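/- arXiv:1909.04460 — 2 statements merged into one kernel-verified Lean document; each statement's English description precedes it below -/
import Mathlib

section
/- Let μ be a partition of n having at least two distinct part sizes (i.e., the corresponding conjugacy class has more than one cycle length). Then the descent map Des on the conjugacy class C_μ ⊆ S_n admits a cyclic extension (cDes, p). -/
open Finset

/-- One-line notation value of a permutation at (1-indexed) position `i`:
`oneline π i = π_i` (as a number in `{1,…,n}`), and `0` if `i` is out of range. -/
def oneline {n : ℕ} (π : Equiv.Perm (Fin n)) (i : ℕ) : ℕ :=
  if h : i - 1 < n then (π ⟨i - 1, h⟩ : ℕ) + 1 else 0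

/-- The descent set `Des(π) = {i ∈ [n-1] : π_i > π_{i+1}}`. -/
def Des {n : ℕ} (π : Equiv.Perm (Fin n)) : Finset ℕ :=
  (Finset.Icc 1 (n - 1)).filter fun i => oneline π (i + 1) < oneline π i

/-- The cyclic shift map on subsets of `[n]`, induced by `i ↦ i + 1 (mod n)`. -/
def sh (n : ℕ) (S : Finset ℕ) : Finset ℕ := S.image fun i => i % n + 1

/-- `(cDes, p)` is a cyclic extension of the descent map `DesT : T → 2^{[n-1]}`. -/
def IsCyclicExtension {T : Type*} (n : ℕ) (DesT : T → Finset ℕ)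
    (cDes : T → Finset ℕ) (p : T ≃ T) : Prop :=
  ∀ t : T,
    cDes t ⊆ Finset.Icc 1 n ∧
    cDes t ∩ Finset.Icc 1 (n - 1) = DesT t ∧
    cDes (p t) = sh n (cDes t) ∧
    cDes t ≠ ∅ ∧ cDes t ≠ Finset.Icc 1 n

/-- The descent map on `T` admits a cyclic extension. -/
def HasCyclicExtension {T : Type*} (n : ℕ) (DesT : T → Finset ℕ) : Prop :=
  ∃ (cDes : T → Finset ℕ) (p : T ≃ T), IsCyclicExtension n DesT cDes p

/-- The cycle type of a permutation, including fixed points as parts equal to `1`;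
a multiset of parts summing to `n`. -/
def fullCycleType {n : ℕ} (π : Equiv.Perm (Fin n)) : Multiset ℕ :=
  π.cycleType + Multiset.replicate (n - π.support.card) 1

section CanonicalForm

variable {n : ℕ} {C : Type*}

/-- A permutation is primitive for a colouring if distinct points of a common cycle read
distinct colour words along the cycle. -/
def IsPrimitive (F : Fin n → C) (ρ : Equiv.Perm (Fin n)) : Prop :=
  ∀ x k, (∀ j, F ((ρ ^ j) x) = F ((ρ ^ (j + k)) x)) → (ρ ^ k) x = x

/-- The permutation is increasing on each fibre of the colouring. -/
def IsFiberMono (F : Fin n → C) (ρ : Equiv.Perm (Fin n)) : Prop :=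
  ∀ x y, x < y → F x = F y → ρ x < ρ y

/-- The infinite colour word read from `x` along its cycle, in the lexicographic order. -/
def colorWord (F : Fin n → C) (ρ : Equiv.Perm (Fin n)) (x : Fin n) : Lex (ℕ → C) :=
  toLex fun k => F ((ρ ^ k) x)

theorem colorWord_eq_iff {F F' : Fin n → C} {ρ ρ' : Equiv.Perm (Fin n)} {x y : Fin n} :
    colorWord F ρ x = colorWord F' ρ' y ↔ ∀ k, F ((ρ ^ k) x) = F' ((ρ' ^ k) y) := by
  unfold colorWord
  rw [toLex_inj, funext_iff]

theorem IsFiberMono.pow_lt {F : Fin n → C} {ρ : Equiv.Perm (Fin n)} (h : IsFiberMono F ρ)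
    {x y : Fin n} (hxy : x < y) :
    ∀ i, (∀ j < i, F ((ρ ^ j) x) = F ((ρ ^ j) y)) → (ρ ^ i) x < (ρ ^ i) y
  | 0, _ => by simpa using hxy
  | i + 1, hi => by
    have := h _ _ (h.pow_lt hxy i fun j hj => hi j (by omega)) (hi i (by omega))
    simpa [pow_succ'] using this

theorem IsFiberMono.isPrimitive {F : Fin n → C} {ρ : Equiv.Perm (Fin n)} (h : IsFiberMono F ρ) :
    IsPrimitive F ρ := by
  intro x k hk
  have hword : ∀ i j, F ((ρ ^ j) x) = F ((ρ ^ (j + k * i)) x) := by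
    intro i
    induction i with
    | zero => simp
    | succ i ih => intro j; rw [ih, hk, mul_add_one, add_assoc]
  have hstep : ∀ i j, F ((ρ ^ j) ((ρ ^ (k * i)) x)) = F ((ρ ^ j) ((ρ ^ (k * (i + 1))) x)) := by
    intro i j
    simp only [← Equiv.Perm.mul_apply, ← pow_add, ← hword]
  have hper : (ρ ^ (k * orderOf ρ)) x = x := by
    rw [mul_comm, pow_mul, pow_orderOf_eq_one, one_pow, Equiv.Perm.one_apply]
  have hpos := orderOf_pos ρ
  have key : ∀ i, (ρ ^ (k * i)) ((ρ ^ k) x) = (ρ ^ (k * (i + 1))) x := by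
    intro i
    rw [← Equiv.Perm.mul_apply, ← pow_add, mul_add_one]
  rcases lt_trichotomy ((ρ ^ k) x) x with hlt | heq | hgt
  · have hdec : StrictAnti fun i => (ρ ^ (k * i)) x := by
      refine strictAnti_nat_of_succ_lt fun i => ?_
      have := h.pow_lt hlt (k * i) fun j _ => by
        rw [hk j, ← Equiv.Perm.mul_apply, ← pow_add]
      rwa [key] at this
    have := hdec hpos
    simp only [hper, mul_zero, pow_zero, Equiv.Perm.one_apply, lt_self_iff_false] at this
  · exact heq
  · have hinc : StrictMono fun i => (ρ ^ (k * i)) x := by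
      refine strictMono_nat_of_lt_succ fun i => ?_
      have := h.pow_lt hgt (k * i) fun j _ => by
        rw [hk j, ← Equiv.Perm.mul_apply, ← pow_add]
      rwa [key] at this
    have := hinc hpos
    simp only [hper, mul_zero, pow_zero, Equiv.Perm.one_apply, lt_self_iff_false] at this

variable [LinearOrder C]

theorem colorWord_lt_iff {F : Fin n → C} {ρ : Equiv.Perm (Fin n)} {x y : Fin n} :
    colorWord F ρ x < colorWord F ρ y ↔
      ∃ i, (∀ j < i, F ((ρ ^ j) x) = F ((ρ ^ j) y)) ∧ F ((ρ ^ i) x) < F ((ρ ^ i) y) :=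
  Iff.rfl

theorem le_of_colorWord_le {F : Fin n → C} {ρ : Equiv.Perm (Fin n)} {x y : Fin n}
    (h : colorWord F ρ x ≤ colorWord F ρ y) : F x ≤ F y := by
  contrapose! h
  exact colorWord_lt_iff.2 ⟨0, by simp, by simpa using h⟩

theorem IsFiberMono.monotone_colorWord {F : Fin n → C} {ρ : Equiv.Perm (Fin n)}
    (hF : Monotone F) (h : IsFiberMono F ρ) : Monotone (colorWord F ρ) := by
  intro x y hxy
  rcases hxy.eq_or_lt with rfl | hxy
  · rfl
  by_contra! hlt
  obtain ⟨i, hi, hi'⟩ := colorWord_lt_iff.1 hlt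
  exact hi'.not_ge (hF (h.pow_lt hxy i fun j hj => (hi j hj).symm).le)

/-- Every primitive permutation is conjugate to one in canonical form. -/
theorem IsPrimitive.exists_isFiberMono_conj {F : Fin n → C} {ρ : Equiv.Perm (Fin n)}
    (h : IsPrimitive F ρ) :
    ∃ g : Equiv.Perm (Fin n), Monotone (F ∘ g) ∧ IsFiberMono (F ∘ g) (g⁻¹ * ρ * g) := by
  let rep : Fin n → Fin n := fun x =>
    (Quotient.mk (Equiv.Perm.SameCycle.setoid ρ) x).out
  have hrep : ∀ x y, rep x = rep y ↔ ρ.SameCycle x y := fun x y =>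
    Quotient.out_inj.trans Quotient.eq
  let key : Fin n → Lex (Lex (ℕ → C) × Fin n) := fun x => toLex (colorWord F ρ x, rep x)
  have hkey : Function.Injective key := by
    intro x y hxy
    have h1 : colorWord F ρ x = colorWord F ρ y := congrArg (fun z => (ofLex z).1) hxy
    have h2 : rep x = rep y := congrArg (fun z => (ofLex z).2) hxy
    obtain ⟨k, -, rfl⟩ := ((hrep x y).1 h2).exists_pow_eq'
    refine (h x k fun j => ?_).symm
    rw [colorWord_eq_iff.1 h1 j, ← Equiv.Perm.mul_apply, ← pow_add]
  have hsort := Tuple.monotone_sort key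
  set g := Tuple.sort key
  refine ⟨g, fun x y hxy => le_of_colorWord_le (F := F) (ρ := ρ) ?_, fun x y hxy hF => ?_⟩
  · rcases Prod.Lex.le_iff.1 (hsort hxy) with h1 | h1
    · exact h1.le
    · exact h1.1.le
  · simp only [Equiv.Perm.mul_apply]
    by_contra! hle
    have hlt : key (g x) < key (g y) :=
      (hsort hxy.le).lt_of_ne fun e => hxy.ne (g.injective (hkey e))
    have hge := hsort hle
    simp only [Function.comp_apply, ← Equiv.Perm.mul_apply, mul_inv_cancel_left] at hge
    refine hge.not_gt (Prod.Lex.lt_iff.2 ?_)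
    rcases Prod.Lex.lt_iff.1 hlt with h1 | ⟨h1, h2⟩
    · left
      obtain ⟨i, hi, hi'⟩ := colorWord_lt_iff.1 h1
      cases i with
      | zero => exact absurd hF (ne_of_lt (by simpa using hi'))
      | succ i =>
        refine colorWord_lt_iff.2 ⟨i, fun j hj => ?_, ?_⟩
        · simpa [pow_succ] using hi (j + 1) (by omega)
        · simpa [pow_succ] using hi'
    · right
      refine ⟨colorWord_eq_iff.2 fun k => ?_, ?_⟩
      · simpa [pow_succ] using colorWord_eq_iff.1 h1 (k + 1)
      · have e : ∀ z, rep (ρ z) = rep z := fun z =>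
            (hrep _ _).2 (Equiv.Perm.sameCycle_apply_left.2 (.refl _ _))
        change rep (ρ (g x)) < rep (ρ (g y))
        rw [e, e]
        exact h2

/-- Canonical forms that are conjugate by a colour-preserving permutation are equal. -/
theorem IsFiberMono.eq_of_conj {F F' : Fin n → C} {ρ ρ' h : Equiv.Perm (Fin n)}
    (hF : Monotone F) (hF' : Monotone F') (hρ : IsFiberMono F ρ) (hρ' : IsFiberMono F' ρ')
    (hh : ∀ x, F' (h x) = F x) (hconj : ρ' = h * ρ * h⁻¹) : ρ = ρ' := by
  have hpow : ∀ k x, (ρ' ^ k) (h x) = h ((ρ ^ k) x) := by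
    intro k x
    rw [hconj, conj_pow]
    simp
  have hW : colorWord F ρ = colorWord F' ρ' := by
    have hcomp : colorWord F' ρ' ∘ h = colorWord F ρ := by
      funext x
      exact colorWord_eq_iff.2 fun k => by rw [hpow, hh]
    have := Tuple.unique_monotone (f := colorWord F' ρ') (σ := h) (τ := 1)
      (by rw [hcomp]; exact hρ.monotone_colorWord hF) (hρ'.monotone_colorWord hF')
    rw [← hcomp, this]
    rfl
  have hW' : ∀ k x, F ((ρ ^ k) x) = F' ((ρ' ^ k) x) := fun k x =>
    colorWord_eq_iff.1 (congrFun hW x) k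
  set δ := ρ'⁻¹ * ρ with hδ
  have hδρ : ∀ x, ρ' (δ x) = ρ x := fun x => by simp [hδ]
  have hsucc : ∀ k x, F' ((ρ' ^ (k + 1)) (δ x)) = F ((ρ ^ (k + 1)) x) := by
    intro k x
    rw [pow_succ, Equiv.Perm.mul_apply, hδρ, ← hW', pow_succ, Equiv.Perm.mul_apply]
  have hδW : ∀ x, colorWord F ρ x = colorWord F' ρ' (δ x) := by
    intro x
    refine colorWord_eq_iff.2 fun k => ?_
    have hN : 0 < orderOf ρ * orderOf ρ' := Nat.mul_pos (orderOf_pos ρ) (orderOf_pos ρ')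
    have e1 : ρ ^ (k + orderOf ρ * orderOf ρ') = ρ ^ k := by
      rw [pow_add, pow_mul, pow_orderOf_eq_one, one_pow, mul_one]
    have e2 : ρ' ^ (k + orderOf ρ * orderOf ρ') = ρ' ^ k := by
      rw [pow_add, mul_comm (orderOf ρ), pow_mul, pow_orderOf_eq_one, one_pow, mul_one]
    have := hsucc (k + orderOf ρ * orderOf ρ' - 1) x
    rw [show k + orderOf ρ * orderOf ρ' - 1 + 1 = k + orderOf ρ * orderOf ρ' by omega, e1, e2]
      at this
    exact this.symm
  have hmono : StrictMono δ := by
    intro x y hxy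
    by_contra! hle
    have h1 := hρ'.monotone_colorWord hF' hle
    rw [← hδW, ← hδW] at h1
    have h2 := le_antisymm h1 (hρ.monotone_colorWord hF hxy.le)
    have hne : δ y < δ x := hle.lt_of_ne fun e => hxy.ne' (δ.injective e)
    have h3 := hρ' _ _ hne (by
      simpa using colorWord_eq_iff.1 (((hδW y).symm.trans h2).trans (hδW x)) 0)
    rw [hδρ, hδρ] at h3
    exact h3.not_gt (hρ _ _ hxy (by simpa using colorWord_eq_iff.1 h2.symm 0))
  ext x
  rw [← hδρ x, le_antisymm hmono.apply_le hmono.le_apply]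

end CanonicalForm

section ClassCount

variable {n : ℕ} {C C' : Type*}

/-- Conjugacy by permutations preserving the colouring. -/
def colorConj (F : Fin n → C) : Setoid (Equiv.Perm (Fin n)) where
  r ρ σ := ∃ h : Equiv.Perm (Fin n), (∀ x, F (h x) = F x) ∧ σ = h * ρ * h⁻¹
  iseqv :=
    { refl := fun ρ => ⟨1, by simp, by simp⟩
      symm := by
        rintro ρ _ ⟨h, hF, rfl⟩
        exact ⟨h⁻¹, fun x => by rw [← hF (h⁻¹ x), ← Equiv.Perm.mul_apply, mul_inv_cancel]; rfl,
          by group⟩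
      trans := by
        rintro ρ _ _ ⟨h, hF, rfl⟩ ⟨h', hF', rfl⟩
        exact ⟨h' * h, fun x => by rw [Equiv.Perm.mul_apply, hF', hF], by group⟩ }

/-- The number of classes of primitive permutations in `K`, up to conjugacy by permutations
preserving the colouring. -/
noncomputable def numClasses (F : Fin n → C) (K : Set (Equiv.Perm (Fin n))) : ℕ :=
  (Quotient.mk (colorConj F) '' {ρ | ρ ∈ K ∧ IsPrimitive F ρ}).ncard

theorem isPrimitive_conj_iff {F : Fin n → C} {F' : Fin n → C'} {e ρ : Equiv.Perm (Fin n)}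
    {c : C → C'} (hc : Function.Injective c) (hF : ∀ x, F' (e x) = c (F x)) :
    IsPrimitive F' (e * ρ * e⁻¹) ↔ IsPrimitive F ρ := by
  have hpow : ∀ k x, ((e * ρ * e⁻¹) ^ k) (e x) = e ((ρ ^ k) x) := by
    intro k x
    rw [conj_pow]
    simp
  unfold IsPrimitive
  rw [← e.forall_congr_right]
  simp only [hpow, hF, hc.eq_iff, e.injective.eq_iff]

theorem numClasses_congr {F : Fin n → C} {F' : Fin n → C'} {K K' : Set (Equiv.Perm (Fin n))}
    (e : Equiv.Perm (Fin n)) {c : C → C'} (hc : Function.Injective c)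
    (hF : ∀ x, F' (e x) = c (F x)) (hK : ∀ ρ, e * ρ * e⁻¹ ∈ K' ↔ ρ ∈ K) :
    numClasses F K = numClasses F' K' := by
  have hF' : ∀ x, F' x = c (F (e⁻¹ x)) := fun x => by rw [← hF]; simp
  let φ : Quotient (colorConj F) → Quotient (colorConj F') :=
    Quotient.map (fun ρ => e * ρ * e⁻¹) (by
      rintro ρ _ ⟨h, hh, rfl⟩
      exact ⟨e * h * e⁻¹, fun x => by simp [hF', hh], by group⟩)
  have hφ : Function.Injective φ := by
    intro a b
    induction a using Quotient.inductionOn with | _ a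
    induction b using Quotient.inductionOn with | _ b
    intro hab
    obtain ⟨h, hh, hb⟩ := Quotient.exact hab
    refine Quotient.sound ⟨e⁻¹ * h * e, fun x => hc ?_, ?_⟩
    · rw [← hF, ← hF]
      simp [hh]
    · have hb : e * b * e⁻¹ = h * (e * a * e⁻¹) * h⁻¹ := hb
      calc b = e⁻¹ * (e * b * e⁻¹) * e := by group
        _ = _ := by rw [hb]; group
  unfold numClasses
  rw [← Set.ncard_image_of_injective _ hφ]
  congr 1
  ext q
  constructor
  · rintro ⟨_, ⟨ρ, ⟨hρ, hp⟩, rfl⟩, rfl⟩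
    exact ⟨_, ⟨(hK ρ).2 hρ, (isPrimitive_conj_iff hc hF).2 hp⟩, rfl⟩
  · rintro ⟨σ, ⟨hσ, hp⟩, rfl⟩
    obtain ⟨ρ, rfl⟩ : ∃ ρ, e * ρ * e⁻¹ = σ := ⟨e⁻¹ * σ * e, by group⟩
    exact ⟨_, ⟨ρ, ⟨(hK ρ).1 hσ, (isPrimitive_conj_iff hc hF).1 hp⟩, rfl⟩, rfl⟩

variable [LinearOrder C]

theorem comp_eq_of_monotone {F : Fin n → C} {g : Equiv.Perm (Fin n)} (hF : Monotone F)
    (hg : Monotone (F ∘ g)) : F ∘ g = F :=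
  Tuple.unique_monotone (f := F) (σ := g) (τ := 1) hg hF

/-- Each class contains exactly one permutation in canonical form. -/
theorem numClasses_eq_ncard {F : Fin n → C} (hF : Monotone F) {K : Set (Equiv.Perm (Fin n))}
    (hK : ∀ h ρ : Equiv.Perm (Fin n), (∀ x, F (h x) = F x) → ρ ∈ K → h * ρ * h⁻¹ ∈ K) :
    numClasses F K = {ρ | ρ ∈ K ∧ IsFiberMono F ρ}.ncard := by
  have himage : Quotient.mk (colorConj F) '' {ρ | ρ ∈ K ∧ IsPrimitive F ρ} =
      Quotient.mk (colorConj F) '' {ρ | ρ ∈ K ∧ IsFiberMono F ρ} := by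
    refine Set.Subset.antisymm ?_ (Set.image_mono fun ρ h => ⟨h.1, h.2.isPrimitive⟩)
    rintro _ ⟨ρ, ⟨hρ, hp⟩, rfl⟩
    obtain ⟨g, hg, hm⟩ := hp.exists_isFiberMono_conj
    have hFg := comp_eq_of_monotone hF hg
    have hgF : ∀ x, F (g⁻¹ x) = F x := fun x => by
      rw [← congrFun hFg (g⁻¹ x)]
      simp
    rw [hFg] at hm
    refine ⟨g⁻¹ * ρ * g, ⟨by simpa using hK g⁻¹ ρ hgF hρ, hm⟩, Quotient.sound ?_⟩
    exact ⟨g, fun x => congrFun hFg x, by group⟩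
  rw [numClasses, himage, Set.InjOn.ncard_image]
  rintro ρ ⟨-, hρ⟩ σ ⟨-, hσ⟩ h
  obtain ⟨h, hh, hconj⟩ := Quotient.exact h
  exact hρ.eq_of_conj hF hF hσ hh hconj

/-- Refining a monotone colouring by a conjugation-equivariant statistic does not change the
number of classes. -/
theorem numClasses_eq_ncard_refine {f : Fin n → C} (hf : Monotone f)
    {K : Set (Equiv.Perm (Fin n))} (hK : ∀ h ρ : Equiv.Perm (Fin n), ρ ∈ K → h * ρ * h⁻¹ ∈ K)
    {χ : Equiv.Perm (Fin n) → Fin n → Bool} (hχ : ∀ h ρ x, χ (h * ρ * h⁻¹) (h x) = χ ρ x) :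
    numClasses f K = {ρ | ρ ∈ K ∧ Monotone (fun x => toLex (f x, χ ρ x)) ∧
      IsFiberMono (fun x => toLex (f x, χ ρ x)) ρ}.ncard := by
  have hinv : ∀ ρ k x, χ ρ ((ρ ^ k) x) = χ ρ x := by
    intro ρ k x
    have := hχ (ρ ^ k) ρ x
    rwa [show ρ ^ k * ρ * (ρ ^ k)⁻¹ = ρ by group] at this
  have hprim : ∀ ρ, IsPrimitive (fun x => toLex (f x, χ ρ x)) ρ ↔ IsPrimitive f ρ := by
    intro ρ
    simp only [IsPrimitive, hinv, toLex_inj, Prod.mk.injEq, and_true]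
  have himage : Quotient.mk (colorConj f) '' {ρ | ρ ∈ K ∧ IsPrimitive f ρ} =
      Quotient.mk (colorConj f) '' {ρ | ρ ∈ K ∧ Monotone (fun x => toLex (f x, χ ρ x)) ∧
        IsFiberMono (fun x => toLex (f x, χ ρ x)) ρ} := by
    refine Set.Subset.antisymm ?_
      (Set.image_mono fun ρ h => ⟨h.1, (hprim ρ).1 h.2.2.isPrimitive⟩)
    rintro _ ⟨ρ, ⟨hρ, hp⟩, rfl⟩
    obtain ⟨g, hg, hm⟩ := ((hprim ρ).2 hp).exists_isFiberMono_conj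
    have hfg : f ∘ g = f := comp_eq_of_monotone hf fun x y hxy => by
      rcases Prod.Lex.le_iff.1 (hg hxy) with h | h
      · exact h.le
      · exact h.1.le
    have hF : (fun x => toLex (f x, χ ρ x)) ∘ g =
        fun x => toLex (f x, χ (g⁻¹ * ρ * g) x) := by
      funext x
      have := hχ g⁻¹ ρ (g x)
      simp only [inv_inv, ← Equiv.Perm.mul_apply, inv_mul_cancel, Equiv.Perm.one_apply] at this
      simp only [Function.comp_apply, this, ← congrFun hfg x]
    rw [hF] at hg hm
    refine ⟨g⁻¹ * ρ * g, ⟨by simpa using hK g⁻¹ ρ hρ, hg, hm⟩, Quotient.sound ?_⟩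
    exact ⟨g, fun x => congrFun hfg x, by group⟩
  rw [numClasses, himage, Set.InjOn.ncard_image]
  rintro ρ ⟨-, hm, hρ⟩ σ ⟨-, hm', hσ⟩ h
  obtain ⟨h, hh, rfl⟩ := Quotient.exact h
  exact hρ.eq_of_conj hm hm' hσ (fun x => by simp only [hh, hχ]) rfl

end ClassCount

section Blocks

variable {m : ℕ}

theorem exists_finRotate_pow_eq_of_le (x y : Fin (m + 1)) (h : x ≤ y) :
    ∃ k, ((finRotate (m + 1)) ^ k) x = y := by
  induction y using Fin.induction with
  | zero => exact ⟨0, by simpa using h⟩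
  | succ i ih =>
    rcases h.eq_or_lt with rfl | hlt
    · exact ⟨0, rfl⟩
    · obtain ⟨k, hk⟩ := ih (Fin.le_castSucc_iff.2 hlt)
      exact ⟨k + 1, by rw [pow_succ', Equiv.Perm.mul_apply, hk]; simp⟩

theorem exists_finRotate_pow_eq (x y : Fin (m + 1)) :
    ∃ k, ((finRotate (m + 1)) ^ k) x = y := by
  obtain ⟨k, hk⟩ := exists_finRotate_pow_eq_of_le x (Fin.last m) (Fin.le_last x)
  obtain ⟨l, hl⟩ := exists_finRotate_pow_eq_of_le 0 y (Fin.zero_le y)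
  refine ⟨l + (1 + k), ?_⟩
  rw [pow_add, pow_add, Equiv.Perm.mul_apply, Equiv.Perm.mul_apply, hk, pow_one,
    finRotate_last, hl]

/-- The first element of `J` reached from `i` by cyclic rotation, starting at `i` itself. -/
noncomputable def blockEnd (J : Finset (Fin (m + 1))) (i : Fin (m + 1)) : Fin (m + 1) :=
  ((finRotate (m + 1)) ^ sInf {d | ((finRotate (m + 1)) ^ d) i ∈ J}) i

theorem blockEnd_of_mem {J : Finset (Fin (m + 1))} {i : Fin (m + 1)} (hi : i ∈ J) :
    blockEnd J i = i := by
  have : sInf {d | ((finRotate (m + 1)) ^ d) i ∈ J} = 0 :=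
    Nat.sInf_eq_zero.2 (Or.inl (by simpa using hi))
  rw [blockEnd, this]
  rfl

theorem blockEnd_finRotate {J : Finset (Fin (m + 1))} (hJ : J.Nonempty) {i : Fin (m + 1)}
    (hi : i ∉ J) : blockEnd J (finRotate (m + 1) i) = blockEnd J i := by
  obtain ⟨j, hj⟩ := hJ
  obtain ⟨k, hk⟩ := exists_finRotate_pow_eq i j
  have h0 : sInf {d | ((finRotate (m + 1)) ^ d) i ∈ J} ≠ 0 := by
    intro h
    rcases Nat.sInf_eq_zero.1 h with h | h
    · exact hi (by simpa using h)
    · have : k ∈ ({d | ((finRotate (m + 1)) ^ d) i ∈ J} : Set ℕ) := by simpa [hk] using hj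
      simp [h] at this
  have h1 := Nat.sInf_add (n := 1) (p := fun d => ((finRotate (m + 1)) ^ d) i ∈ J) (by
    simpa using Nat.one_le_iff_ne_zero.2 h0)
  simp only [pow_succ, Equiv.Perm.mul_apply] at h1
  rw [blockEnd, blockEnd, ← h1, pow_succ, Equiv.Perm.mul_apply]

theorem blockEnd_map_finRotate (J : Finset (Fin (m + 1))) (i : Fin (m + 1)) :
    blockEnd (J.map (finRotate (m + 1)).toEmbedding) (finRotate (m + 1) i) =
      finRotate (m + 1) (blockEnd J i) := by
  have hcomm : ∀ d, ((finRotate (m + 1)) ^ d) (finRotate (m + 1) i) =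
      finRotate (m + 1) (((finRotate (m + 1)) ^ d) i) := by
    intro d
    rw [← Equiv.Perm.mul_apply, ← Equiv.Perm.mul_apply, ← pow_succ, ← pow_succ']
  unfold blockEnd
  simp only [hcomm, Finset.mem_map_equiv, Equiv.symm_apply_apply]

theorem le_blockEnd {J : Finset (Fin (m + 1))} (hJ : Fin.last m ∈ J) (i : Fin (m + 1)) :
    i ≤ blockEnd J i := by
  induction i using Fin.reverseInduction with
  | last => rw [blockEnd_of_mem hJ]
  | cast i ih =>
    by_cases hi : i.castSucc ∈ J
    · rw [blockEnd_of_mem hi]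
    · rw [← blockEnd_finRotate ⟨_, hJ⟩ hi]
      simp only [finRotate_apply, Fin.coeSucc_eq_succ]
      exact (Fin.castSucc_lt_succ).le.trans ih

theorem blockEnd_castSucc_lt_succ {J : Finset (Fin (m + 1))} (hJ : Fin.last m ∈ J) {i : Fin m}
    (hi : i.castSucc ∈ J) : blockEnd J i.castSucc < blockEnd J i.succ := by
  rw [blockEnd_of_mem hi]
  exact (Fin.castSucc_lt_succ).trans_le (le_blockEnd hJ _)

theorem blockEnd_castSucc_eq_succ_iff {J : Finset (Fin (m + 1))} (hJ : Fin.last m ∈ J)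
    {i : Fin m} : blockEnd J i.castSucc = blockEnd J i.succ ↔ i.castSucc ∉ J := by
  refine ⟨fun h hi => (blockEnd_castSucc_lt_succ hJ hi).ne h, fun hi => ?_⟩
  rw [← blockEnd_finRotate ⟨_, hJ⟩ hi]
  simp

theorem monotone_blockEnd {J : Finset (Fin (m + 1))} (hJ : Fin.last m ∈ J) :
    Monotone (blockEnd J) := by
  refine Fin.monotone_iff_le_succ.2 fun i => ?_
  by_cases hi : i.castSucc ∈ J
  · exact (blockEnd_castSucc_lt_succ hJ hi).le
  · exact ((blockEnd_castSucc_eq_succ_iff hJ).2 hi).le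

theorem isFiberMono_iff_castSucc_succ {C : Type*} [PartialOrder C] {F : Fin (m + 1) → C}
    (hF : Monotone F) {ρ : Equiv.Perm (Fin (m + 1))} :
    IsFiberMono F ρ ↔ ∀ i : Fin m, F i.castSucc = F i.succ → ρ i.castSucc < ρ i.succ := by
  refine ⟨fun h i => h _ _ Fin.castSucc_lt_succ, fun h x y => ?_⟩
  induction y using Fin.induction with
  | zero => exact fun hx => absurd hx (Fin.not_lt_zero x)
  | succ i ih =>
    intro hx hxy
    have hle := Fin.le_castSucc_iff.2 hx
    have hi : F i.castSucc = F i.succ :=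
      le_antisymm (hF Fin.castSucc_lt_succ.le) (hxy ▸ hF hle)
    rcases hle.eq_or_lt with rfl | hlt
    · exact h i hi
    · exact (ih hlt (hxy.trans hi.symm)).trans (h i hi)

theorem monotone_toLex_blockEnd_iff {J : Finset (Fin (m + 1))} (hJ : Fin.last m ∈ J)
    {χ : Fin (m + 1) → Bool} :
    Monotone (fun x => toLex (blockEnd J x, χ x)) ↔
      ∀ i : Fin m, χ i.castSucc = true → χ i.succ = false → i.castSucc ∈ J := by
  rw [Fin.monotone_iff_le_succ]
  refine forall_congr' fun i => ?_
  rw [Prod.Lex.le_iff]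
  by_cases hi : i.castSucc ∈ J
  · simp [hi, blockEnd_castSucc_lt_succ hJ hi]
  · have h := (blockEnd_castSucc_eq_succ_iff hJ).2 hi
    simp only [ofLex_toLex, h, lt_self_iff_false, false_or, true_and, hi]
    cases χ i.castSucc <;> cases χ i.succ <;> simp

/-- Positions at which the flag drops cyclically. -/
def flagDrops (χ : Fin (m + 1) → Bool) : Finset (Fin (m + 1)) :=
  Finset.univ.filter fun i => χ i = true ∧ χ (finRotate (m + 1) i) = false

/-- The descent set of a permutation, as a set of positions `i` in `Fin (m + 1)`. -/
def desSet (ρ : Equiv.Perm (Fin (m + 1))) : Finset (Fin (m + 1)) :=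
  Finset.univ.filter fun i => i ≠ Fin.last m ∧ ρ (finRotate (m + 1) i) < ρ i

/-- The flagged cyclic descent set: flag drops, descents between equally flagged neighbours,
and the last position. -/
def flagDes (χ : Fin (m + 1) → Bool) (ρ : Equiv.Perm (Fin (m + 1))) : Finset (Fin (m + 1)) :=
  Finset.univ.filter fun i => i = Fin.last m ∨ (χ i = true ∧ χ (finRotate (m + 1) i) = false) ∨
    (χ i = χ (finRotate (m + 1) i) ∧ ρ (finRotate (m + 1) i) < ρ i)

theorem castSucc_lt_succ_iff_not_lt (ρ : Equiv.Perm (Fin (m + 1))) (i : Fin m) :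
    ρ i.castSucc < ρ i.succ ↔ ¬ ρ i.succ < ρ i.castSucc :=
  ⟨fun h => h.not_gt, fun h =>
    (not_lt.1 h).lt_of_ne fun e => Fin.castSucc_lt_succ.ne (ρ.injective e)⟩

theorem isFiberMono_blockEnd_iff {J : Finset (Fin (m + 1))} (hJ : Fin.last m ∈ J)
    {ρ : Equiv.Perm (Fin (m + 1))} : IsFiberMono (blockEnd J) ρ ↔ desSet ρ ⊆ J := by
  rw [isFiberMono_iff_castSucc_succ (monotone_blockEnd hJ)]
  simp only [blockEnd_castSucc_eq_succ_iff hJ, castSucc_lt_succ_iff_not_lt, desSet,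
    Finset.subset_iff, Finset.mem_filter, Finset.mem_univ, true_and, Fin.forall_fin_succ',
    finRotate_apply, Fin.coeSucc_eq_succ, hJ, implies_true, and_true]
  refine forall_congr' fun i => ?_
  have := Fin.castSucc_ne_last i
  tauto

theorem isFiberMono_toLex_blockEnd_iff {J : Finset (Fin (m + 1))} (hJ : Fin.last m ∈ J)
    {χ : Fin (m + 1) → Bool} {ρ : Equiv.Perm (Fin (m + 1))} :
    (Monotone (fun x => toLex (blockEnd J x, χ x)) ∧
      IsFiberMono (fun x => toLex (blockEnd J x, χ x)) ρ) ↔ flagDes χ ρ ⊆ J := by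
  have key : flagDes χ ρ ⊆ J ↔ ∀ i : Fin m,
      (χ i.castSucc = true → χ i.succ = false → i.castSucc ∈ J) ∧
      (i.castSucc ∉ J → χ i.castSucc = χ i.succ → ρ i.castSucc < ρ i.succ) := by
    simp only [castSucc_lt_succ_iff_not_lt, flagDes,
      Finset.subset_iff, Finset.mem_filter, Finset.mem_univ, true_and, Fin.forall_fin_succ',
      finRotate_apply, Fin.coeSucc_eq_succ, hJ, implies_true, and_true]
    refine forall_congr' fun i => ?_
    have := Fin.castSucc_ne_last i
    tauto
  rw [key, forall_and, ← monotone_toLex_blockEnd_iff hJ]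
  refine and_congr_right fun hm => ?_
  rw [isFiberMono_iff_castSucc_succ hm]
  simp only [toLex_inj, Prod.mk.injEq, blockEnd_castSucc_eq_succ_iff hJ, and_imp]

theorem flagDrops_subset_flagDes (χ : Fin (m + 1) → Bool) (ρ : Equiv.Perm (Fin (m + 1))) :
    flagDrops χ ⊆ flagDes χ ρ := by
  intro i hi
  simp only [flagDrops, flagDes, Finset.mem_filter, Finset.mem_univ, true_and] at hi ⊢
  exact Or.inr (Or.inl hi)

theorem flagDrops_shift (χ : Fin (m + 1) → Bool) :
    flagDrops (χ ∘ (finRotate (m + 1)).symm) =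
      (flagDrops χ).map (finRotate (m + 1)).toEmbedding := by
  ext i
  obtain ⟨i, rfl⟩ := (finRotate (m + 1)).surjective i
  simp only [flagDrops, Finset.mem_map_equiv, Finset.mem_filter, Finset.mem_univ, true_and,
    Function.comp_apply, Equiv.symm_apply_apply]

end Blocks

section SubsetSums

variable {α β : Type*}

theorem eq_of_sum_powerset_eq {a b : Finset α → ℕ} (J : Finset α)
    (h : ∀ I ⊆ J, ∑ L ∈ I.powerset, a L = ∑ L ∈ I.powerset, b L) : a J = b J := by
  classical
  induction J using Finset.strongInduction with
  | H J ih =>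
    have hJ := h J subset_rfl
    have hrest : ∑ L ∈ J.powerset.erase J, a L = ∑ L ∈ J.powerset.erase J, b L := by
      refine Finset.sum_congr rfl fun L hL => ?_
      have hL' := Finset.mem_erase.1 hL
      have hsub := Finset.mem_powerset.1 hL'.2
      exact ih L (hsub.ssubset_of_ne hL'.1) fun I hI => h I (hI.trans hsub)
    rw [← Finset.add_sum_erase _ _ (Finset.mem_powerset_self J),
      ← Finset.add_sum_erase _ b (Finset.mem_powerset_self J), hrest] at hJ
    exact Nat.add_right_cancel hJ

theorem sum_powerset_map (e : Equiv.Perm α) (a : Finset α → ℕ) (J : Finset α) :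
    ∑ I ∈ J.powerset, a (I.map e.toEmbedding) = ∑ I ∈ (J.map e.toEmbedding).powerset, a I := by
  refine Finset.sum_equiv e.finsetCongr (fun I => ?_) fun I _ => rfl
  simp [Equiv.finsetCongr_apply]

theorem sum_ncard_fiber [Finite α] [DecidableEq β] (P : α → Prop) (g : α → β) (s : Finset β) :
    ∑ b ∈ s, {x | P x ∧ g x = b}.ncard = {x | P x ∧ g x ∈ s}.ncard := by
  classical
  have := Fintype.ofFinite α
  have hcard : ∀ Q : α → Prop, {x | Q x}.ncard = (Finset.univ.filter Q).card := fun Q => by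
    rw [← Set.ncard_coe_finset]
    simp
  simp only [hcard]
  rw [Finset.card_eq_sum_card_fiberwise (f := g) (t := s) fun x hx => (by simpa using hx : _ ∧ _).2]
  refine Finset.sum_congr rfl fun b hb => ?_
  congr 1
  ext x
  simp only [Finset.mem_filter, Finset.mem_univ, true_and]
  exact ⟨fun h => ⟨⟨h.1, h.2 ▸ hb⟩, h.2⟩, fun h => ⟨h.1.1, h.2⟩⟩

end SubsetSums

section FlagCount

variable {m : ℕ} {K : Set (Equiv.Perm (Fin (m + 1)))}
  {st : Equiv.Perm (Fin (m + 1)) → Fin (m + 1) → Bool}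

/-- The number of classes of permutations in `K` with statistic `χ`, coloured by the cyclic
blocks of `J` and by `χ`; zero unless every flag drop is a block end. -/
noncomputable def flagCount (K : Set (Equiv.Perm (Fin (m + 1))))
    (st : Equiv.Perm (Fin (m + 1)) → Fin (m + 1) → Bool) (χ : Fin (m + 1) → Bool)
    (J : Finset (Fin (m + 1))) : ℕ :=
  if flagDrops χ ⊆ J then
    numClasses (fun x => toLex (blockEnd J x, χ x)) {ρ | ρ ∈ K ∧ st ρ = χ}
  else 0

theorem flagCount_shift (hK : ∀ h ρ : Equiv.Perm (Fin (m + 1)), h * ρ * h⁻¹ ∈ K ↔ ρ ∈ K)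
    (hst : ∀ h ρ x, st (h * ρ * h⁻¹) (h x) = st ρ x) (χ : Fin (m + 1) → Bool)
    (J : Finset (Fin (m + 1))) :
    flagCount K st (χ ∘ (finRotate (m + 1)).symm) (J.map (finRotate (m + 1)).toEmbedding) =
      flagCount K st χ J := by
  unfold flagCount
  simp only [flagDrops_shift, Finset.map_subset_map]
  congr 1
  refine (numClasses_congr (finRotate (m + 1))
    (c := fun z => toLex (finRotate (m + 1) (ofLex z).1, (ofLex z).2)) ?_ ?_ ?_).symm
  · intro z w h
    have h' := toLex_inj.1 h
    rw [Prod.mk.injEq] at h'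
    exact ofLex_inj.1 (Prod.ext ((finRotate (m + 1)).injective h'.1) h'.2)
  · intro x
    simp only [blockEnd_map_finRotate, Function.comp_apply, Equiv.symm_apply_apply, ofLex_toLex]
  · intro ρ
    simp only [Set.mem_ofPred_eq, hK, funext_iff, Function.comp_apply]
    rw [← (finRotate (m + 1)).forall_congr_right]
    simp only [hst, Equiv.symm_apply_apply]

theorem flagCount_eq_ncard (hK : ∀ h ρ : Equiv.Perm (Fin (m + 1)), h * ρ * h⁻¹ ∈ K ↔ ρ ∈ K)
    (hst : ∀ h ρ x, st (h * ρ * h⁻¹) (h x) = st ρ x) (χ : Fin (m + 1) → Bool)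
    {J : Finset (Fin (m + 1))} (hJ : Fin.last m ∈ J) :
    flagCount K st χ J = {ρ | (ρ ∈ K ∧ flagDes χ ρ ⊆ J) ∧ st ρ = χ}.ncard := by
  unfold flagCount
  split_ifs with hY
  · have hm : Monotone (fun x => toLex (blockEnd J x, χ x)) :=
      (monotone_toLex_blockEnd_iff hJ).2 fun i h1 h2 =>
        hY (by simp [flagDrops, finRotate_apply, h1, h2])
    rw [numClasses_eq_ncard hm]
    · congr 1
      ext ρ
      simp only [Set.mem_ofPred_eq, ← isFiberMono_toLex_blockEnd_iff hJ, hm, true_and]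
      tauto
    · rintro h ρ hh ⟨hρ, rfl⟩
      refine ⟨(hK h ρ).2 hρ, funext fun x => ?_⟩
      obtain ⟨x, rfl⟩ := h.surjective x
      have := toLex_inj.1 (hh x)
      rw [Prod.mk.injEq] at this
      rw [hst, this.2]
  · symm
    rw [Set.ncard_eq_zero]
    ext ρ
    simp only [Set.mem_ofPred_eq, Set.mem_empty_iff_false, iff_false]
    exact fun h => hY ((flagDrops_subset_flagDes χ ρ).trans h.1.2)

theorem sum_flagCount_eq_ncard
    (hK : ∀ h ρ : Equiv.Perm (Fin (m + 1)), h * ρ * h⁻¹ ∈ K ↔ ρ ∈ K)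
    (hst : ∀ h ρ x, st (h * ρ * h⁻¹) (h x) = st ρ x)
    {J : Finset (Fin (m + 1))} (hJ : Fin.last m ∈ J) :
    ∑ χ, flagCount K st χ J = {ρ | ρ ∈ K ∧ desSet ρ ⊆ J}.ncard := by
  have h1 := numClasses_eq_ncard (monotone_blockEnd hJ) fun h ρ _ => (hK h ρ).2
  have h2 := numClasses_eq_ncard_refine (monotone_blockEnd hJ) (fun h ρ => (hK h ρ).2) hst
  simp only [isFiberMono_blockEnd_iff hJ, isFiberMono_toLex_blockEnd_iff hJ] at h1 h2
  rw [← h1, h2]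
  have h3 := sum_ncard_fiber (fun ρ => ρ ∈ K ∧ flagDes (st ρ) ρ ⊆ J) st Finset.univ
  simp only [Finset.mem_univ, and_true] at h3
  rw [← h3]
  refine Finset.sum_congr rfl fun χ _ => ?_
  rw [flagCount_eq_ncard hK hst χ hJ]
  congr 1
  ext ρ
  simp only [Set.mem_ofPred_eq]
  exact and_congr_left (by rintro rfl; rfl)

/-- `a` is a Möbius inverse of `H` supported on nonempty proper subsets. -/
def IsProperInverse (H a : Finset (Fin (m + 1)) → ℕ) : Prop :=
  (∀ J, ∑ I ∈ J.powerset, a I = H J) ∧ a ∅ = 0 ∧ a Finset.univ = 0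

theorem exists_isProperInverse_of_last
    (hK : ∀ h ρ : Equiv.Perm (Fin (m + 1)), h * ρ * h⁻¹ ∈ K ↔ ρ ∈ K)
    (hst : ∀ h ρ x, st (h * ρ * h⁻¹) (h x) = st ρ x) {χ : Fin (m + 1) → Bool}
    (hlast : χ (Fin.last m) = true) (hzero : χ 0 = false) :
    ∃ a, IsProperInverse (flagCount K st χ) a := by
  have hdrop : Fin.last m ∈ flagDrops χ := by
    simp [flagDrops, hlast, hzero]
  have hne : ∃ i, χ i = false ∧ χ (finRotate (m + 1) i) = true := by
    by_contra! hcon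
    have : ∀ k, χ (((finRotate (m + 1)) ^ k) 0) = false := by
      intro k
      induction k with
      | zero => exact hzero
      | succ k ih =>
        rw [pow_succ', Equiv.Perm.mul_apply]
        simpa using hcon _ ih
    obtain ⟨k, hk⟩ := exists_finRotate_pow_eq 0 (Fin.last m)
    simpa [hk, hlast] using this k
  obtain ⟨i, hi, hi'⟩ := hne
  refine ⟨fun I => {ρ | (ρ ∈ K ∧ st ρ = χ) ∧ flagDes χ ρ = I}.ncard, fun J => ?_, ?_, ?_⟩
  · rw [sum_ncard_fiber]
    by_cases hJ : Fin.last m ∈ J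
    · rw [flagCount_eq_ncard hK hst χ hJ]
      congr 1
      ext ρ
      simp only [Set.mem_ofPred_eq, Finset.mem_powerset]
      tauto
    · have h0 : flagCount K st χ J = 0 := if_neg fun h => hJ (h hdrop)
      rw [h0, Set.ncard_eq_zero]
      ext ρ
      simp only [Set.mem_ofPred_eq, Finset.mem_powerset, Set.mem_empty_iff_false, iff_false]
      exact fun h => hJ (h.2 (flagDrops_subset_flagDes χ ρ hdrop))
  · rw [Set.ncard_eq_zero]
    ext ρ
    simp only [Set.mem_ofPred_eq, Set.mem_empty_iff_false, iff_false]
    intro h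
    have := flagDrops_subset_flagDes χ ρ hdrop
    simp [h.2] at this
  · rw [Set.ncard_eq_zero]
    ext ρ
    simp only [Set.mem_ofPred_eq, Set.mem_empty_iff_false, iff_false]
    intro h
    have hmem : i ∈ flagDes χ ρ := by simp [h.2]
    simp only [flagDes, Finset.mem_filter, Finset.mem_univ, true_and, hi, hi'] at hmem
    rcases hmem with rfl | h | h
    · simp [hlast] at hi
    · simp at h
    · simp at h

theorem IsProperInverse.of_shift {H H' a : Finset (Fin (m + 1)) → ℕ}
    (hH : ∀ J, H' (J.map (finRotate (m + 1)).toEmbedding) = H J) (ha : IsProperInverse H' a) :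
    IsProperInverse H fun I => a (I.map (finRotate (m + 1)).toEmbedding) := by
  refine ⟨fun J => ?_, ?_, ?_⟩
  · rw [sum_powerset_map, ha.1, hH]
  · simpa using ha.2.1
  · simpa using ha.2.2

theorem exists_isProperInverse_flagCount
    (hK : ∀ h ρ : Equiv.Perm (Fin (m + 1)), h * ρ * h⁻¹ ∈ K ↔ ρ ∈ K)
    (hst : ∀ h ρ x, st (h * ρ * h⁻¹) (h x) = st ρ x)
    (hne : ∀ ρ ∈ K, ∃ x y, st ρ x = true ∧ st ρ y = false) (χ : Fin (m + 1) → Bool) :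
    ∃ a, IsProperInverse (flagCount K st χ) a := by
  by_cases hχ : ∃ ρ ∈ K, st ρ = χ
  · obtain ⟨ρ, hρ, rfl⟩ := hχ
    obtain ⟨x, y, hx, hy⟩ := hne ρ hρ
    have hdrop : ∃ i, st ρ i = true ∧ st ρ (finRotate (m + 1) i) = false := by
      by_contra! hcon
      have : ∀ k, st ρ (((finRotate (m + 1)) ^ k) x) = true := by
        intro k
        induction k with
        | zero => exact hx
        | succ k ih =>
          rw [pow_succ', Equiv.Perm.mul_apply]
          simpa using hcon _ ih
      obtain ⟨k, hk⟩ := exists_finRotate_pow_eq x y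
      simpa [hk, hy] using this k
    obtain ⟨i, hi, hi'⟩ := hdrop
    obtain ⟨k, hk⟩ := exists_finRotate_pow_eq i (Fin.last m)
    have hgen : ∀ k (χ : Fin (m + 1) → Bool) (i : Fin (m + 1)),
        ((finRotate (m + 1)) ^ k) i = Fin.last m → χ i = true →
        χ (finRotate (m + 1) i) = false → ∃ a, IsProperInverse (flagCount K st χ) a := by
      intro k
      induction k with
      | zero =>
        rintro χ i rfl hi hi'
        exact exists_isProperInverse_of_last hK hst hi (by simpa using hi')
      | succ k ih =>
        intro χ i hik hi hi'
        obtain ⟨a, ha⟩ := ih (χ ∘ (finRotate (m + 1)).symm) (finRotate (m + 1) i)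
          (by rwa [pow_succ] at hik) (by simpa using hi) (by simpa using hi')
        exact ⟨_, ha.of_shift (flagCount_shift hK hst χ)⟩
    exact hgen k _ i hk hi hi'
  · have hempty : {ρ | ρ ∈ K ∧ st ρ = χ} = ∅ := by
      ext ρ
      simp only [Set.mem_ofPred_eq, Set.mem_empty_iff_false, iff_false]
      exact fun h => hχ ⟨ρ, h⟩
    refine ⟨fun _ => 0, fun J => ?_, rfl, rfl⟩
    simp [flagCount, hempty, numClasses]

/-- The multiplicities of a cyclic descent set on a conjugation-invariant set of permutations
carrying an equivariant non-constant two-valued statistic. -/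
theorem exists_cyclic_multiplicity
    (hK : ∀ h ρ : Equiv.Perm (Fin (m + 1)), h * ρ * h⁻¹ ∈ K ↔ ρ ∈ K)
    (hst : ∀ h ρ x, st (h * ρ * h⁻¹) (h x) = st ρ x)
    (hne : ∀ ρ ∈ K, ∃ x y, st ρ x = true ∧ st ρ y = false) :
    ∃ a : Finset (Fin (m + 1)) → ℕ, a ∅ = 0 ∧ a Finset.univ = 0 ∧
      (∀ J, a (J.map (finRotate (m + 1)).toEmbedding) = a J) ∧
      ∀ J, Fin.last m ∉ J →
        a J + a (insert (Fin.last m) J) = {ρ | ρ ∈ K ∧ desSet ρ = J}.ncard := by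
  choose b hb using exists_isProperInverse_flagCount hK hst hne
  have hsum : ∀ J, ∑ I ∈ J.powerset, ∑ χ, b χ I = ∑ χ, flagCount K st χ J := by
    intro J
    rw [Finset.sum_comm]
    exact Finset.sum_congr rfl fun χ _ => (hb χ).1 J
  have hshift : ∀ J : Finset (Fin (m + 1)),
      ∑ χ, flagCount K st χ (J.map (finRotate (m + 1)).toEmbedding) =
        ∑ χ, flagCount K st χ J := by
    intro J
    rw [← Equiv.sum_comp ((finRotate (m + 1)).arrowCongr (Equiv.refl Bool))]
    exact Finset.sum_congr rfl fun χ _ => flagCount_shift hK hst χ J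
  refine ⟨fun I => ∑ χ, b χ I, ?_, ?_, fun J => ?_, fun J hJ => ?_⟩
  · exact Finset.sum_eq_zero fun χ _ => (hb χ).2.1
  · exact Finset.sum_eq_zero fun χ _ => (hb χ).2.2
  · refine eq_of_sum_powerset_eq (a := fun J => ∑ χ, b χ (J.map (finRotate (m + 1)).toEmbedding))
      (b := fun J => ∑ χ, b χ J) J fun I _ => ?_
    rw [sum_powerset_map (finRotate (m + 1)) fun J => ∑ χ, b χ J, hsum, hshift, hsum]
  · refine eq_of_sum_powerset_eq
      (a := fun J => ∑ χ, b χ J + ∑ χ, b χ (insert (Fin.last m) J))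
      (b := fun J => {ρ | ρ ∈ K ∧ desSet ρ = J}.ncard) J fun I hI => ?_
    have hlast : Fin.last m ∉ I := fun h => hJ (hI h)
    rw [Finset.sum_add_distrib,
      ← Finset.sum_powerset_insert hlast fun J => ∑ χ, b χ J, hsum,
      sum_flagCount_eq_ncard hK hst (Finset.mem_insert_self _ _), sum_ncard_fiber]
    congr 1
    ext ρ
    have hdes : Fin.last m ∉ desSet ρ := by simp [desSet]
    simp only [Set.mem_ofPred_eq, Finset.mem_powerset, Finset.subset_insert_iff_of_notMem hdes]

end FlagCount

section Extension

/-- A rotation-invariant multiplicity function refining the descent distribution yields a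
cyclic extension. -/
theorem exists_extension_of_multiplicity {α T : Type*} [Finite T] [Fintype α] [DecidableEq α]
    {l : α} {e : Equiv.Perm α} {des : T → Finset α} {a : Finset α → ℕ} (hl : ∀ t, l ∉ des t)
    (ha : ∀ J, l ∉ J → a J + a (insert l J) = {t | des t = J}.ncard)
    (hae : ∀ J, a (J.map e.toEmbedding) = a J) (hempty : a ∅ = 0) (huniv : a Finset.univ = 0) :
    ∃ (c : T → Finset α) (p : T ≃ T), (∀ t, (c t).erase l = des t) ∧
      (∀ t, c (p t) = (c t).map e.toEmbedding) ∧ (∀ t, c t ≠ ∅) ∧ ∀ t, c t ≠ Finset.univ := by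
  classical
  have hA : ∀ J, ∃ A : Set T, l ∉ J → A ⊆ {t | des t = J} ∧ A.ncard = a J := by
    intro J
    by_cases hJ : l ∈ J
    · exact ⟨∅, fun h => absurd hJ h⟩
    · obtain ⟨A, hA⟩ := Set.exists_subset_card_eq (s := {t | des t = J}) (n := a J)
        (by rw [← ha J hJ]; exact Nat.le_add_right _ _)
      exact ⟨A, fun _ => hA⟩
  choose A hA using hA
  let c : T → Finset α := fun t => if t ∈ A (des t) then des t else insert l (des t)
  have hc : ∀ t, (c t).erase l = des t := by
    intro t
    simp only [c]
    split_ifs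
    · exact Finset.erase_eq_of_notMem (hl t)
    · exact Finset.erase_insert (hl t)
  have hmem : ∀ t, l ∈ c t ↔ t ∉ A (des t) := by
    intro t
    simp only [c]
    split_ifs with h <;> simp [h, hl]
  have hcard : ∀ I, {t | c t = I}.ncard = a I := by
    intro I
    by_cases hI : l ∈ I
    · have hJ := Finset.notMem_erase l I
      have hset : {t | c t = I} = {t | des t = I.erase l} \ A (I.erase l) := by
        ext t
        simp only [Set.mem_ofPred_eq, Set.mem_sdiff]
        constructor
        · rintro rfl
          rw [hc]
          exact ⟨rfl, (hmem t).1 hI⟩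
        · rintro ⟨h1, h2⟩
          rw [← h1] at h2
          rw [← Finset.insert_erase ((hmem t).2 h2), hc, h1, Finset.insert_erase hI]
      rw [hset, Set.ncard_sdiff (hA _ hJ).1, ← ha _ hJ, (hA _ hJ).2, Finset.insert_erase hI,
        Nat.add_sub_cancel_left]
    · rw [← (hA I hI).2]
      congr 1
      ext t
      simp only [Set.mem_ofPred_eq]
      constructor
      · rintro rfl
        have h1 := (hmem t).not_left.1 hI
        rwa [← hc, Finset.erase_eq_of_notMem hI] at h1
      · intro h
        have h1 : des t = I := (hA I hI).1 h
        simp only [c, h1, h, if_true]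
  have hne : ∀ t I, a I = 0 → c t ≠ I := by
    rintro t _ hI rfl
    have := hcard (c t)
    rw [hI, Set.ncard_eq_zero] at this
    exact (Set.ext_iff.1 this t).1 rfl
  have hfib : ∀ I, Nonempty ({t // c t = I} ≃ {t // c t = e.finsetCongr I}) := fun I =>
    Finite.card_eq.1 ((hcard I).trans ((hae I).symm.trans (hcard _).symm))
  let E := fun I => (hfib I).some
  refine ⟨c, (Equiv.sigmaFiberEquiv c).symm.trans
    ((Equiv.sigmaCongr e.finsetCongr E).trans (Equiv.sigmaFiberEquiv c)), hc, fun t => ?_,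
    fun t => hne t _ hempty, fun t => hne t _ huniv⟩
  exact (E (c t) ⟨t, rfl⟩).2

theorem Des_eq_image_desSet {m : ℕ} (π : Equiv.Perm (Fin (m + 1))) :
    Des π = (desSet π).image fun i : Fin (m + 1) => (i : ℕ) + 1 := by
  ext i
  simp only [Des, desSet, oneline, Finset.mem_filter, Finset.mem_Icc, Finset.mem_image,
    Finset.mem_univ, true_and, Nat.add_sub_cancel]
  constructor
  · rintro ⟨⟨h1, h2⟩, h3⟩
    obtain ⟨j, rfl⟩ : ∃ j, i = j + 1 := ⟨i - 1, by omega⟩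
    have hj : j < m := by omega
    refine ⟨(⟨j, hj⟩ : Fin m).castSucc, ⟨Fin.castSucc_ne_last _, ?_⟩, rfl⟩
    rw [dif_pos (by omega), dif_pos (by omega)] at h3
    rw [finRotate_apply, Fin.coeSucc_eq_succ]
    exact Nat.lt_of_add_lt_add_right h3
  · rintro ⟨j, ⟨h1, h2⟩, rfl⟩
    obtain ⟨j, rfl⟩ := Fin.exists_castSucc_eq.2 h1
    rw [finRotate_apply, Fin.coeSucc_eq_succ] at h2
    have := j.2
    refine ⟨by simp, ?_⟩
    rw [dif_pos (by simp), dif_pos (by simp)]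
    exact Nat.add_lt_add_right h2 1

theorem sh_image_val_add_one {m : ℕ} (J : Finset (Fin (m + 1))) :
    sh (m + 1) (J.image fun i : Fin (m + 1) => (i : ℕ) + 1) =
      (J.map (finRotate (m + 1)).toEmbedding).image fun i : Fin (m + 1) => (i : ℕ) + 1 := by
  rw [sh, Finset.image_image, Finset.map_eq_image, Finset.image_image]
  congr 1
  funext i
  simp [finRotate_apply, Fin.val_add]

theorem image_val_add_one_univ (m : ℕ) :
    (Finset.univ : Finset (Fin (m + 1))).image (fun i : Fin (m + 1) => (i : ℕ) + 1) =
      Finset.Icc 1 (m + 1) := by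
  ext i
  simp only [Finset.mem_image, Finset.mem_univ, true_and, Finset.mem_Icc]
  constructor
  · rintro ⟨j, rfl⟩
    omega
  · rintro ⟨h1, h2⟩
    exact ⟨⟨i - 1, by omega⟩, by simp only; omega⟩

theorem image_val_add_one_inter_Icc {m : ℕ} (J : Finset (Fin (m + 1))) :
    (J.image fun i : Fin (m + 1) => (i : ℕ) + 1) ∩ Finset.Icc 1 m =
      (J.erase (Fin.last m)).image fun i : Fin (m + 1) => (i : ℕ) + 1 := by
  ext i
  simp only [Finset.mem_inter, Finset.mem_image, Finset.mem_erase, Finset.mem_Icc, ne_eq,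
    Fin.ext_iff, Fin.val_last]
  constructor
  · rintro ⟨⟨j, hj, rfl⟩, h⟩
    exact ⟨j, ⟨by omega, hj⟩, rfl⟩
  · rintro ⟨j, ⟨h, hj⟩, rfl⟩
    exact ⟨⟨j, hj, rfl⟩, by omega⟩

/-- The flag marking the points lying on cycles of length `a`. -/
def onCycleOfLength {n : ℕ} (a : ℕ) (ρ : Equiv.Perm (Fin n)) (x : Fin n) : Bool :=
  decide ((ρ.cycleOf x).support.card = a)

theorem cycleOf_conj_apply {n : ℕ} (h ρ : Equiv.Perm (Fin n)) (x : Fin n) :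
    (h * ρ * h⁻¹).cycleOf (h x) = h * ρ.cycleOf x * h⁻¹ := by
  ext y
  obtain ⟨y, rfl⟩ := h.surjective y
  simp only [Equiv.Perm.cycleOf_apply, Equiv.Perm.sameCycle_conj, Equiv.Perm.mul_apply,
    show ∀ z, h⁻¹ (h z) = z from fun z => h.symm_apply_apply z]
  split_ifs <;> rfl

theorem onCycleOfLength_conj {n : ℕ} (a : ℕ) (h ρ : Equiv.Perm (Fin n)) (x : Fin n) :
    onCycleOfLength a (h * ρ * h⁻¹) (h x) = onCycleOfLength a ρ x := by
  simp only [onCycleOfLength, cycleOf_conj_apply, Equiv.Perm.card_support_conj]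

theorem fullCycleType_conj {n : ℕ} (h ρ : Equiv.Perm (Fin n)) :
    fullCycleType (h * ρ * h⁻¹) = fullCycleType ρ := by
  simp only [fullCycleType, Equiv.Perm.cycleType_conj, Equiv.Perm.card_support_conj]

theorem exists_card_support_cycleOf {n : ℕ} {ρ : Equiv.Perm (Fin n)} {a : ℕ}
    (ha : a ∈ ρ.cycleType) : ∃ x, (ρ.cycleOf x).support.card = a := by
  rw [Equiv.Perm.cycleType_def, Multiset.mem_map] at ha
  obtain ⟨c, hc, rfl⟩ := ha
  have hc' : c ∈ ρ.cycleFactorsFinset := hc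
  obtain ⟨x, hx⟩ := ((Equiv.Perm.mem_cycleFactorsFinset_iff.1 hc').1).nonempty_support
  exact ⟨x, by rw [← Equiv.Perm.cycle_is_cycleOf hx hc']; rfl⟩

theorem exists_onCycleOfLength {n : ℕ} {ρ : Equiv.Perm (Fin n)} {a b : ℕ} (ha1 : a ≠ 1)
    (hab : a ≠ b) (ha : a ∈ fullCycleType ρ) (hb : b ∈ fullCycleType ρ) :
    ∃ x y, onCycleOfLength a ρ x = true ∧ onCycleOfLength a ρ y = false := by
  simp only [onCycleOfLength, decide_eq_true_eq, decide_eq_false_iff_not]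
  have ha' : a ∈ ρ.cycleType :=
    (Multiset.mem_add.1 ha).resolve_right fun h => ha1 (Multiset.eq_of_mem_replicate h)
  obtain ⟨x, hx⟩ := exists_card_support_cycleOf ha'
  rcases Multiset.mem_add.1 hb with hb | hb
  · obtain ⟨y, hy⟩ := exists_card_support_cycleOf hb
    exact ⟨x, y, hx, by rw [hy]; exact hab.symm⟩
  · have hlt : ρ.support.card < Fintype.card (Fin n) := by
      have := (Multiset.mem_replicate.1 hb).1
      rw [Fintype.card_fin]
      omega
    obtain ⟨y, hy⟩ : ∃ y, y ∉ ρ.support := by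
      by_contra! hcon
      rw [Finset.eq_univ_iff_forall.2 hcon, Finset.card_univ] at hlt
      exact hlt.false
    refine ⟨x, y, hx, ?_⟩
    rw [(Equiv.Perm.cycleOf_eq_one_iff ρ).2 (Equiv.Perm.notMem_support.1 hy),
      Equiv.Perm.support_one, Finset.card_empty]
    have := Equiv.Perm.two_le_of_mem_cycleType ha'
    omega

end Extension

/-- If the partition `μ` of `n` has at least two distinct part sizes, then the
descent map on the conjugacy class `C_μ ⊆ S_n` admits a cyclic extension. -/
theorem stmt1 (n : ℕ) (μ : n.Partition)
    (hμ : ∃ a ∈ μ.parts, ∃ b ∈ μ.parts, a ≠ b) :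
    HasCyclicExtension n
      (fun π : {π : Equiv.Perm (Fin n) // fullCycleType π = μ.parts} => Des π.1) := by
  obtain ⟨a, ha, b, hb, hab, ha1⟩ : ∃ a ∈ μ.parts, ∃ b ∈ μ.parts, a ≠ b ∧ a ≠ 1 := by
    obtain ⟨a, ha, b, hb, hab⟩ := hμ
    by_cases h : a = 1
    · exact ⟨b, hb, a, ha, hab.symm, fun h' => hab (h.trans h'.symm)⟩
    · exact ⟨a, ha, b, hb, hab, h⟩
  cases n with
  | zero =>
    have h1 := Multiset.le_sum_of_mem ha
    have h2 := μ.parts_pos ha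
    have h3 := μ.parts_sum
    omega
  | succ m =>
    obtain ⟨M, hempty, huniv, hrot, hM⟩ := exists_cyclic_multiplicity
      (K := {π : Equiv.Perm (Fin (m + 1)) | fullCycleType π = μ.parts}) (st := onCycleOfLength a)
      (fun h ρ => by simp only [Set.mem_ofPred_eq, fullCycleType_conj])
      (onCycleOfLength_conj a)
      (fun ρ hρ => exists_onCycleOfLength ha1 hab (hρ.symm ▸ ha) (hρ.symm ▸ hb))
    obtain ⟨c, p, hdes, hp, hne, hnu⟩ := exists_extension_of_multiplicity
      (T := {π : Equiv.Perm (Fin (m + 1)) // fullCycleType π = μ.parts})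
      (l := Fin.last m) (e := finRotate (m + 1)) (des := fun π => desSet π.1) (a := M)
      (fun t => by simp [desSet])
      (fun J hJ => by
        rw [hM J hJ, ← Set.ncard_image_of_injective _ Subtype.val_injective]
        congr 1
        ext ρ
        simp [and_comm])
      hrot hempty huniv
    have hinj : Function.Injective fun i : Fin (m + 1) => (i : ℕ) + 1 := fun i j h =>
      Fin.ext (Nat.add_right_cancel h)
    refine ⟨fun t => (c t).image fun i : Fin (m + 1) => (i : ℕ) + 1, p,
      fun t => ⟨?_, ?_, ?_, ?_, ?_⟩⟩
    · rw [← image_val_add_one_univ]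
      exact Finset.image_subset_image (Finset.subset_univ _)
    · rw [Nat.add_sub_cancel, image_val_add_one_inter_Icc, hdes]
      exact (Des_eq_image_desSet _).symm
    · rw [sh_image_val_add_one]
      exact congrArg _ (hp t)
    · rw [Ne, Finset.image_eq_empty]
      exact hne t
    · rw [← image_val_add_one_univ]
      exact fun h => hnu t (Finset.image_injective hinj h)
end

section
/- Let r, s ≥ 1 and n = rs. The descent map Des on the conjugacy class C_{(r^s)} ⊆ S_n (permutations that are products of s disjoint cycles of length r) admits a cyclic extension (cDes, p) if and only if r is not squarefree. -/
open Finset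

/-- `σ` is a standardization of the labelling `κ` with respect to the permutation `π₀`: it refines
the order of the labels, and `π₀` is increasing on every block of equal labels. -/
def IsStd {X K : Type*} [LinearOrder K] {n : ℕ} (π₀ : Equiv.Perm X) (κ : X → K)
    (σ : X ≃ Fin n) : Prop :=
  ∀ x y, (κ x < κ y → σ x < σ y) ∧ (κ x = κ y → σ x < σ y → σ (π₀ x) < σ (π₀ y))

/-- A labelling is aperiodic if a nontrivial move along a cycle changes the label itinerary. -/
def IsAper {X K : Type*} (π₀ : Equiv.Perm X) (κ : X → K) : Prop :=
  ∀ x (j : ℕ), (∀ i : ℕ, κ ((π₀ ^ i) ((π₀ ^ j) x)) = κ ((π₀ ^ i) x)) → (π₀ ^ j) x = x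

/-- Permutations that commute with `π₀` and preserve the labelling `κ`. -/
def IsSym {X K : Type*} (π₀ : Equiv.Perm X) (κ : X → K) (z : Equiv.Perm X) : Prop :=
  (∀ x, z (π₀ x) = π₀ (z x)) ∧ ∀ x, κ (z x) = κ x

/-- The itinerary of labels along the `π₀`-orbit of a point, ordered lexicographically. -/
def itin {X K : Type*} (π₀ : Equiv.Perm X) (κ : X → K) (x : X) : Lex (ℕ → K) :=
  toLex fun i => κ ((π₀ ^ i) x)

section
variable {X K : Type*} [LinearOrder K] {n : ℕ} {π₀ : Equiv.Perm X} {κ : X → K}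

omit [LinearOrder K] in
theorem itin_eq_iff {x y : X} :
    itin π₀ κ x = itin π₀ κ y ↔ ∀ i : ℕ, κ ((π₀ ^ i) x) = κ ((π₀ ^ i) y) :=
  ⟨fun h i => congrFun (congrArg ofLex h) i, fun h => congrArg toLex (funext h)⟩

theorem itin_lt_iff {x y : X} : itin π₀ κ x < itin π₀ κ y ↔
    ∃ i : ℕ, (∀ j < i, κ ((π₀ ^ j) x) = κ ((π₀ ^ j) y)) ∧ κ ((π₀ ^ i) x) < κ ((π₀ ^ i) y) :=
  Iff.rfl

omit [LinearOrder K] in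
theorem itin_map_eq {x y : X} (h : itin π₀ κ x = itin π₀ κ y) :
    itin π₀ κ (π₀ x) = itin π₀ κ (π₀ y) := by
  rw [itin_eq_iff] at h ⊢
  intro i
  have := h (i + 1)
  simpa [pow_succ] using this

omit [LinearOrder K] in
theorem itin_eq_of_map_eq [Finite X] {x y : X} (h : itin π₀ κ (π₀ x) = itin π₀ κ (π₀ y)) :
    itin π₀ κ x = itin π₀ κ y := by
  rw [itin_eq_iff] at h ⊢
  intro i
  obtain ⟨N, hN, hN'⟩ := (isOfFinOrder_of_finite π₀).exists_pow_eq_one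
  have key : ∀ a : X, (π₀ ^ (i + (N - 1))) (π₀ a) = (π₀ ^ i) a := by
    intro a
    have : (π₀ ^ (i + (N - 1))) * π₀ = π₀ ^ i := by
      rw [← pow_succ, show i + (N - 1) + 1 = i + N by omega, pow_add, hN', mul_one]
    rw [← this]; rfl
  have := h (i + (N - 1))
  rwa [key, key] at this

theorem IsStd.lt_of_itin_lt {σ : X ≃ Fin n} (hσ : IsStd π₀ κ σ) {x y : X}
    (h : itin π₀ κ x < itin π₀ κ y) : σ x < σ y := by
  obtain ⟨i, hi, hlt⟩ := itin_lt_iff.1 h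
  by_contra hcon
  have hne : x ≠ y := by rintro rfl; exact lt_irrefl _ h
  have h0 : σ y < σ x := lt_of_le_of_ne (not_lt.1 hcon) fun h => hne (σ.injective h).symm
  have : ∀ j ≤ i, σ ((π₀ ^ j) y) < σ ((π₀ ^ j) x) := by
    intro j
    induction j with
    | zero => intro _; simpa using h0
    | succ j ih =>
      intro hj
      have := (hσ _ _).2 (hi j (by omega)).symm (ih (by omega))
      simpa [pow_succ'] using this
  exact lt_asymm (this i le_rfl) ((hσ _ _).1 hlt)

theorem IsStd.itin_le {σ : X ≃ Fin n} (hσ : IsStd π₀ κ σ) {x y : X}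
    (h : σ x ≤ σ y) : itin π₀ κ x ≤ itin π₀ κ y :=
  not_lt.1 fun h' => not_lt.2 h (hσ.lt_of_itin_lt h')

theorem IsStd.pow_lt {σ : X ≃ Fin n} (hσ : IsStd π₀ κ σ) {x y : X}
    (h : itin π₀ κ x = itin π₀ κ y) (hxy : σ x < σ y) (j : ℕ) :
    σ ((π₀ ^ j) x) < σ ((π₀ ^ j) y) := by
  induction j with
  | zero => simpa using hxy
  | succ j ih => simpa [pow_succ'] using (hσ _ _).2 (itin_eq_iff.1 h j) ih

theorem IsStd.isAper {σ : X ≃ Fin n} (hσ : IsStd π₀ κ σ) : IsAper π₀ κ := by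
  intro x j hj
  have hit : itin π₀ κ ((π₀ ^ j) x) = itin π₀ κ x := itin_eq_iff.2 hj
  by_contra hne
  have hpow : ∀ k, (π₀ ^ (j * (k + 1))) x = (π₀ ^ (j * k)) ((π₀ ^ j) x) := fun k => by
    rw [mul_add, mul_one, pow_add]; rfl
  rcases lt_or_gt_of_ne (fun h => hne (σ.injective h)) with h | h
  · have : StrictAnti fun k : ℕ => σ ((π₀ ^ (j * k)) x) := strictAnti_nat_of_succ_lt fun k => by
      rw [hpow]; exact hσ.pow_lt hit h _
    exact not_injective_infinite_finite _ this.injective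
  · have : StrictMono fun k : ℕ => σ ((π₀ ^ (j * k)) x) := strictMono_nat_of_lt_succ fun k => by
      rw [hpow]; exact hσ.pow_lt hit.symm h _
    exact not_injective_infinite_finite _ this.injective

theorem eq_comp_of_monotone {α : Type*} [PartialOrder α] {f : X → α} {σ τ : X ≃ Fin n}
    (hσ : ∀ x y, σ x ≤ σ y → f x ≤ f y) (hτ : ∀ x y, τ x ≤ τ y → f x ≤ f y) (j : Fin n) :
    f (σ.symm j) = f (τ.symm j) := by
  have := Tuple.unique_monotone (f := f ∘ σ.symm) (σ := Equiv.refl _) (τ := τ.symm.trans σ)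
    (fun a b h => hσ _ _ (by simpa using h)) (fun a b h => by
      simpa using hτ (τ.symm a) (τ.symm b) (by simpa using h))
  simpa using congrFun this j

theorem IsStd.isSym [Finite X] {σ τ : X ≃ Fin n} (hσ : IsStd π₀ κ σ) (hτ : IsStd π₀ κ τ) :
    IsSym π₀ κ (σ.trans τ.symm) := by
  have hit : ∀ x, itin π₀ κ (τ.symm (σ x)) = itin π₀ κ x := fun x => by
    have := eq_comp_of_monotone (fun x y => hσ.itin_le) (fun x y => hτ.itin_le) (σ x)
    rw [← this, Equiv.symm_apply_apply]
  refine ⟨?_, fun x => by simpa using itin_eq_iff.1 (hit x) 0⟩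
  set g : X → X := fun x => π₀.symm (τ.symm (σ (π₀ x))) with hg
  have hπg : ∀ x, π₀ (g x) = τ.symm (σ (π₀ x)) := fun x => by simp [hg]
  have hgit : ∀ x, itin π₀ κ (g x) = itin π₀ κ x := fun x =>
    itin_eq_of_map_eq (by rw [hπg, hit])
  have hginj : Function.Injective g := fun x y h => by simpa [hg] using h
  have hmono : ∀ x y, σ x < σ y → τ (g x) < τ (g y) := by
    intro x y hxy
    rcases lt_trichotomy (itin π₀ κ x) (itin π₀ κ y) with h | h | h
    · exact hτ.lt_of_itin_lt (by rwa [hgit, hgit])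
    · by_contra hcon
      have hlt : τ (g y) < τ (g x) := lt_of_le_of_ne (not_lt.1 hcon) fun h => by
        have := hginj (τ.injective h)
        subst this
        exact lt_irrefl _ hxy
      have h1 := (hτ _ _).2 (by simpa using itin_eq_iff.1 (by rw [hgit, hgit, h]) 0) hlt
      rw [hπg, hπg, Equiv.apply_symm_apply, Equiv.apply_symm_apply] at h1
      exact lt_asymm h1 ((hσ _ _).2 (by simpa using itin_eq_iff.1 h 0) hxy)
    · exact absurd hxy (lt_asymm (hσ.lt_of_itin_lt h))
  have hid : (fun j => τ (g (σ.symm j))) = id :=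
    StrictMono.eq_id fun a b h => hmono _ _ (by simpa using h)
  intro x
  have := congrFun hid (σ x)
  simp only [Equiv.symm_apply_apply, id] at this
  have h2 : τ.symm (σ x) = g x := by rw [← this, Equiv.symm_apply_apply]
  simp only [Equiv.trans_apply]
  rw [h2, hπg]

theorem IsStd.comp {τ : X ≃ Fin n} (hτ : IsStd π₀ κ τ) {z : Equiv.Perm X}
    (hz : IsSym π₀ κ z) : IsStd π₀ κ (z.trans τ) := by
  intro x y
  have := hτ (z x) (z y)
  simpa [hz.1, hz.2] using this

theorem IsAper.exists_isStd [Finite X] (hX : Nat.card X = n) (h : IsAper π₀ κ) :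
    ∃ σ : X ≃ Fin n, IsStd π₀ κ σ := by
  classical
  have := Fintype.ofFinite X
  let S := Equiv.Perm.SameCycle.setoid π₀
  obtain ⟨N, ⟨e⟩⟩ := Finite.exists_equiv_fin (Quotient S)
  let idx : X → ℕ := fun x => e (Quotient.mk S x)
  have hidx : ∀ x, idx (π₀ x) = idx x := fun x => by
    have : Quotient.mk S (π₀ x) = Quotient.mk S x :=
      Quotient.sound (show Equiv.Perm.SameCycle π₀ (π₀ x) x by simp [Equiv.Perm.SameCycle.refl])
    simp [idx, this]
  let key : X → Lex (Lex (ℕ → K) × ℕ) := fun x => toLex (itin π₀ κ x, idx x)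
  have hkey : Function.Injective key := by
    intro x y hxy
    have h1 : itin π₀ κ x = itin π₀ κ y := congrArg (fun p => (ofLex p).1) hxy
    have h2 : idx x = idx y := congrArg (fun p => (ofLex p).2) hxy
    have h3 : Equiv.Perm.SameCycle π₀ x y := Quotient.exact (e.injective (Fin.ext h2))
    obtain ⟨j, -, hj⟩ := h3.exists_pow_eq'
    have := h x j (by rw [← itin_eq_iff, hj, h1])
    rw [← hj, this]
  let _ : LinearOrder X := LinearOrder.lift' key hkey
  let σ : X ≃o Fin n := (Fintype.orderIsoFinOfCardEq X (by rw [← hX, Nat.card_eq_fintype_card])).symm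
  have hσ : ∀ x y, σ x < σ y ↔ key x < key y := fun x y => σ.lt_iff_lt
  refine ⟨σ.toEquiv, fun x y => ⟨fun hxy => (hσ x y).2 ?_, fun hxy hlt => (hσ _ _).2 ?_⟩⟩
  · exact Prod.Lex.toLex_lt_toLex.2 (Or.inl (itin_lt_iff.2 ⟨0, by simp, by simpa using hxy⟩))
  · rcases Prod.Lex.toLex_lt_toLex.1 ((hσ x y).1 hlt) with h1 | ⟨h1, h2⟩
    · obtain ⟨i, hi, hi'⟩ := itin_lt_iff.1 h1
      refine Prod.Lex.toLex_lt_toLex.2 (Or.inl (itin_lt_iff.2 ?_))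
      cases i with
      | zero => simp [hxy] at hi'
      | succ i =>
        refine ⟨i, fun j hj => ?_, by simpa [pow_succ] using hi'⟩
        simpa [pow_succ] using hi (j + 1) (by omega)
    · refine Prod.Lex.toLex_lt_toLex.2 (Or.inr ⟨itin_map_eq h1, ?_⟩)
      simpa [hidx] using h2

theorem card_isStd [Finite X] (hX : Nat.card X = n) (h : IsAper π₀ κ) :
    Nat.card {σ : X ≃ Fin n // IsStd π₀ κ σ} = Nat.card {z : Equiv.Perm X // IsSym π₀ κ z} := by
  obtain ⟨τ, hτ⟩ := h.exists_isStd hX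
  exact Nat.card_congr
    { toFun := fun σ => ⟨σ.1.trans τ.symm, σ.2.isSym hτ⟩
      invFun := fun z => ⟨z.1.trans τ, hτ.comp z.2⟩
      left_inv := fun σ => by ext; simp
      right_inv := fun z => by ext; simp }
end

/-- The index of the block of position `j` when positions are cut just before every `k ∈ K`. -/
def blk (K : Finset ℕ) (j : ℕ) : ℕ := #{k ∈ K | k ≤ j}

theorem blk_mono (K : Finset ℕ) : Monotone (blk K) := fun _ _ h =>
  card_le_card fun _ hk => by
    rw [mem_filter] at hk ⊢
    exact ⟨hk.1, hk.2.trans h⟩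

theorem blk_succ (K : Finset ℕ) (j : ℕ) :
    blk K (j + 1) = blk K j + if j + 1 ∈ K then 1 else 0 := by
  have h : {k ∈ K | k ≤ j + 1} = {k ∈ K | k ≤ j} ∪ if j + 1 ∈ K then {j + 1} else ∅ := by
    ext k
    split_ifs with h
    · simp only [mem_filter, mem_union, mem_singleton]
      constructor
      · rintro ⟨h1, h2⟩
        by_cases hk : k = j + 1
        · exact Or.inr hk
        · exact Or.inl ⟨h1, by omega⟩
      · rintro (⟨h1, h2⟩ | rfl)
        · exact ⟨h1, by omega⟩
        · exact ⟨h, le_rfl⟩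
    · simp only [mem_filter, union_empty]
      refine and_congr_right fun hk => ⟨fun hle => ?_, fun hle => by omega⟩
      have : k ≠ j + 1 := by rintro rfl; exact h hk
      omega
  rw [blk, blk, h]
  split_ifs with h'
  · rw [card_union_of_disjoint (by simp [disjoint_singleton_right]), card_singleton]
  · simp

theorem rel_of_forall_adjacent {n : ℕ} {α : Type*} [PartialOrder α] {v : Fin n → α}
    (hv : Monotone v) {R : Fin n → Fin n → Prop} (hR : ∀ a b c, R a b → R b c → R a c)
    (h : ∀ j j' : Fin n, (j' : ℕ) = j + 1 → v j = v j' → R j j') :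
    ∀ j j' : Fin n, j < j' → v j = v j' → R j j' := by
  have key : ∀ d : ℕ, ∀ j j' : Fin n, (j' : ℕ) = j + d + 1 → v j = v j' → R j j' := by
    intro d
    induction d with
    | zero => exact h
    | succ d ih =>
      intro j j' hj hb
      let m : Fin n := ⟨j + d + 1, by omega⟩
      have h1 : v j ≤ v m := hv (by rw [Fin.le_def]; simp only [m]; omega)
      have h2 : v m ≤ v j' := hv (by rw [Fin.le_def]; simp only [m]; omega)
      exact hR _ _ _ (ih j m rfl (le_antisymm h1 (hb ▸ h2))) (h m j' hj (le_antisymm h2 (hb ▸ h1)))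
  intro j j' hj hb
  exact key (j' - j - 1) j j' (by have : (j : ℕ) < j' := hj; omega) hb

theorem forall_adjacent_iff {n : ℕ} {K : Finset ℕ} {R : Fin n → Fin n → Prop}
    (hR : ∀ a b c, R a b → R b c → R a c) :
    (∀ j j' : Fin n, (j' : ℕ) = j + 1 → (j' : ℕ) ∉ K → R j j') ↔
      ∀ j j' : Fin n, j < j' → blk K j = blk K j' → R j j' := by
  have hsucc : ∀ j j' : Fin n, (j' : ℕ) = j + 1 → ((j' : ℕ) ∉ K ↔ blk K j = blk K j') := by
    intro j j' hj
    rw [hj, blk_succ]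
    split_ifs with h <;> simp [h]
  constructor
  · intro h
    exact rel_of_forall_adjacent (v := fun j => blk K j) (fun a b hab => blk_mono K hab) hR
      fun j j' hj hb => h j j' hj ((hsucc j j' hj).2 hb)
  · intro h j j' hj hmem
    exact h j j' (by rw [Fin.lt_def]; omega) ((hsucc j j' hj).1 hmem)

theorem mem_Des {n : ℕ} {π : Equiv.Perm (Fin n)} {i : ℕ} :
    i ∈ Des π ↔ ∃ j j' : Fin n, (j' : ℕ) = j + 1 ∧ (j' : ℕ) = i ∧ π j' < π j := by
  rw [Des, mem_filter, mem_Icc]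
  unfold oneline
  constructor
  · rintro ⟨⟨h1, h2⟩, h⟩
    have h3 : i + 1 - 1 < n := by omega
    have h4 : i - 1 < n := by omega
    rw [dif_pos h3, dif_pos h4] at h
    refine ⟨⟨i - 1, h4⟩, ⟨i + 1 - 1, h3⟩, ?_, ?_, ?_⟩
    · simp only; omega
    · simp
    · rw [Fin.lt_def]; omega
  · rintro ⟨j, j', h1, rfl, h⟩
    refine ⟨by omega, ?_⟩
    rw [Fin.lt_def] at h
    have e1 : (⟨(j' : ℕ) + 1 - 1, by omega⟩ : Fin n) = j' := by ext; simp
    have e2 : (⟨(j' : ℕ) - 1, by omega⟩ : Fin n) = j := by ext; simp only; omega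
    rw [dif_pos (by omega), dif_pos (by omega), e1, e2]
    omega

theorem Des_subset_Icc {n : ℕ} (π : Equiv.Perm (Fin n)) : Des π ⊆ Icc 1 (n - 1) :=
  filter_subset _ _

section
variable {X Λ : Type*} [LinearOrder Λ] {n : ℕ} {π₀ : Equiv.Perm X} {lam : X → Λ} {K : Finset ℕ}
  {σ : X ≃ Fin n}

theorem Des_permCongr_subset_iff :
    Des (σ.permCongr π₀) ⊆ K ↔ IsStd π₀ (fun x => blk K (σ x)) σ := by
  have h1 : Des (σ.permCongr π₀) ⊆ K ↔ ∀ j j' : Fin n, (j' : ℕ) = j + 1 → (j' : ℕ) ∉ K →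
      σ.permCongr π₀ j < σ.permCongr π₀ j' := by
    constructor
    · intro h j j' hj hK
      by_contra hcon
      refine hK (h (mem_Des.2 ⟨j, j', hj, rfl, lt_of_le_of_ne (not_lt.1 hcon) fun he => ?_⟩))
      rw [(σ.permCongr π₀).injective he] at hj
      omega
    · intro h i hi
      obtain ⟨j, j', hj, rfl, hlt⟩ := mem_Des.1 hi
      by_contra hcon
      exact lt_asymm hlt (h j j' hj hcon)
  rw [h1, forall_adjacent_iff (R := fun j j' => σ.permCongr π₀ j < σ.permCongr π₀ j')
    (fun _ _ _ => lt_trans)]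
  constructor
  · intro h x y
    refine ⟨fun hlt => ?_, fun he hlt => by simpa using h (σ x) (σ y) hlt he⟩
    by_contra hcon
    exact not_le.2 hlt (blk_mono K (not_lt.1 hcon))
  · intro h j j' hlt he
    have := (h (σ.symm j) (σ.symm j')).2 (by simpa using he) (by simpa using hlt)
    simpa using this

/-- The label of `x` followed by the cyclic displacement of its position under `π₀`. -/
def cval (π₀ : Equiv.Perm X) (lam : X → Λ) (σ : X ≃ Fin n) (x : X) : Λ ×ₗ ℕ :=
  toLex (lam x, ((σ (π₀ x) - σ x : Fin n) : ℕ))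

/-- The step from `x` to `π₀ x` lowers the pair of the word and the label. -/
def Wraps (π₀ : Equiv.Perm X) (lam : X → Λ) (w : X → ℕ) (x : X) : Prop :=
  w (π₀ x) < w x ∨ w (π₀ x) = w x ∧ lam (π₀ x) < lam x

/-- The word `w` refined by the labels and the wrapping steps. -/
def finer (π₀ : Equiv.Perm X) (lam : X → Λ) (w : X → ℕ) (x : X) : ℕ ×ₗ (Λ ×ₗ Prop) :=
  toLex (w x, toLex (lam x, Wraps π₀ lam w x))

theorem finer_lt_iff {w : X → ℕ} {x y : X} : finer π₀ lam w x < finer π₀ lam w y ↔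
    w x < w y ∨ w x = w y ∧ (lam x < lam y ∨ lam x = lam y ∧
      ¬ Wraps π₀ lam w x ∧ Wraps π₀ lam w y) := by
  have hP : ∀ p q : Prop, p < q ↔ ¬ p ∧ q := fun p q => by
    rw [lt_iff_le_not_ge]
    simp only [le_Prop_eq]
    tauto
  simp only [finer, Prod.Lex.toLex_lt_toLex, hP]

theorem finer_eq_iff {w : X → ℕ} {x y : X} : finer π₀ lam w x = finer π₀ lam w y ↔
    w x = w y ∧ lam x = lam y ∧ (Wraps π₀ lam w x ↔ Wraps π₀ lam w y) := by
  simp only [finer, EmbeddingLike.apply_eq_iff_eq, Prod.mk.injEq, eq_iff_iff]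

theorem cval_le_iff {x y : X} : cval π₀ lam σ x ≤ cval π₀ lam σ y ↔ lam x < lam y ∨ lam x = lam y ∧
    ((σ (π₀ x) - σ x : Fin n) : ℕ) ≤ ((σ (π₀ y) - σ y : Fin n) : ℕ) := by
  simp only [cval, Prod.Lex.toLex_le_toLex]

theorem fin_sub_val (a b : Fin n) :
    (((a - b : Fin n) : ℕ) : ℤ) = a - b + if a < b then (n : ℤ) else 0 := by
  have ha := a.2
  have hb := b.2
  rw [Fin.val_sub]
  split_ifs with h
  · rw [Fin.lt_def] at h
    rw [Nat.mod_eq_of_lt (by omega)]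
    omega
  · rw [Fin.lt_def] at h
    rw [show n - (b : ℕ) + a = (a - b : ℕ) + n by omega, Nat.add_mod_right,
      Nat.mod_eq_of_lt (by omega)]
    omega

theorem wraps_iff (hlam : ∀ x, lam (π₀ x) ≠ lam x) {w : X → ℕ}
    (h : ∀ x y, w x < w y ∨ w x = w y ∧ lam x < lam y → σ x < σ y) (x : X) :
    Wraps π₀ lam w x ↔ σ (π₀ x) < σ x := by
  refine ⟨h _ _, fun hlt => ?_⟩
  by_contra hcon
  refine lt_asymm hlt (h x (π₀ x) ?_)
  unfold Wraps at hcon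
  rcases lt_trichotomy (w (π₀ x)) (w x) with h1 | h1 | h1
  · exact absurd (Or.inl h1) hcon
  · rcases lt_or_gt_of_ne (hlam x) with h2 | h2
    · exact absurd (Or.inr ⟨h1, h2⟩) hcon
    · exact Or.inr ⟨h1.symm, h2⟩
  · exact Or.inl h1

theorem cval_adjacent_iff (hlam : ∀ x, lam (π₀ x) ≠ lam x) :
    (∀ j j' : Fin n, (j' : ℕ) = j + 1 → (j' : ℕ) ∉ K →
      cval π₀ lam σ (σ.symm j) ≤ cval π₀ lam σ (σ.symm j')) ↔
    IsStd π₀ (finer π₀ lam fun x => blk K (σ x)) σ := by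
  have hblk : ∀ x y, blk K (σ x) < blk K (σ y) → σ x < σ y := fun x y hlt => by
    by_contra hcon
    exact not_le.2 hlt (blk_mono K (not_lt.1 hcon))
  constructor
  · rw [forall_adjacent_iff (R := fun j j' => cval π₀ lam σ (σ.symm j) ≤ cval π₀ lam σ (σ.symm j'))
      (fun _ _ _ => le_trans)]
    intro h
    have h' : ∀ x y, σ x < σ y → blk K (σ x) = blk K (σ y) →
        cval π₀ lam σ x ≤ cval π₀ lam σ y := fun x y hlt he => by
      simpa using h (σ x) (σ y) hlt he
    have hlex : ∀ x y, blk K (σ x) < blk K (σ y) ∨ blk K (σ x) = blk K (σ y) ∧ lam x < lam y →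
        σ x < σ y := by
      rintro x y (hlt | ⟨he, hlt⟩)
      · exact hblk _ _ hlt
      · by_contra hcon
        have hne : σ y ≠ σ x := fun h => by rw [σ.injective h] at hlt; exact lt_irrefl _ hlt
        rcases cval_le_iff.1 (h' y x (lt_of_le_of_ne (not_lt.1 hcon) hne) he.symm) with h1 | h1
        · exact lt_asymm h1 hlt
        · exact hlt.ne' h1.1
    have hwr := wraps_iff (w := fun x => blk K (σ x)) hlam hlex
    intro x y
    have e1 := fin_sub_val (σ (π₀ x)) (σ x)
    have e2 := fin_sub_val (σ (π₀ y)) (σ y)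
    rw [finer_lt_iff, finer_eq_iff, hwr, hwr]
    refine ⟨?_, ?_⟩
    · rintro (hlt | ⟨he, hlt | ⟨hl, hx, hy⟩⟩)
      · exact hblk _ _ hlt
      · exact hlex _ _ (Or.inr ⟨he, hlt⟩)
      · by_contra hcon
        have hne : σ y ≠ σ x := fun h => by rw [σ.injective h] at hy; exact hx hy
        have hlt := lt_of_le_of_ne (not_lt.1 hcon) hne
        rcases cval_le_iff.1 (h' y x hlt he.symm) with h1 | ⟨-, h1⟩
        · exact h1.ne' hl
        · rw [if_neg hx] at e1
          rw [if_pos hy] at e2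
          have := (σ (π₀ x)).2
          have := (σ (π₀ y)).2
          rw [Fin.lt_def] at hlt
          omega
    · rintro ⟨he, hl, hw⟩ hlt
      rcases cval_le_iff.1 (h' x y hlt he) with h1 | ⟨-, h1⟩
      · exact absurd hl h1.ne
      · rw [Fin.lt_def] at hlt ⊢
        simp only [hw] at e1
        split_ifs at e1 e2 <;> omega
  · intro h j j' hj hK
    obtain ⟨x, rfl⟩ := σ.surjective j
    obtain ⟨y, rfl⟩ := σ.surjective j'
    have he : blk K (σ x) = blk K (σ y) := by rw [hj, blk_succ, if_neg (by rwa [← hj]), add_zero]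
    have hlex : ∀ x y, blk K (σ x) < blk K (σ y) ∨ blk K (σ x) = blk K (σ y) ∧ lam x < lam y →
        σ x < σ y := by
      rintro x y (hlt | ⟨he, hlt⟩)
      · exact hblk _ _ hlt
      · exact (h x y).1 (finer_lt_iff.2 (Or.inr ⟨he, Or.inl hlt⟩))
    have hwr := wraps_iff (w := fun x => blk K (σ x)) hlam hlex
    have hlt : σ x < σ y := by rw [Fin.lt_def]; omega
    rw [Equiv.symm_apply_apply, Equiv.symm_apply_apply, cval_le_iff]
    have e1 := fin_sub_val (σ (π₀ x)) (σ x)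
    have e2 := fin_sub_val (σ (π₀ y)) (σ y)
    rcases lt_trichotomy (lam x) (lam y) with hl | hl | hl
    · exact Or.inl hl
    · refine Or.inr ⟨hl, ?_⟩
      by_cases hx : σ (π₀ x) < σ x <;> by_cases hy : σ (π₀ y) < σ y
      · have := (h x y).2 (finer_eq_iff.2 ⟨he, hl, by rw [hwr, hwr]; tauto⟩) hlt
        rw [if_pos hx] at e1
        rw [if_pos hy] at e2
        rw [Fin.lt_def] at this
        omega
      · have := (h y x).1 (finer_lt_iff.2 (Or.inr ⟨he.symm, Or.inr ⟨hl.symm, by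
          rw [hwr, hwr]; exact ⟨hy, hx⟩⟩⟩))
        exact absurd hlt (lt_asymm this)
      · rw [if_neg hx] at e1
        rw [if_pos hy] at e2
        have := (σ (π₀ x)).2
        omega
      · have := (h x y).2 (finer_eq_iff.2 ⟨he, hl, by rw [hwr, hwr]; tauto⟩) hlt
        rw [if_neg hx] at e1
        rw [if_neg hy] at e2
        rw [Fin.lt_def] at this
        omega
    · exact absurd hlt (lt_asymm (hlex y x (Or.inr ⟨he.symm, hl⟩)))
end

theorem exists_equiv_of_card_fiber_eq {A B I : Type*} [Finite A] [Finite B] (f : A → I) (g : B → I)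
    (h : ∀ i, Nat.card {a // f a = i} = Nat.card {b // g b = i}) :
    ∃ e : A ≃ B, ∀ a, g (e a) = f a := by
  have e : ∀ i, {a // f a = i} ≃ {b // g b = i} := fun i =>
    Classical.choice (Finite.card_eq.1 (h i))
  refine ⟨(Equiv.sigmaFiberEquiv f).symm.trans
    ((Equiv.sigmaCongrRight e).trans (Equiv.sigmaFiberEquiv g)), fun a => ?_⟩
  exact (e (f a) ⟨a, rfl⟩).2

theorem card_eq_of_card_fiber_eq {A B I : Type*} [Finite A] [Finite B] {P : A → Prop} {Q : B → Prop}
    (f : A → I) (g : B → I)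
    (h : ∀ i, Nat.card {a // P a ∧ f a = i} = Nat.card {b // Q b ∧ g b = i}) :
    Nat.card {a // P a} = Nat.card {b // Q b} := by
  obtain ⟨e, -⟩ := exists_equiv_of_card_fiber_eq (fun a : {a // P a} => f a.1)
    (fun b : {b // Q b} => g b.1) fun i => by
      rw [Nat.card_congr (Equiv.subtypeSubtypeEquivSubtypeInter P fun a => f a = i), h,
        ← Nat.card_congr (Equiv.subtypeSubtypeEquivSubtypeInter Q fun a => g a = i)]
  exact Nat.card_congr e

theorem card_filter_subset {A : Type*} [Fintype A] [DecidableEq A] (f : A → Finset ℕ)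
    (K : Finset ℕ) : #{a | f a ⊆ K} = ∑ L ∈ K.powerset, #{a | f a = L} := by
  rw [card_eq_sum_card_fiberwise (f := f) (t := K.powerset) (fun a ha => by simpa using ha)]
  refine sum_congr rfl fun L hL => congrArg card ?_
  rw [filter_filter]
  refine filter_congr fun a _ => ⟨fun h => h.2, fun h => ⟨?_, h⟩⟩
  rw [h]; exact mem_powerset.1 hL

theorem card_eq_mul_of_card_subset_eq_mul {Y T : Type*} [Finite Y] [Finite T] {S : Finset ℕ}
    (f : Y → Finset ℕ) (g : T → Finset ℕ) (N : ℕ)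
    (h : ∀ K ⊆ S, Nat.card {y // f y ⊆ K} = N * Nat.card {t // g t ⊆ K}) :
    ∀ K ⊆ S, Nat.card {y // f y = K} = N * Nat.card {t // g t = K} := by
  classical
  have := Fintype.ofFinite Y
  have := Fintype.ofFinite T
  simp only [Nat.card_eq_fintype_card, Fintype.card_subtype] at h ⊢
  intro K
  induction K using Finset.strongInduction with
  | H K ih =>
    intro hK
    have h1 := h K hK
    rw [card_filter_subset, card_filter_subset, ← add_sum_erase _ _ (mem_powerset_self K),
      ← add_sum_erase _ _ (mem_powerset_self K),
      mul_add, mul_sum] at h1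
    rw [sum_congr rfl fun L hL => ih L ?_ ?_] at h1
    · exact Nat.add_right_cancel h1
    · rw [mem_erase, mem_powerset] at hL
      exact hL.2.ssubset_of_ne hL.1
    · rw [mem_erase, mem_powerset] at hL
      exact hL.2.trans hK

section
variable {n : ℕ}

open Classical in
/-- The residues of `J` among the representatives `1, …, n - 1`. -/
noncomputable def nonzeroPart (J : Finset (ZMod n)) : Finset ℕ :=
  {i ∈ Icc 1 (n - 1) | (i : ZMod n) ∈ J}

theorem mem_nonzeroPart {J : Finset (ZMod n)} {i : ℕ} :
    i ∈ nonzeroPart J ↔ i ∈ Icc 1 (n - 1) ∧ (i : ZMod n) ∈ J := by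
  simp [nonzeroPart]

theorem nonzeroPart_subset (J : Finset (ZMod n)) : nonzeroPart J ⊆ Icc 1 (n - 1) :=
  fun _ h => (mem_nonzeroPart.1 h).1

theorem nonzeroPart_eq_iff [NeZero n] [DecidableEq (ZMod n)] {K : Finset ℕ} (hK : K ⊆ Icc 1 (n - 1))
    {J : Finset (ZMod n)} : nonzeroPart J = K ↔
      J = K.image (Nat.cast : ℕ → ZMod n) ∨ J = insert 0 (K.image (Nat.cast : ℕ → ZMod n)) := by
  have hn := NeZero.pos n
  have hval : ∀ i ∈ Icc 1 (n - 1), (i : ZMod n).val = i := fun i hi => by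
    rw [mem_Icc] at hi
    exact ZMod.val_cast_of_lt (by omega)
  have h0 : ∀ x : ZMod n, x ≠ 0 → x.val ∈ Icc 1 (n - 1) := fun x hx => by
    have := ZMod.val_lt x
    have : x.val ≠ 0 := by rwa [Ne, ZMod.val_eq_zero]
    rw [mem_Icc]; omega
  have hmem : ∀ i ∈ Icc 1 (n - 1), (i : ZMod n) ∈ K.image (Nat.cast : ℕ → ZMod n) ↔ i ∈ K := by
    intro i hi
    rw [mem_image]
    constructor
    · rintro ⟨k, hk, he⟩
      have := congrArg ZMod.val he
      rw [hval k (hK hk), hval i hi] at this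
      rwa [← this]
    · exact fun h => ⟨i, h, rfl⟩
  have hne : ∀ i ∈ Icc 1 (n - 1), (i : ZMod n) ≠ 0 := fun i hi h => by
    have := congrArg ZMod.val h
    rw [hval i hi, ZMod.val_zero] at this
    rw [mem_Icc] at hi
    omega
  have hK0 : (0 : ZMod n) ∉ K.image (Nat.cast : ℕ → ZMod n) := fun h => by
    obtain ⟨k, hk, he⟩ := mem_image.1 h
    exact hne k (hK hk) he
  constructor
  · intro h
    have hx : ∀ x : ZMod n, x ≠ 0 → (x ∈ J ↔ x ∈ K.image (Nat.cast : ℕ → ZMod n)) := by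
      intro x hx
      have h1 : x.val ∈ nonzeroPart J ↔ x.val ∈ K := by rw [h]
      rw [mem_nonzeroPart, ← hmem _ (h0 x hx), ZMod.natCast_zmod_val] at h1
      rw [← h1]
      exact ⟨fun h => ⟨h0 x hx, h⟩, fun h => h.2⟩
    by_cases hJ : (0 : ZMod n) ∈ J
    · right
      ext x
      by_cases hx0 : x = 0
      · simp [hx0, hJ]
      · rw [mem_insert, hx x hx0]; tauto
    · left
      ext x
      by_cases hx0 : x = 0
      · rw [hx0]; exact ⟨fun h => absurd h hJ, fun h => absurd h hK0⟩
      · exact hx x hx0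
  · rintro (rfl | rfl)
    · ext i
      rw [mem_nonzeroPart]
      exact ⟨fun h => (hmem i h.1).1 h.2, fun h => ⟨hK h, (hmem i (hK h)).2 h⟩⟩
    · ext i
      rw [mem_nonzeroPart, mem_insert]
      exact ⟨fun h => (hmem i h.1).1 (h.2.resolve_left (hne i h.1)),
        fun h => ⟨hK h, Or.inr ((hmem i (hK h)).2 h)⟩⟩

theorem image_nonzeroPart [NeZero n] [DecidableEq (ZMod n)] (J : Finset (ZMod n)) :
    (nonzeroPart J).image (Nat.cast : ℕ → ZMod n) = J.erase 0 := by
  have h1 := (nonzeroPart_eq_iff (nonzeroPart_subset J)).1 rfl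
  have h2 : (0 : ZMod n) ∉ (nonzeroPart J).image (Nat.cast : ℕ → ZMod n) := by
    intro h
    obtain ⟨k, hk, he⟩ := mem_image.1 h
    have hk' := mem_Icc.1 (nonzeroPart_subset J hk)
    have := congrArg ZMod.val he
    rw [ZMod.val_cast_of_lt (by omega), ZMod.val_zero] at this
    omega
  rcases h1 with h | h
  · rw [← h] at h2
    rw [erase_eq_of_notMem h2, ← h]
  · conv_rhs => rw [h]
    rw [erase_insert h2]

/-- A family of cyclic descent classes with translation-invariant cardinalities, matched with the
descent classes of `DesT`. -/
def HasCyclicModel {T : Type*} (n : ℕ) (DesT : T → Finset ℕ) : Prop :=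
  ∃ b : Finset (ZMod n) → ℕ, b ∅ = 0 ∧ (∀ J, (∀ x, x ∈ J) → b J = 0) ∧
    (∀ J J', (∀ x, x + 1 ∈ J' ↔ x ∈ J) → b J' = b J) ∧
    ∃ e : T ≃ {p : Finset (ZMod n) × ℕ // p.2 < b p.1}, ∀ t, nonzeroPart (e t).1.1 = DesT t

theorem hasCyclicModel_of_card_subset {Y T : Type*} [Finite Y] [Finite T] [NeZero n]
    (cd : Y → Finset (ZMod n)) (q : Y ≃ Y) (hq : ∀ y x, x + 1 ∈ cd (q y) ↔ x ∈ cd y)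
    (hempty : ∀ y, cd y ≠ ∅) (huniv : ∀ y, ∃ x, x ∉ cd y) (DesT : T → Finset ℕ)
    (hD : ∀ t, DesT t ⊆ Icc 1 (n - 1)) {N : ℕ} (hN : 0 < N)
    (hc : ∀ K ⊆ Icc 1 (n - 1),
      Nat.card {y // nonzeroPart (cd y) ⊆ K} = N * Nat.card {t // DesT t ⊆ K}) :
    HasCyclicModel n DesT := by
  classical
  have := Fintype.ofFinite Y
  have := Fintype.ofFinite T
  let B : Finset (ZMod n) → ℕ := fun J => #{y | cd y = J}
  have hB0 : B ∅ = 0 := by simp [B, hempty]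
  have hBu : ∀ J, (∀ x, x ∈ J) → B J = 0 := fun J hJ => by
    simp only [B, card_eq_zero, filter_eq_empty_iff, mem_univ, true_imp_iff]
    rintro y rfl
    obtain ⟨x, hx⟩ := huniv y
    exact hx (hJ x)
  have hBs : ∀ J J', (∀ x, x + 1 ∈ J' ↔ x ∈ J) → B J' = B J := fun J J' h => by
    refine (card_bij (fun y _ => q y) (fun y hy => ?_) (fun _ _ _ _ h => q.injective h)
      (fun y hy => ⟨q.symm y, ?_, by simp⟩)).symm
    · simp only [mem_filter, mem_univ, true_and] at hy ⊢
      ext x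
      obtain ⟨x, rfl⟩ : ∃ x', x = x' + 1 := ⟨x - 1, by ring⟩
      rw [hq, h, hy]
    · simp only [mem_filter, mem_univ, true_and] at hy ⊢
      ext x
      rw [← h, ← hy, ← hq, q.apply_symm_apply]
  have hsplit : ∀ K ⊆ Icc 1 (n - 1), B (K.image Nat.cast) + B (insert 0 (K.image Nat.cast)) =
      N * Nat.card {t // DesT t = K} := by
    intro K hK
    rw [← card_eq_mul_of_card_subset_eq_mul (fun y => nonzeroPart (cd y)) DesT N hc K hK,
      Nat.card_eq_fintype_card, Fintype.card_subtype, ← card_union_of_disjoint]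
    · congr 1
      ext y
      simp only [mem_union, mem_filter, mem_univ, true_and, nonzeroPart_eq_iff hK]
    · rw [disjoint_left]
      intro y h1 h2
      simp only [mem_filter, mem_univ, true_and] at h1 h2
      have h3 := (nonzeroPart_eq_iff hK).2 (Or.inl h1)
      have h4 := image_nonzeroPart (cd y)
      rw [h3, ← h1] at h4
      rw [h2] at h4
      have := h4 ▸ mem_insert_self (0 : ZMod n) _
      simp at this
  have hrot : ∀ (k : ℕ) (J : Finset (ZMod n)), B (J.image (· - (k : ZMod n))) = B J := by
    intro k
    induction k with
    | zero => intro J; simp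
    | succ k ih =>
      intro J
      rw [← ih J]
      refine (hBs _ _ fun x => ?_).symm
      simp only [mem_image, Nat.cast_succ]
      exact exists_congr fun a => and_congr_right fun _ => by
        rw [sub_eq_iff_eq_add, sub_eq_iff_eq_add]
        constructor <;> rintro rfl <;> ring
  have hdvd : ∀ (m : ℕ) (J : Finset (ZMod n)), #J = m → N ∣ B J := by
    intro m
    induction m with
    | zero => intro J hJ; rw [card_eq_zero.1 hJ, hB0]; exact dvd_zero _
    | succ m ih =>
      intro J hJ
      obtain ⟨x, hx⟩ : J.Nonempty := card_pos.1 (by omega)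
      have h0 := hrot x.val J
      rw [ZMod.natCast_zmod_val] at h0
      set J' := J.image (· - x) with hJ'
      have hc' : #J' = m + 1 := by
        rw [hJ', card_image_of_injective _ (sub_left_injective), hJ]
      have hmem : (0 : ZMod n) ∈ J' := mem_image.2 ⟨x, hx, sub_self x⟩
      have h1 := hsplit (nonzeroPart J') (nonzeroPart_subset _)
      rw [image_nonzeroPart, insert_erase hmem] at h1
      rw [← h0]
      exact (Nat.dvd_add_right (ih _ (by rw [card_erase_of_mem hmem, hc']; rfl))).1
        (h1 ▸ Nat.dvd_mul_right _ _)
  refine ⟨fun J => B J / N, by simp [hB0], fun J hJ => by simp [hBu J hJ],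
    fun J J' h => by simp only [hBs J J' h], ?_⟩
  let M := {p : Finset (ZMod n) × ℕ // p.2 < B p.1 / N}
  have hfin : Finite M := by
    let f : M → Σ J : Finset (ZMod n), Fin (B J / N) := fun p => ⟨p.1.1, ⟨p.1.2, p.2⟩⟩
    refine Finite.of_injective f fun p q h => ?_
    obtain ⟨⟨p1, p2⟩, hp⟩ := p
    obtain ⟨⟨q1, q2⟩, hq⟩ := q
    simp only [f, Sigma.mk.injEq] at h
    obtain ⟨rfl, h⟩ := h
    simp only [heq_eq_eq, Fin.mk.injEq] at h
    simp [h]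
  obtain ⟨e, he⟩ := exists_equiv_of_card_fiber_eq DesT (fun p : M => nonzeroPart p.1.1) (by
    intro K
    by_cases hK : K ⊆ Icc 1 (n - 1)
    · set J₀ : Finset (ZMod n) := K.image Nat.cast with hJ₀
      have h0 : (0 : ZMod n) ∉ J₀ := by
        have := image_nonzeroPart J₀
        rw [(nonzeroPart_eq_iff hK).2 (Or.inl hJ₀), ← hJ₀] at this
        exact this ▸ notMem_erase 0 J₀
      have hne : insert 0 J₀ ≠ J₀ := fun h => h0 (h ▸ mem_insert_self _ _)
      have h1 : Nat.card {t // DesT t = K} = B J₀ / N + B (insert 0 J₀) / N := by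
        have := hsplit K hK
        rw [← hJ₀] at this
        rw [← Nat.add_div_of_dvd_right (hdvd _ _ rfl), this, Nat.mul_div_cancel_left _ hN]
      rw [h1]
      let g : Fin (B J₀ / N) ⊕ Fin (B (insert 0 J₀) / N) → {p : M // nonzeroPart p.1.1 = K} :=
        Sum.elim (fun m => ⟨⟨(J₀, m), m.2⟩, (nonzeroPart_eq_iff hK).2 (Or.inl rfl)⟩)
          (fun m => ⟨⟨(insert 0 J₀, m), m.2⟩, (nonzeroPart_eq_iff hK).2 (Or.inr rfl)⟩)
      have hg : Function.Bijective g := by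
        constructor
        · rintro (a | a) (b | b) h
          all_goals
            have h' := congrArg (fun p => p.1.1) h
            simp only [g, Sum.elim_inl, Sum.elim_inr, Prod.mk.injEq] at h'
          · rw [Fin.ext h'.2]
          · exact absurd h'.1.symm hne
          · exact absurd h'.1 hne
          · rw [Fin.ext h'.2]
        · rintro ⟨⟨⟨J, m⟩, hm⟩, hp⟩
          rcases (nonzeroPart_eq_iff hK).1 hp with h | h
          · obtain rfl : J = J₀ := h
            exact ⟨Sum.inl ⟨m, hm⟩, rfl⟩
          · obtain rfl : J = insert 0 J₀ := h
            exact ⟨Sum.inr ⟨m, hm⟩, rfl⟩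
      rw [← Nat.card_congr (Equiv.ofBijective g hg), Nat.card_sum, Nat.card_fin, Nat.card_fin]
    · have h1 : IsEmpty {t // DesT t = K} := ⟨fun t => hK (t.2 ▸ hD t.1)⟩
      have h2 : IsEmpty {p : M // nonzeroPart p.1.1 = K} :=
        ⟨fun p => hK (p.2 ▸ nonzeroPart_subset _)⟩
      rw [Nat.card_of_isEmpty, Nat.card_of_isEmpty])
  exact ⟨e, he⟩

theorem HasCyclicModel.hasCyclicExtension {T : Type*} [NeZero n] {DesT : T → Finset ℕ}
    (h : HasCyclicModel n DesT) : HasCyclicExtension n DesT := by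
  classical
  obtain ⟨b, h0, hu, hs, e, he⟩ := h
  have hn := NeZero.pos n
  have hsh : ∀ (J : Finset (ZMod n)) (c : ZMod n) x, x + c ∈ J.image (· + c) ↔ x ∈ J :=
    fun J c x => by simp
  have hb : ∀ J : Finset (ZMod n), b (J.image (· + 1)) = b J := fun J => hs _ _ (hsh J 1)
  have hb' : ∀ J : Finset (ZMod n), b (J.image (· - 1)) = b J := fun J => by
    refine (hs _ _ fun x => ?_).symm
    simp [sub_eq_iff_eq_add]
  let q : {p : Finset (ZMod n) × ℕ // p.2 < b p.1} ≃ {p : Finset (ZMod n) × ℕ // p.2 < b p.1} :=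
    { toFun := fun p => ⟨(p.1.1.image (· + 1), p.1.2), by rw [hb]; exact p.2⟩
      invFun := fun p => ⟨(p.1.1.image (· - 1), p.1.2), by rw [hb']; exact p.2⟩
      left_inv := fun p => Subtype.ext (Prod.ext (by
        simp only [image_image, Function.comp_def, add_sub_cancel_right, image_id']) rfl)
      right_inv := fun p => Subtype.ext (Prod.ext (by
        simp only [image_image, Function.comp_def, sub_add_cancel, image_id']) rfl) }
  have hq : ∀ p x, x ∈ (q p).1.1 ↔ ∃ a ∈ p.1.1, a + 1 = x := fun p x => mem_image
  refine ⟨fun t => {i ∈ Icc 1 n | (i : ZMod n) ∈ (e t).1.1}, (e.trans q).trans e.symm,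
    fun t => ⟨filter_subset _ _, ?_, ?_, ?_, ?_⟩⟩
  · rw [← he t]
    ext i
    simp only [mem_inter, mem_filter, mem_nonzeroPart, mem_Icc]
    exact ⟨fun h => ⟨h.2, h.1.2⟩, fun h => ⟨⟨⟨h.1.1, by omega⟩, h.2⟩, h.1⟩⟩
  · ext i
    simp only [Equiv.trans_apply, Equiv.apply_symm_apply, sh, mem_image, mem_filter, mem_Icc, hq]
    constructor
    · rintro ⟨⟨h1, h2⟩, a, ha, hai⟩
      refine ⟨if i = 1 then n else i - 1, ?_, ?_⟩
      · have : (((if i = 1 then n else i - 1 : ℕ)) : ZMod n) = a := by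
          split_ifs with hi
          · rw [hi, Nat.cast_one] at hai
            rw [ZMod.natCast_self]
            exact (by simpa using hai : a = 0).symm
          · rw [Nat.cast_sub h1, ← hai]; simp
        rw [this]
        refine ⟨?_, ha⟩
        split_ifs <;> omega
      · split_ifs with hi
        · simp [hi]
        · rw [Nat.mod_eq_of_lt (by omega)]; omega
    · rintro ⟨k, ⟨hk, hk'⟩, rfl⟩
      have := Nat.mod_lt k hn
      refine ⟨by omega, (k : ZMod n), hk', by simp⟩
  · intro hE
    have hJ : (e t).1.1 = ∅ := by
      rw [eq_empty_iff_forall_notMem] at hE ⊢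
      intro x hx
      refine hE (if x.val = 0 then n else x.val) ?_
      have := ZMod.val_lt x
      rw [mem_filter, mem_Icc]
      refine ⟨by split_ifs <;> omega, ?_⟩
      split_ifs with h
      · rw [ZMod.natCast_self, ← (ZMod.val_eq_zero x).1 h]; exact hx
      · rwa [ZMod.natCast_zmod_val]
    have := (e t).2
    rw [hJ, h0] at this
    omega
  · intro hE
    have hJ : ∀ x, x ∈ (e t).1.1 := by
      intro x
      have h1 : (if x.val = 0 then n else x.val) ∈ Icc 1 n := by
        have := ZMod.val_lt x
        rw [mem_Icc]
        split_ifs <;> omega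
      rw [← hE, mem_filter] at h1
      have h2 := h1.2
      split_ifs at h2 with h
      · rwa [ZMod.natCast_self, ← (ZMod.val_eq_zero x).1 h] at h2
      · rwa [ZMod.natCast_zmod_val] at h2
    have := (e t).2
    rw [hu _ hJ] at this
    omega
end

section
variable {X : Type*} {n : ℕ} {π₀ : Equiv.Perm X} {K : Finset ℕ}

theorem card_permCongr [Finite X] (P : Equiv.Perm (Fin n) → Prop) :
    Nat.card {σ : X ≃ Fin n // P (σ.permCongr π₀)} =
      Nat.card {z : Equiv.Perm X // ∀ x, z (π₀ x) = π₀ (z x)} *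
      Nat.card {π : {π : Equiv.Perm (Fin n) // ∃ σ : X ≃ Fin n, σ.permCongr π₀ = π} // P π.1} := by
  rw [← Nat.card_prod]
  choose s hs using fun π : {π : Equiv.Perm (Fin n) // ∃ σ : X ≃ Fin n, σ.permCongr π₀ = π} => π.2
  have h1 : ∀ (z : Equiv.Perm X) (τ : X ≃ Fin n), (∀ x, z (π₀ x) = π₀ (z x)) →
      (z.trans τ).permCongr π₀ = τ.permCongr π₀ := by
    intro z τ hz
    ext j
    simp only [Equiv.permCongr_apply, Equiv.trans_apply, Equiv.symm_trans_apply]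
    rw [hz, Equiv.apply_symm_apply]
  have h2 : ∀ (σ τ : X ≃ Fin n), σ.permCongr π₀ = τ.permCongr π₀ →
      ∀ x, (σ.trans τ.symm) (π₀ x) = π₀ ((σ.trans τ.symm) x) := by
    intro σ τ h x
    have := congrArg (fun f => τ.symm (f (σ x))) h
    simpa [Equiv.permCongr_apply] using this
  refine Nat.card_congr
    { toFun := fun σ => ⟨⟨σ.1.trans (s ⟨σ.1.permCongr π₀, _, rfl⟩).symm,
        h2 _ _ (hs ⟨σ.1.permCongr π₀, _, rfl⟩).symm⟩, ⟨⟨σ.1.permCongr π₀, _, rfl⟩, σ.2⟩⟩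
      invFun := fun p => ⟨p.1.1.trans (s p.2.1), by rw [h1 _ _ p.1.2, hs]; exact p.2.2⟩
      left_inv := fun σ => ?_
      right_inv := fun p => ?_ }
  · ext; simp
  · obtain ⟨⟨z, hz⟩, ⟨π, hπ⟩, hP⟩ := p
    have h3 : (⟨(z.trans (s ⟨π, hπ⟩)).permCongr π₀, _, rfl⟩ : {π : Equiv.Perm (Fin n) //
        ∃ σ : X ≃ Fin n, σ.permCongr π₀ = π}) = ⟨π, hπ⟩ :=
      Subtype.ext ((h1 _ _ hz).trans (hs _))
    refine Prod.ext (Subtype.ext ?_) (Subtype.ext h3)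
    simp only [h3]
    ext; simp

/-- The words obtained from `blk K` by an arbitrary numbering of the letters' positions. -/
def IsWord (n : ℕ) (K : Finset ℕ) (w : X → ℕ) : Prop :=
  ∃ τ : X ≃ Fin n, ∀ x, w x = blk K (τ x)

theorem IsWord.blk_eq {w : X → ℕ} (hw : IsWord n K w) {σ : X ≃ Fin n}
    (h : ∀ x y, w x < w y → σ x < σ y) (x : X) : blk K (σ x) = w x := by
  obtain ⟨τ, hτ⟩ := hw
  have := eq_comp_of_monotone (f := w) (σ := σ) (τ := τ)
    (fun x y hxy => not_lt.1 fun h' => not_lt.2 hxy (h y x h'))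
    (fun x y hxy => by rw [hτ, hτ]; exact blk_mono K hxy) (σ x)
  rw [hτ (τ.symm _), Equiv.apply_symm_apply, Equiv.symm_apply_apply] at this
  exact this.symm

theorem isStd_blk_iff {Γ : Type*} [LinearOrder Γ] (F : (X → ℕ) → X → Γ)
    (hF : ∀ w x y, w x < w y → F w x < F w y) {w : X → ℕ} (hw : IsWord n K w) (σ : X ≃ Fin n) :
    (IsStd π₀ (F fun x => blk K (σ x)) σ ∧ (fun x => blk K (σ x)) = w) ↔ IsStd π₀ (F w) σ := by
  constructor
  · rintro ⟨h, rfl⟩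
    exact h
  · intro h
    have : (fun x => blk K (σ x)) = w :=
      funext fun x => hw.blk_eq (fun x y hxy => (h x y).1 (hF w x y hxy)) x
    rw [this]
    exact ⟨h, rfl⟩

theorem card_isStd_blk [Finite X] (hX : Nat.card X = n) {Γ : Type*} [LinearOrder Γ]
    (F : (X → ℕ) → X → Γ) (hF : ∀ w x y, w x < w y → F w x < F w y) {w : X → ℕ}
    (hw : IsWord n K w) (ha : IsAper π₀ (F w)) :
    Nat.card {σ : X ≃ Fin n // IsStd π₀ (F fun x => blk K (σ x)) σ ∧ (fun x => blk K (σ x)) = w} =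
      Nat.card {z : Equiv.Perm X // IsSym π₀ (F w) z} := by
  rw [← card_isStd hX ha]
  exact Nat.card_congr (Equiv.subtypeEquivRight fun σ => isStd_blk_iff F hF hw σ)

theorem card_isStd_blk_self [Finite X] (hX : Nat.card X = n) {w : X → ℕ}
    (hw : IsWord n K w) (ha : IsAper π₀ w) :
    Nat.card {σ : X ≃ Fin n // IsStd π₀ (fun x => blk K (σ x)) σ ∧ (fun x => blk K (σ x)) = w} =
      Nat.card {z : Equiv.Perm X // IsSym π₀ w z} :=
  card_isStd_blk hX (fun w => w) (fun _ _ _ h => h) hw ha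

theorem finer_lt_of_lt {Λ : Type*} [LinearOrder Λ] {lam : X → Λ} (w : X → ℕ) (x y : X)
    (h : w x < w y) : finer π₀ lam w x < finer π₀ lam w y :=
  finer_lt_iff.2 (Or.inl h)
end

section
variable {X Λ : Type*} [LinearOrder Λ] {n : ℕ} [NeZero n] {π₀ : Equiv.Perm X} {lam : X → Λ}
  {K : Finset ℕ} {σ : X ≃ Fin n}

/-- Positions as residues. -/
def finZMod (n : ℕ) [NeZero n] : Fin n ≃ ZMod n where
  toFun j := ((j : ℕ) : ZMod n)
  invFun a := ⟨a.val, a.val_lt⟩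
  left_inv j := Fin.ext (ZMod.val_cast_of_lt j.2)
  right_inv a := ZMod.natCast_zmod_val a

theorem fin_sub_val_eq (a b : Fin n) : ((a - b : Fin n) : ℕ) = (finZMod n a - finZMod n b).val := by
  have hb := b.2
  have : finZMod n a - finZMod n b = ((n - (b : ℕ) + a : ℕ) : ZMod n) := by
    simp only [finZMod, Equiv.coe_fn_mk]
    rw [Nat.cast_add, Nat.cast_sub hb.le, ZMod.natCast_self]
    ring
  rw [Fin.val_sub, this, ZMod.val_natCast]

/-- The element whose position is the residue `a`. -/
def atPos (σ : X ≃ Fin n) (a : ZMod n) : X := σ.symm ((finZMod n).symm a)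

theorem atPos_finZMod (x : X) : atPos σ (finZMod n (σ x)) = x := by simp [atPos]

open Classical in
/-- The cyclic descent set of `σ` determined by the labels `lam`. -/
noncomputable def cyc (π₀ : Equiv.Perm X) (lam : X → Λ) (σ : X ≃ Fin n) : Finset (ZMod n) :=
  {a | cval π₀ lam σ (atPos σ a) < cval π₀ lam σ (atPos σ (a - 1))}

theorem mem_cyc {a : ZMod n} : a ∈ cyc π₀ lam σ ↔
    cval π₀ lam σ (atPos σ a) < cval π₀ lam σ (atPos σ (a - 1)) := by
  simp [cyc]

/-- Cyclic rotation of all positions. -/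
def rot (X : Type*) (n : ℕ) [NeZero n] : (X ≃ Fin n) ≃ (X ≃ Fin n) :=
  Equiv.equivCongr (Equiv.refl X)
    ((finZMod n).trans ((Equiv.addRight 1).trans (finZMod n).symm))

theorem finZMod_rot (x : X) : finZMod n (rot X n σ x) = finZMod n (σ x) + 1 := by
  simp [rot, Equiv.equivCongr]

theorem atPos_rot (a : ZMod n) : atPos (rot X n σ) (a + 1) = atPos σ a := by
  have h := finZMod_rot (σ := σ) (atPos σ a)
  have h2 : finZMod n (σ (atPos σ a)) = a := by simp [atPos]
  rw [h2] at h
  rw [← h, atPos_finZMod]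

theorem fin_sub_rot (x y : X) : rot X n σ x - rot X n σ y = σ x - σ y := by
  apply Fin.ext
  rw [fin_sub_val_eq, fin_sub_val_eq, finZMod_rot, finZMod_rot, add_sub_add_right_eq_sub]

omit [LinearOrder Λ] in
theorem cval_rot (x : X) : cval π₀ lam (rot X n σ) x = cval π₀ lam σ x := by
  simp only [cval, fin_sub_rot]

theorem mem_cyc_rot (a : ZMod n) : a + 1 ∈ cyc π₀ lam (rot X n σ) ↔ a ∈ cyc π₀ lam σ := by
  rw [mem_cyc, mem_cyc, atPos_rot, cval_rot, cval_rot, add_sub_cancel_right,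
    ← atPos_rot (a - 1), sub_add_cancel]

theorem exists_notMem_cyc : ∃ a, a ∉ cyc π₀ lam σ := by
  obtain ⟨a, ha⟩ := Finite.exists_min fun a => cval π₀ lam σ (atPos σ a)
  refine ⟨a + 1, fun h => ?_⟩
  rw [mem_cyc, add_sub_cancel_right] at h
  exact not_le.2 h (ha _)

theorem cyc_ne_empty (hlam : ∀ x, lam (π₀ x) ≠ lam x) : cyc π₀ lam σ ≠ ∅ := by
  intro h
  have h1 : ∀ a, cval π₀ lam σ (atPos σ a) ≤ cval π₀ lam σ (atPos σ (a + 1)) := fun a =>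
    not_lt.1 fun hlt => by
      have : a + 1 ∈ cyc π₀ lam σ := mem_cyc.2 (by rwa [add_sub_cancel_right])
      rw [h] at this
      exact notMem_empty _ this
  have h2 : ∀ (k : ℕ) a, cval π₀ lam σ (atPos σ a) ≤ cval π₀ lam σ (atPos σ (a + k)) := by
    intro k
    induction k with
    | zero => intro a; simp
    | succ k ih => intro a; rw [Nat.cast_succ, ← add_assoc]; exact (ih a).trans (h1 _)
  have h3 : ∀ x y, cval π₀ lam σ x ≤ cval π₀ lam σ y := fun x y => by
    have := h2 (finZMod n (σ y) - finZMod n (σ x)).val (finZMod n (σ x))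
    rwa [ZMod.natCast_zmod_val, add_sub_cancel, atPos_finZMod, atPos_finZMod] at this
  obtain x := σ.symm ⟨0, NeZero.pos n⟩
  have h4 := le_antisymm (h3 (π₀ x) x) (h3 x (π₀ x))
  exact hlam x (congrArg (fun p => (ofLex p).1) h4)

theorem nonzeroPart_cyc_subset_iff (hlam : ∀ x, lam (π₀ x) ≠ lam x) :
    nonzeroPart (cyc π₀ lam σ) ⊆ K ↔ IsStd π₀ (finer π₀ lam fun x => blk K (σ x)) σ := by
  rw [← cval_adjacent_iff hlam]
  have hpos : ∀ j : Fin n, atPos σ ((j : ℕ) : ZMod n) = σ.symm j := fun j => by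
    rw [show (((j : ℕ) : ZMod n)) = finZMod n j from rfl, atPos, Equiv.symm_apply_apply]
  constructor
  · intro h j j' hj hK
    by_contra hcon
    refine hK (h (mem_nonzeroPart.2 ⟨by rw [mem_Icc]; omega, mem_cyc.2 ?_⟩))
    rw [hpos, hj, Nat.cast_succ, add_sub_cancel_right, hpos]
    exact not_le.1 hcon
  · intro h i hi
    obtain ⟨hi, hmem⟩ := mem_nonzeroPart.1 hi
    rw [mem_Icc] at hi
    by_contra hcon
    have := h ⟨i - 1, by omega⟩ ⟨i, by omega⟩ (by simp only; omega) hcon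
    rw [← hpos, ← hpos] at this
    rw [mem_cyc] at hmem
    refine not_le.2 hmem ?_
    simp only at this
    rwa [Nat.cast_sub hi.1, Nat.cast_one] at this
end

theorem addRight_pow_apply {r : ℕ} (j : ℕ) (x : ZMod r) :
    ((Equiv.addRight (1 : ZMod r)) ^ j) x = x + j := by
  induction j with
  | zero => simp
  | succ j ih => rw [pow_succ', Equiv.Perm.mul_apply, ih]; simp [add_assoc]

theorem isAper_zmod_iff {r : ℕ} [NeZero r] {Γ : Type*} {κ : ZMod r → Γ} :
    IsAper (Equiv.addRight 1) κ ↔ ∀ a : ZMod r, (∀ x, κ (x + a) = κ x) → a = 0 := by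
  simp only [IsAper, addRight_pow_apply]
  constructor
  · intro h a ha
    have := h 0 a.val fun i => by rw [ZMod.natCast_zmod_val, add_right_comm, ha]
    simpa using this
  · intro h x j hj
    rw [h j, add_zero]
    intro y
    have := hj (y - x).val
    rwa [ZMod.natCast_zmod_val, show x + j + (y - x) = y + j by ring, add_sub_cancel] at this

theorem apply_eq_add_of_commute {r : ℕ} [NeZero r] {z : Equiv.Perm (ZMod r)}
    (hz : ∀ x, z (Equiv.addRight 1 x) = Equiv.addRight 1 (z x)) (x : ZMod r) : z x = x + z 0 := by
  have h : ∀ k : ℕ, z k = k + z 0 := by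
    intro k
    induction k with
    | zero => simp
    | succ k ih =>
      have := hz k
      simp only [Equiv.coe_addRight] at this
      rw [Nat.cast_succ, this, ih]; ring
  have := h x.val
  rwa [ZMod.natCast_zmod_val] at this

theorem IsAper.isSym_zmod_iff {r : ℕ} [NeZero r] {Γ : Type*} {κ : ZMod r → Γ}
    (hκ : IsAper (Equiv.addRight 1) κ) (z : Equiv.Perm (ZMod r)) :
    IsSym (Equiv.addRight 1) κ z ↔ z = 1 := by
  constructor
  · rintro ⟨h1, h2⟩
    have h5 := isAper_zmod_iff.1 hκ (z 0) fun x => by rw [← apply_eq_add_of_commute h1, h2]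
    ext x
    rw [apply_eq_add_of_commute h1, h5]; simp
  · rintro rfl
    exact ⟨fun _ => rfl, fun _ => rfl⟩

theorem hasCyclicModel_single {r p : ℕ} [NeZero r] (hp : p.Prime) (hpr : p * p ∣ r) :
    HasCyclicModel r (fun π : {π : Equiv.Perm (Fin r) //
      ∃ σ : ZMod r ≃ Fin r, σ.permCongr (Equiv.addRight 1) = π} => Des π.1) := by
  have hp1 : p ∣ r := (Dvd.intro _ rfl).trans hpr
  have : NeZero p := ⟨hp.ne_zero⟩
  have : Fact p.Prime := ⟨hp⟩
  set π₀ : Equiv.Perm (ZMod r) := Equiv.addRight 1 with hπ₀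
  let lam : ZMod r → ℕ := fun x => (ZMod.castHom hp1 (ZMod p) x).val
  have hlam0 : ∀ x a, lam (x + a) = lam x ↔ ZMod.castHom hp1 (ZMod p) a = 0 := fun x a => by
    simp only [lam]
    rw [(ZMod.val_injective p).eq_iff, map_add, add_eq_left]
  have hlam : ∀ x, lam (π₀ x) ≠ lam x := fun x h => by
    have := (hlam0 x 1).1 (by simpa [hπ₀] using h)
    rw [map_one] at this
    exact one_ne_zero this
  have hdvd : ∀ a : ZMod r, p * a = 0 → ZMod.castHom hp1 (ZMod p) a = 0 := fun a ha => by
    have h1 : ((p * a.val : ℕ) : ZMod r) = 0 := by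
      rw [Nat.cast_mul, ZMod.natCast_zmod_val, ha]
    rw [ZMod.natCast_eq_zero_iff] at h1
    have h2 : p ∣ a.val := Nat.dvd_of_mul_dvd_mul_left hp.pos (hpr.trans h1)
    rw [← ZMod.natCast_zmod_val a, map_natCast]
    exact (ZMod.natCast_eq_zero_iff _ _).2 h2
  have hA : ∀ w : ZMod r → ℕ, IsAper π₀ (finer π₀ lam w) ↔ IsAper π₀ w := by
    intro w
    rw [hπ₀, isAper_zmod_iff, isAper_zmod_iff]
    have hfin : ∀ a, (∀ x, finer π₀ lam w (x + a) = finer π₀ lam w x) ↔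
        (∀ x, w (x + a) = w x) ∧ ZMod.castHom hp1 (ZMod p) a = 0 := by
      intro a
      simp only [finer_eq_iff, hlam0]
      constructor
      · exact fun h => ⟨fun x => (h x).1, (h 0).2.1⟩
      · rintro ⟨h1, h2⟩ x
        have h3 := (hlam0 x a).2 h2
        have h4 := (hlam0 (x + 1) a).2 h2
        refine ⟨h1 x, h2, ?_⟩
        simp only [Wraps, hπ₀, Equiv.coe_addRight]
        rw [add_right_comm x a 1, h1, h1, h3, h4]
    constructor
    · intro h a ha
      have hmul : ∀ k : ℕ, ∀ x, w (x + k * a) = w x := by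
        intro k
        induction k with
        | zero => simp
        | succ k ih => intro x; rw [Nat.cast_succ, add_mul, one_mul, ← add_assoc, ha, ih]
      have h1 := h (p * a) ((hfin _).2 ⟨hmul p, by
        rw [map_mul, map_natCast, CharP.cast_eq_zero, zero_mul]⟩)
      exact h a ((hfin _).2 ⟨ha, hdvd a h1⟩)
    · exact fun h a ha => h a ((hfin a).1 ha).1
  have hcard : ∀ {Γ : Type} (κ : ZMod r → Γ), IsAper π₀ κ →
      Nat.card {z // IsSym π₀ κ z} = 1 := fun κ hκ => by
    rw [Nat.card_congr (Equiv.subtypeEquivRight hκ.isSym_zmod_iff)]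
    simp
  have hX : Nat.card (ZMod r) = r := by simp
  have hfin : Finite (ZMod r ≃ Fin r) := inferInstance
  refine hasCyclicModel_of_card_subset (fun σ : ZMod r ≃ Fin r => cyc π₀ lam σ) (rot _ r)
    (fun σ a => mem_cyc_rot a) (fun σ => cyc_ne_empty hlam) (fun σ => exists_notMem_cyc) _
    (fun t => Des_subset_Icc _) (N := Nat.card {z : Equiv.Perm (ZMod r) // ∀ x, z (π₀ x) = π₀ (z x)})
    (Nat.card_pos_iff.2 ⟨⟨⟨1, fun _ => rfl⟩⟩, inferInstance⟩) fun K _ => ?_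
  rw [← card_permCongr (fun π => Des π ⊆ K)]
  refine card_eq_of_card_fiber_eq (fun σ x => blk K (σ x)) (fun σ x => blk K (σ x)) fun w => ?_
  simp only [nonzeroPart_cyc_subset_iff hlam, Des_permCongr_subset_iff]
  by_cases hw : IsWord r K w ∧ IsAper π₀ w
  · rw [card_isStd_blk hX (finer π₀ lam) finer_lt_of_lt hw.1 ((hA w).2 hw.2),
      card_isStd_blk_self hX hw.1 hw.2, hcard _ hw.2, hcard _ ((hA w).2 hw.2)]
  · have h1 : IsEmpty {σ : ZMod r ≃ Fin r // IsStd π₀ (finer π₀ lam fun x => blk K (σ x)) σ ∧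
        (fun x => blk K (σ x)) = w} := ⟨fun ⟨σ, h1, h2⟩ => hw ⟨⟨σ, fun x => (congrFun h2 x).symm⟩,
          (hA w).1 (h2 ▸ h1.isAper)⟩⟩
    have h2 : IsEmpty {σ : ZMod r ≃ Fin r // IsStd π₀ (fun x => blk K (σ x)) σ ∧
        (fun x => blk K (σ x)) = w} := ⟨fun ⟨σ, h1, h2⟩ => hw ⟨⟨σ, fun x => (congrFun h2 x).symm⟩,
          h2 ▸ h1.isAper⟩⟩
    rw [Nat.card_of_isEmpty, Nat.card_of_isEmpty]

section
variable {r : ℕ}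

/-- The first offset at which a predicate on residues differs from its value at `0`. -/
noncomputable def firstChange (A : ZMod r → Prop) : ℕ := sInf {k : ℕ | ¬ (A k ↔ A 0)}

open Classical in
/-- The first change counted positively or negatively according to the value at `0`. -/
noncomputable def signedChange (A : ZMod r → Prop) : ℤ :=
  if A 0 then firstChange A else -firstChange A

theorem firstChange_spec [NeZero r] {A : ZMod r → Prop} (h1 : ∃ x, A x) (h2 : ∃ x, ¬ A x) :
    ¬ (A (firstChange A) ↔ A 0) := by
  refine Nat.sInf_mem (s := {k : ℕ | ¬ (A k ↔ A 0)}) ?_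
  obtain ⟨x, hx⟩ := h1
  obtain ⟨y, hy⟩ := h2
  by_cases h : A 0
  · exact ⟨y.val, by rw [Set.mem_ofPred_eq, ZMod.natCast_zmod_val]; tauto⟩
  · exact ⟨x.val, by rw [Set.mem_ofPred_eq, ZMod.natCast_zmod_val]; tauto⟩

theorem firstChange_pos [NeZero r] {A : ZMod r → Prop} (h1 : ∃ x, A x) (h2 : ∃ x, ¬ A x) :
    0 < firstChange A := by
  refine Nat.pos_of_ne_zero fun h => firstChange_spec h1 h2 ?_
  rw [h, Nat.cast_zero]

theorem signedChange_shift [NeZero r] {A : ZMod r → Prop} (h1 : ∃ x, A x) (h2 : ∃ x, ¬ A x) :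
    signedChange (fun x => A (x + 1)) ≠ signedChange A ∧
      (signedChange (fun x => A (x + 1)) < signedChange A ↔ A 0) := by
  have p1 := firstChange_pos h1 h2
  have p2 := firstChange_pos (A := fun x => A (x + 1)) (h1.imp' (· - 1) fun x hx => by simpa)
    (h2.imp' (· - 1) fun x hx => by simpa)
  have key : (A (0 + 1) ↔ A 0) → firstChange (fun x => A (x + 1)) < firstChange A := by
    intro h
    have hk := firstChange_spec h1 h2
    set k := firstChange A
    have : firstChange (fun x => A (x + 1)) ≤ k - 1 := Nat.sInf_le (by
      simp only [Set.mem_ofPred_eq, h]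
      rwa [Nat.cast_sub p1, Nat.cast_one, sub_add_cancel])
    omega
  unfold signedChange
  by_cases ha : A 0 <;> by_cases hb : A (0 + 1) <;> simp only [ha, hb, if_true, if_false] at key ⊢
  · have := key trivial
    simp only [iff_true]; omega
  · simp only [iff_true]; omega
  · simp only [iff_false]; omega
  · have := key trivial
    simp only [iff_false]; omega

theorem HasCyclicModel.exists_labels [NeZero r] {T : Type} [Finite T] {DesT : T → Finset ℕ}
    (h : HasCyclicModel r DesT) :
    ∃ (M : Type) (_ : Finite M) (tr : ZMod r → M → M) (Lam : M → ℤ ×ₗ ℕ) (e : T ≃ M),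
      (∀ a b p, tr a (tr b p) = tr (a + b) p) ∧ (∀ p, tr 0 p = p) ∧ Function.Injective Lam ∧
      (∀ p, Lam (tr 1 p) ≠ Lam p) ∧
      ∀ t i, i + 1 < r → (i + 1 ∈ DesT t ↔
        Lam (tr ((i + 1 : ℕ) : ZMod r) (e t)) < Lam (tr (i : ZMod r) (e t))) := by
  classical
  obtain ⟨b, h0, hu, hs, e, he⟩ := h
  let M := {p : Finset (ZMod r) × ℕ // p.2 < b p.1}
  have hM : Finite M := Finite.of_equiv _ e
  obtain ⟨code, hcode⟩ := Countable.exists_injective_nat M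
  have hb1 : ∀ J : Finset (ZMod r), b (J.image (· - 1)) = b J := fun J => by
    refine (hs _ _ fun x => ?_).symm
    simp [sub_eq_iff_eq_add]
  have hbk : ∀ (k : ℕ) (J : Finset (ZMod r)), b (J.image (· - (k : ZMod r))) = b J := by
    intro k
    induction k with
    | zero => intro J; simp
    | succ k ih =>
      intro J
      rw [← ih J, ← hb1 (J.image (· - (k : ZMod r))), image_image]
      congr 2
      funext x
      simp only [Function.comp, Nat.cast_succ, sub_sub]
  have hb : ∀ (a : ZMod r) (J : Finset (ZMod r)), b (J.image (· - a)) = b J := fun a J => by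
    rw [← ZMod.natCast_zmod_val a, hbk]
  let tr : ZMod r → M → M := fun a p => ⟨(p.1.1.image (· - a), p.1.2), by
    simp only [hb]; exact p.2⟩
  have htr : ∀ a p x, x ∈ (tr a p).1.1 ↔ x + a ∈ p.1.1 := fun a p x => by
    simp [tr, sub_eq_iff_eq_add]
  let Lam : M → ℤ ×ₗ ℕ := fun p => toLex (signedChange fun x => x + 1 ∈ p.1.1, code p)
  have hmem1 : ∀ p : M, ∃ x, x + 1 ∈ p.1.1 := fun p => by
    by_contra hcon
    push Not at hcon
    have : p.1.1 = ∅ := eq_empty_iff_forall_notMem.2 fun x => by simpa using hcon (x - 1)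
    have := p.2
    rw [‹p.1.1 = ∅›, h0] at this
    omega
  have hmem2 : ∀ p : M, ∃ x, x + 1 ∉ p.1.1 := fun p => by
    by_contra hcon
    push Not at hcon
    have := p.2
    rw [hu _ fun x => by simpa using hcon (x - 1)] at this
    omega
  have hlam : ∀ p : M, Lam (tr 1 p) ≠ Lam p ∧ (Lam (tr 1 p) < Lam p ↔ 1 ∈ p.1.1) := fun p => by
    have : (signedChange fun x => x + 1 ∈ (tr 1 p).1.1) ≠ signedChange (fun x => x + 1 ∈ p.1.1) ∧
        ((signedChange fun x => x + 1 ∈ (tr 1 p).1.1) < signedChange (fun x => x + 1 ∈ p.1.1) ↔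
          1 ∈ p.1.1) := by
      simpa only [htr, zero_add] using signedChange_shift (hmem1 p) (hmem2 p)
    constructor
    · intro h
      refine this.1 ?_
      exact congrArg (fun q => (ofLex q).1) h
    · simp only [Lam, Prod.Lex.toLex_lt_toLex]
      tauto
  have hadd : ∀ a b p, tr a (tr b p) = tr (a + b) p := fun a b p => by
    refine Subtype.ext (Prod.ext ?_ rfl)
    ext x
    rw [htr, htr, htr, add_assoc]
  refine ⟨M, hM, tr, Lam, e, hadd, fun p => ?_, fun p q h => hcode ?_, fun p => (hlam p).1,
    fun t i hi => ?_⟩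
  · refine Subtype.ext (Prod.ext ?_ rfl)
    ext x
    rw [htr, add_zero]
  · exact congrArg (fun q => (ofLex q).2) h
  · rw [← he, mem_nonzeroPart, Nat.cast_succ, add_comm (i : ZMod r) 1, ← hadd, (hlam _).2, htr,
      add_comm 1 (i : ZMod r)]
    simp only [mem_Icc]
    exact ⟨fun h => h.2, fun h => ⟨by omega, h⟩⟩
end

section
variable {r : ℕ} [NeZero r] {M Λ : Type*} [LinearOrder Λ] {tr : ZMod r → M → M} {Lam : M → Λ}
  {e : {π : Equiv.Perm (Fin r) // ∃ σ : ZMod r ≃ Fin r, σ.permCongr (Equiv.addRight 1) = π} ≃ M}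
  {u u' u₁ u₂ : ZMod r → ℕ} {p p₁ p₂ : M}

/-- The correspondence between words `u` on a cycle and pairs of a label `p` and a word `u'`:
the standardisation of `u` is relabelled through `e`. -/
def RowRel (tr : ZMod r → M → M)
    (e : {π : Equiv.Perm (Fin r) //
      ∃ σ : ZMod r ≃ Fin r, σ.permCongr (Equiv.addRight 1) = π} ≃ M)
    (u : ZMod r → ℕ) (p : M) (u' : ZMod r → ℕ) : Prop :=
  ∃ (σ : ZMod r ≃ Fin r) (y : ZMod r), IsStd (Equiv.addRight 1) u σ ∧ (σ y : ℕ) = 0 ∧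
    tr y p = e ⟨σ.permCongr (Equiv.addRight 1), σ, rfl⟩ ∧ ∀ x, u x = u' (y + finZMod r (σ x))

omit [NeZero r] in
theorem permCongr_addRight_trans (τ : ZMod r ≃ Fin r) (a : ZMod r) :
    ((Equiv.addRight a).trans τ).permCongr (Equiv.addRight 1) =
      τ.permCongr (Equiv.addRight 1) := by
  refine Equiv.ext fun j => ?_
  simp only [Equiv.permCongr_apply, Equiv.trans_apply, Equiv.symm_trans_apply,
    Equiv.addRight_symm, Equiv.coe_addRight]
  congr 1
  ring

theorem RowRel.isAper (h : RowRel tr e u p u') : IsAper (Equiv.addRight 1) u := by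
  obtain ⟨σ, y, h, -⟩ := h
  exact h.isAper

theorem exists_rowRel_of_isAper (hadd : ∀ a b p, tr a (tr b p) = tr (a + b) p)
    (h0 : ∀ p, tr 0 p = p) (hu : IsAper (Equiv.addRight 1) u) :
    ∃ q : M × (ZMod r → ℕ), RowRel tr e u q.1 q.2 := by
  obtain ⟨σ, hσ⟩ := hu.exists_isStd (n := r) (by simp)
  let y := σ.symm ⟨0, NeZero.pos r⟩
  refine ⟨(tr (-y) (e ⟨σ.permCongr (Equiv.addRight 1), σ, rfl⟩),
    fun x => u (σ.symm ((finZMod r).symm (x - y)))), σ, y, hσ, by simp [y], ?_, fun x => ?_⟩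
  · rw [hadd, add_neg_cancel, h0]
  · simp

theorem RowRel.left_unique (hadd : ∀ a b p, tr a (tr b p) = tr (a + b) p)
    (h0 : ∀ p, tr 0 p = p) {u₁' u₂' : ZMod r → ℕ} (h₁ : RowRel tr e u p₁ u₁')
    (h₂ : RowRel tr e u p₂ u₂') : p₁ = p₂ ∧ u₁' = u₂' := by
  obtain ⟨σ, y, hσ, hy, hp, hu⟩ := h₁
  obtain ⟨σ₂, y₂, hσ₂, hy₂, hp₂, hu₂⟩ := h₂
  have h1 : σ.trans σ₂.symm = 1 := (hσ.isAper.isSym_zmod_iff _).1 (hσ.isSym hσ₂)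
  obtain rfl : σ = σ₂ := by
    ext x
    have := congrArg (fun z => σ₂ (z x)) h1
    exact congrArg Fin.val (by simpa using this)
  obtain rfl : y = y₂ := σ.injective (Fin.ext (hy.trans hy₂.symm))
  constructor
  · rw [← h0 p₁, ← neg_add_cancel y, ← hadd, hp, ← hp₂, hadd, neg_add_cancel, h0]
  · funext x
    have h3 := hu (σ.symm ((finZMod r).symm (x - y)))
    have h4 := hu₂ (σ.symm ((finZMod r).symm (x - y)))
    simp only [Equiv.apply_symm_apply, add_sub_cancel] at h3 h4
    rw [← h3, h4]

theorem RowRel.shift (hadd : ∀ a b p, tr a (tr b p) = tr (a + b) p)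
    (h : RowRel tr e u p u') (a : ZMod r) :
    RowRel tr e (fun x => u (x + a)) (tr a p) fun x => u' (x + a) := by
  obtain ⟨σ, y, hσ, hy, hp, hu⟩ := h
  refine ⟨(Equiv.addRight a).trans σ, y - a, fun x x' => ?_, by simpa using hy, ?_, fun x => ?_⟩
  · have := hσ (x + a) (x' + a)
    simpa only [Equiv.coe_addRight, Equiv.trans_apply, add_right_comm _ (1 : ZMod r) a] using this
  · rw [hadd, sub_add_cancel, hp]
    congr 2
    exact (permCongr_addRight_trans σ a).symm
  · simp only [hu, Equiv.trans_apply, Equiv.coe_addRight]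
    congr 1
    ring

theorem RowRel.exists_perm (h : RowRel tr e u p u') :
    ∃ z : Equiv.Perm (ZMod r), ∀ x, u x = u' (z x) := by
  obtain ⟨σ, y, hσ, hy, hp, hu⟩ := h
  exact ⟨σ.trans ((finZMod r).trans (Equiv.addLeft y)), hu⟩

/-- A label and a word with exactly one wrapping step. -/
def RowCompat (tr : ZMod r → M → M) (Lam : M → Λ) (p : M) (u' : ZMod r → ℕ) : Prop :=
  ∃! x, Wraps (Equiv.addRight 1) (fun x => Lam (tr x p)) u' x

theorem exists_wraps {lam : ZMod r → Λ} (hlam : ∀ x, lam (x + 1) ≠ lam x) :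
    ∃ x, Wraps (Equiv.addRight 1) lam u' x := by
  obtain ⟨x, hx⟩ := Finite.exists_max fun x => (toLex (u' x, lam x) : ℕ ×ₗ Λ)
  have h := hx (x + 1)
  rw [Prod.Lex.toLex_le_toLex] at h
  refine ⟨x, ?_⟩
  rcases h with h | h
  · exact Or.inl h
  · exact Or.inr ⟨h.1, lt_of_le_of_ne h.2 (hlam x)⟩

theorem sub_one_of_forall_lt {P : ZMod r → Prop} {y : ZMod r}
    (h : ∀ k : ℕ, k + 1 < r → ¬ P (y + k)) {x : ZMod r} (hx : P x) : y = x + 1 := by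
  have h1 := h (x - y).val
  rw [ZMod.natCast_zmod_val, add_sub_cancel] at h1
  have h2 := ZMod.val_lt (x - y)
  have h3 : (x - y).val + 1 = r := by
    by_contra hcon
    exact h1 (by omega) hx
  have h4 := congrArg (Nat.cast : ℕ → ZMod r) h3
  rw [Nat.cast_succ, ZMod.natCast_zmod_val, ZMod.natCast_self] at h4
  linear_combination -h4

section
variable (hadd : ∀ a b p, tr a (tr b p) = tr (a + b) p) (hlam : ∀ p, Lam (tr 1 p) ≠ Lam p)
  (he : ∀ t i, i + 1 < r → (i + 1 ∈ Des t.1 ↔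
        Lam (tr ((i + 1 : ℕ) : ZMod r) (e t)) < Lam (tr (i : ZMod r) (e t))))
include hadd hlam he

theorem RowRel.wraps_iff (h : RowRel tr e u p u') :
    ∃ (σ : ZMod r ≃ Fin r) (y : ZMod r), IsStd (Equiv.addRight 1) u σ ∧ (σ y : ℕ) = 0 ∧
    tr y p = e ⟨σ.permCongr (Equiv.addRight 1), σ, rfl⟩ ∧
    (∀ x, u x = u' (y + finZMod r (σ x))) ∧
    ∀ x, Wraps (Equiv.addRight 1) (fun x => Lam (tr x p)) u' x ↔ y = x + 1 := by
  obtain ⟨σ, y, hσ, hy, hp, hu⟩ := h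
  refine ⟨σ, y, hσ, hy, hp, hu, ?_⟩
  have h1 : ∀ k : ℕ, k + 1 < r →
      ¬ Wraps (Equiv.addRight 1) (fun x => Lam (tr x p)) u' (y + k) := by
    intro k hk hw
    have hj : ∀ j : ℕ, (hj : j < r) → u (σ.symm ⟨j, hj⟩) = u' (y + j) := fun j hj => by
      rw [hu, Equiv.apply_symm_apply]; rfl
    have h2 := hj k (by omega)
    have h3 := hj (k + 1) hk
    have hlt : (⟨k, by omega⟩ : Fin r) < ⟨k + 1, hk⟩ := by simp [Fin.lt_def]
    simp only [Wraps, Equiv.coe_addRight] at hw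
    rw [add_assoc, ← Nat.cast_succ, ← h2, ← h3] at hw
    rcases hw with hw | ⟨hw, hl⟩
    · have := (hσ _ _).1 hw
      rw [Equiv.apply_symm_apply, Equiv.apply_symm_apply] at this
      exact lt_asymm this hlt
    · have := (hσ (σ.symm ⟨k, by omega⟩) (σ.symm ⟨k + 1, hk⟩)).2 hw.symm (by simp)
      rw [add_comm y, add_comm y, ← hadd, ← hadd, hp, ← he _ _ hk, mem_Des] at hl
      obtain ⟨j, j', hj1, hj2, hd⟩ := hl
      have e1 : j = ⟨k, by omega⟩ := Fin.ext (by simp only; omega)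
      have e2 : j' = ⟨k + 1, hk⟩ := Fin.ext hj2
      simp only [e1, e2, Equiv.permCongr_apply] at hd
      exact lt_asymm this hd
  have h2 : ∀ x, Wraps (Equiv.addRight 1) (fun x => Lam (tr x p)) u' x → y = x + 1 :=
    fun x hx => sub_one_of_forall_lt (P := fun x => Wraps _ _ u' x) h1 hx
  refine fun x => ⟨h2 x, fun hx => ?_⟩
  obtain ⟨x', hx'⟩ := exists_wraps (u' := u') (lam := fun x => Lam (tr x p)) fun x => by
    rw [add_comm, ← hadd]; exact hlam _
  have := h2 x' hx'
  rwa [add_right_cancel (hx.symm.trans this)]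

theorem RowRel.rowCompat (h : RowRel tr e u p u') : RowCompat tr Lam p u' := by
  obtain ⟨σ, y, -, -, -, -, h⟩ := h.wraps_iff hadd hlam he
  exact ⟨y - 1, (h _).2 (by ring), fun x hx => by rw [(h _).1 hx]; ring⟩

theorem RowRel.right_unique (h₁ : RowRel tr e u₁ p u') (h₂ : RowRel tr e u₂ p u') : u₁ = u₂ := by
  obtain ⟨σ, y, -, hy, hp, hu, hw⟩ := h₁.wraps_iff hadd hlam he
  obtain ⟨σ₂, y₂, -, hy₂, hp₂, hu₂, hw₂⟩ := h₂.wraps_iff hadd hlam he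
  have h3 := (hw₂ (y - 1)).1 ((hw (y - 1)).2 (by ring))
  obtain rfl : y₂ = y := by rw [h3]; ring
  have h4 := e.injective (hp.symm.trans hp₂)
  have h5 : ∀ x, (σ.trans σ₂.symm) (Equiv.addRight 1 x) =
      Equiv.addRight 1 ((σ.trans σ₂.symm) x) := by
    intro x
    have := congrArg (fun t => σ₂.symm (t.1 (σ x))) h4
    simpa [Equiv.permCongr_apply] using this
  have h6 := apply_eq_add_of_commute h5
  have h7 : σ y₂ = σ₂ y₂ := Fin.ext (hy.trans hy₂.symm)
  have h8 := h6 y₂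
  rw [Equiv.trans_apply, h7, Equiv.symm_apply_apply, left_eq_add] at h8
  funext x
  have h9 := h6 x
  rw [h8, add_zero, Equiv.trans_apply, Equiv.symm_apply_eq] at h9
  rw [hu, hu₂, h9]

omit hlam in
theorem RowCompat.exists_rowRel (h : RowCompat tr Lam p u') : ∃ u, RowRel tr e u p u' := by
  obtain ⟨x₀, -, hx₀⟩ := h
  obtain ⟨y, hy⟩ : ∃ y, y = x₀ + 1 := ⟨_, rfl⟩
  obtain ⟨⟨-, τ, rfl⟩, ht⟩ := e.surjective (tr y p)
  let σ : ZMod r ≃ Fin r := (Equiv.addRight (τ.symm ⟨0, NeZero.pos r⟩ - y)).trans τ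
  have hστ : σ.permCongr (Equiv.addRight 1) = τ.permCongr (Equiv.addRight 1) := permCongr_addRight_trans τ _
  have hp : tr y p = e ⟨σ.permCongr (Equiv.addRight 1), σ, rfl⟩ := by
    rw [← ht]
    congr 2
    exact hστ.symm
  have hnw : ∀ k : ℕ, k + 1 < r →
      ¬ Wraps (Equiv.addRight 1) (fun x => Lam (tr x p)) u' (y + k) := by
    intro k hk hw
    have h1 : ((k + 1 : ℕ) : ZMod r) = 0 := by
      have := hx₀ _ hw
      rw [hy, add_assoc, add_eq_left] at this
      rw [Nat.cast_succ, add_comm, this]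
    rw [ZMod.natCast_eq_zero_iff] at h1
    have := Nat.le_of_dvd (Nat.succ_pos k) h1
    omega
  have hadj : ∀ j j' : Fin r, (j' : ℕ) = j + 1 →
      u' (y + (j : ℕ)) ≤ u' (y + (j' : ℕ)) ∧ (u' (y + (j : ℕ)) = u' (y + (j' : ℕ)) →
        σ.permCongr (Equiv.addRight 1) j < σ.permCongr (Equiv.addRight 1) j') := by
    intro j j' hj
    have h1 := hnw j (by omega)
    simp only [Wraps, Equiv.coe_addRight] at h1
    rw [add_assoc, ← Nat.cast_add_one, ← hj] at h1
    push Not at h1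
    refine ⟨h1.1, fun heq => ?_⟩
    have h2 := h1.2 heq.symm
    rw [add_comm y, add_comm y, ← hadd, ← hadd, hp, hj] at h2
    have h3 := mt (he ⟨_, σ, rfl⟩ j (by omega)).1 (not_lt.2 h2)
    rw [mem_Des] at h3
    push Not at h3
    refine lt_of_le_of_ne (h3 j j' hj hj) fun h => ?_
    rw [Equiv.injective _ h] at hj
    omega
  have hmono : Monotone fun j : Fin r => u' (y + (j : ℕ)) := by
    have : ∀ d : ℕ, ∀ j j' : Fin r, (j' : ℕ) = j + d → u' (y + (j : ℕ)) ≤ u' (y + (j' : ℕ)) := by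
      intro d
      induction d with
      | zero => intro j j' h; rw [h]; simp
      | succ d ih =>
        intro j j' h
        exact (ih j ⟨j + d, by omega⟩ rfl).trans (hadj _ _ (by simp only; omega)).1
    intro j j' h
    exact this (j' - j) j j' (by have : (j : ℕ) ≤ j' := h; omega)
  have hrel := rel_of_forall_adjacent hmono
    (R := fun j j' => σ.permCongr (Equiv.addRight 1) j < σ.permCongr (Equiv.addRight 1) j')
    (fun _ _ _ => lt_trans) (fun j j' hj => (hadj j j' hj).2)
  refine ⟨fun x => u' (y + finZMod r (σ x)), σ, y, fun x x' => ⟨fun hlt => ?_, fun heq hlt => ?_⟩,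
    by simp [σ], hp, fun x => rfl⟩
  · by_contra hcon
    exact not_le.2 hlt (hmono (not_lt.1 hcon))
  · have := hrel _ _ hlt heq
    simpa [Equiv.permCongr_apply] using this
end
end

theorem card_eq_of_rel {A B I J : Type*} [Finite A] [Finite B] {P : A → Prop} {Q : B → Prop}
    (f : A → I) (g : B → J) (R : I → J → Prop)
    (hP : ∀ a, P a → ∃ j, R (f a) j) (hQ : ∀ b, Q b → ∃ i, R i (g b))
    (hl : ∀ i j j', R i j → R i j' → j = j') (hr : ∀ i i' j, R i j → R i' j → i = i')
    (hc : ∀ i j, R i j → Nat.card {a // P a ∧ f a = i} = Nat.card {b // Q b ∧ g b = j}) :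
    Nat.card {a // P a} = Nat.card {b // Q b} := by
  have hf : ∀ {i j} a, R i j → ({j' | R (f a) j'} = ({j} : Set J) ↔ f a = i) := by
    intro i j a hij
    constructor
    · intro h
      have : j ∈ {j' | R (f a) j'} := h ▸ Set.mem_singleton j
      exact hr _ _ _ this hij
    · rintro rfl
      ext j'
      exact ⟨fun h => hl _ _ _ h hij, fun h => by rw [Set.mem_singleton_iff.1 h]; exact hij⟩
  refine card_eq_of_card_fiber_eq (fun a => {j | R (f a) j}) (fun b => ({g b} : Set J)) fun S => ?_
  by_cases hS : ∃ i j, R i j ∧ S = {j}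
  · obtain ⟨i, j, hij, rfl⟩ := hS
    simp only [hf _ hij, Set.singleton_eq_singleton_iff]
    exact hc i j hij
  · have h1 : IsEmpty {a // P a ∧ {j | R (f a) j} = S} := ⟨fun ⟨a, ha, h⟩ => by
      obtain ⟨j, hj⟩ := hP a ha
      exact hS ⟨_, j, hj, h.symm.trans ((hf a hj).2 rfl)⟩⟩
    have h2 : IsEmpty {b // Q b ∧ ({g b} : Set J) = S} := ⟨fun ⟨b, hb, h⟩ => by
      obtain ⟨i, hi⟩ := hQ b hb
      exact hS ⟨i, _, hi, h.symm⟩⟩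
    rw [Nat.card_of_isEmpty, Nat.card_of_isEmpty]

/-- The permutation of `ι × ZMod r` whose cycles are the rows. -/
def rowShift (ι : Type*) (r : ℕ) : Equiv.Perm (ι × ZMod r) :=
  (Equiv.refl ι).prodCongr (Equiv.addRight 1)

section
variable {ι : Type*} {r : ℕ}

theorem rowShift_apply (i : ι) (x : ZMod r) : rowShift ι r (i, x) = (i, x + 1) := rfl

theorem rowShift_pow_apply (j : ℕ) (i : ι) (x : ZMod r) :
    ((rowShift ι r) ^ j) (i, x) = (i, x + j) := by
  induction j with
  | zero => simp
  | succ j ih => rw [pow_succ', Equiv.Perm.mul_apply, ih, rowShift_apply]; simp [add_assoc]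

theorem isAper_rowShift_iff {Γ : Type*} {κ : ι × ZMod r → Γ} : IsAper (rowShift ι r) κ ↔
    ∀ i, IsAper (Equiv.addRight 1) fun x => κ (i, x) := by
  simp only [IsAper, Prod.forall, rowShift_pow_apply, addRight_pow_apply, Prod.mk.injEq, true_and]

theorem apply_eq_of_commute_rowShift [NeZero r] {z : ι × ZMod r → ι × ZMod r}
    (hz : ∀ x, z (rowShift ι r x) = rowShift ι r (z x)) (i : ι) (x : ZMod r) :
    z (i, x) = ((z (i, 0)).1, (z (i, 0)).2 + x) := by
  have h : ∀ k : ℕ, z (i, k) = ((z (i, 0)).1, (z (i, 0)).2 + k) := by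
    intro k
    induction k with
    | zero => simp
    | succ k ih =>
      rw [Nat.cast_succ, ← rowShift_apply, hz, ih, rowShift_apply, add_assoc]
  have := h x.val
  rwa [ZMod.natCast_zmod_val] at this

theorem sum_fin_sub_eq [NeZero r] {n : ℕ} (σ : ι × ZMod r ≃ Fin n) (i : ι)
    [DecidablePred fun x : ZMod r => σ (i, x + 1) < σ (i, x)] :
    ∑ x : ZMod r, ((σ (i, x + 1) - σ (i, x) : Fin n) : ℕ) =
      n * #{x : ZMod r | σ (i, x + 1) < σ (i, x)} := by
  zify
  simp only [fin_sub_val, sum_add_distrib, sum_sub_distrib]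
  have h := Equiv.sum_comp (Equiv.addRight (1 : ZMod r)) fun x => (((σ (i, x) : Fin n) : ℕ) : ℤ)
  rw [Equiv.coe_addRight] at h
  rw [h, sub_self, zero_add, card_filter, Nat.cast_sum, mul_sum]
  refine sum_congr rfl fun x _ => ?_
  split_ifs <;> simp

variable [NeZero r] {M Λ : Type*} [LinearOrder Λ] {tr : ZMod r → M → M} {Lam : M → Λ}
  {e : {π : Equiv.Perm (Fin r) // ∃ σ : ZMod r ≃ Fin r, σ.permCongr (Equiv.addRight 1) = π} ≃ M}
  {u w : ι × ZMod r → ℕ} {D : ι → M}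

theorem isSym_rowRel_iff (hadd : ∀ a b p, tr a (tr b p) = tr (a + b) p) (h0 : ∀ p, tr 0 p = p)
    (hL : Function.Injective Lam) (hlam : ∀ p, Lam (tr 1 p) ≠ Lam p)
    (he : ∀ t i, i + 1 < r → (i + 1 ∈ Des t.1 ↔
        Lam (tr ((i + 1 : ℕ) : ZMod r) (e t)) < Lam (tr (i : ZMod r) (e t))))
    (h : ∀ i, RowRel tr e (fun x => u (i, x)) (D i) fun x => w (i, x)) (z : Equiv.Perm (ι × ZMod r)) :
    IsSym (rowShift ι r) u z ↔
      IsSym (rowShift ι r) (finer (rowShift ι r) (fun x => Lam (tr x.2 (D x.1))) w) z := by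
  refine and_congr_right fun hz => ?_
  have hz' := apply_eq_of_commute_rowShift hz
  have hsh : ∀ i, RowRel tr e (fun x => u (z (i, x))) (tr (z (i, 0)).2 (D (z (i, 0)).1))
      fun x => w (z (i, x)) := fun i => by
    have := (h (z (i, 0)).1).shift hadd (z (i, 0)).2
    simpa only [add_comm _ (z (i, 0)).2, ← hz' i] using this
  constructor
  · intro hu
    have h1 : ∀ i, tr (z (i, 0)).2 (D (z (i, 0)).1) = D i ∧
        (fun x => w (z (i, x))) = fun x => w (i, x) := fun i => by
      have := hsh i
      simp only [hu] at this
      exact this.left_unique hadd h0 (h i)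
    have hw : ∀ x, w (z x) = w x := fun x => congrFun (h1 x.1).2 x.2
    have hl : ∀ x, Lam (tr (z x).2 (D (z x).1)) = Lam (tr x.2 (D x.1)) := fun x => by
      rw [← (h1 x.1).1, hadd, add_comm, show z x = _ from hz' x.1 x.2]
    intro x
    rw [finer_eq_iff]
    refine ⟨hw x, hl x, ?_⟩
    simp only [Wraps]
    rw [← hz, hw, hw, hl, hl]
  · intro hf
    have h2 := fun x => finer_eq_iff.1 (hf x)
    have h3 : ∀ i, (fun x => u (z (i, x))) = fun x => u (i, x) := fun i => by
      have := hsh i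
      have h4 : tr (z (i, 0)).2 (D (z (i, 0)).1) = D i := by
        have := hL (h2 (i, 0)).2.1
        simpa only [h0] using this
      simp only [h2, h4] at this
      exact this.right_unique hadd hlam he (h i)
    exact fun x => congrFun (h3 x.1) x.2

theorem isWord_rowRel_iff {n : ℕ} {K : Finset ℕ}
    (h : ∀ i, RowRel tr e (fun x => u (i, x)) (D i) fun x => w (i, x)) :
    IsWord n K u ↔ IsWord n K w := by
  choose z hz using fun i => (h i).exists_perm
  let z' : Equiv.Perm (ι × ZMod r) := Equiv.prodShear (Equiv.refl ι) z
  have hz' : ∀ x, u x = w (z' x) := fun x => hz x.1 x.2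
  constructor
  · rintro ⟨τ, hτ⟩
    refine ⟨z'.symm.trans τ, fun x => ?_⟩
    rw [Equiv.trans_apply, ← hτ, hz', Equiv.apply_symm_apply]
  · rintro ⟨τ, hτ⟩
    exact ⟨z'.trans τ, fun x => by rw [hz', hτ]; rfl⟩

theorem isAper_finer_of_rowCompat (h : ∀ i, RowCompat tr Lam (D i) fun x => w (i, x)) :
    IsAper (rowShift ι r) (finer (rowShift ι r) (fun x => Lam (tr x.2 (D x.1))) w) := by
  rw [isAper_rowShift_iff]
  intro i
  rw [isAper_zmod_iff]
  intro a ha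
  obtain ⟨x, hx, hx'⟩ := h i
  have h1 := (finer_eq_iff.1 (ha x)).2.2
  exact add_eq_left.1 (hx' (x + a) (h1.2 hx))

theorem rowCompat_iff_card {n : ℕ} [NeZero n] {σ : ι × ZMod r ≃ Fin n}
    (hadd : ∀ a b p, tr a (tr b p) = tr (a + b) p) (hlam : ∀ p, Lam (tr 1 p) ≠ Lam p)
    (hσ : IsStd (rowShift ι r) (finer (rowShift ι r) (fun x => Lam (tr x.2 (D x.1))) w) σ) (i : ι) :
    RowCompat tr Lam (D i) (fun x => w (i, x)) ↔
      ∑ x : ZMod r, ((σ (i, x + 1) - σ (i, x) : Fin n) : ℕ) = n := by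
  classical
  have h1 : ∀ x, Wraps (Equiv.addRight 1) (fun x => Lam (tr x (D i))) (fun x => w (i, x)) x ↔
      σ (i, x + 1) < σ (i, x) := fun x =>
    wraps_iff (π₀ := rowShift ι r) (lam := fun x => Lam (tr x.2 (D x.1))) (w := w)
      (fun x => by
        rw [show (rowShift ι r x).2 = x.2 + 1 from rfl, add_comm, ← hadd]
        exact hlam _)
      (fun x y hxy => (hσ x y).1 (finer_lt_iff.2 (hxy.imp_right fun h => ⟨h.1, Or.inl h.2⟩))) (i, x)
  rw [sum_fin_sub_eq, mul_eq_left₀ (NeZero.ne n), card_eq_one, RowCompat]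
  simp only [h1, ExistsUnique, Finset.ext_iff, mem_filter, mem_univ, true_and, mem_singleton]
  exact exists_congr fun x => ⟨fun h y => ⟨h.2 y, fun hy => hy ▸ h.1⟩,
    fun h => ⟨(h x).2 rfl, fun y hy => (h y).1 hy⟩⟩

theorem HasCyclicModel.prod [Finite ι] [Nonempty ι] {n : ℕ} (hX : Nat.card (ι × ZMod r) = n)
    (h : HasCyclicModel r (fun π : {π : Equiv.Perm (Fin r) //
      ∃ σ : ZMod r ≃ Fin r, σ.permCongr (Equiv.addRight 1) = π} => Des π.1)) :
    HasCyclicModel n (fun π : {π : Equiv.Perm (Fin n) //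
      ∃ σ : ι × ZMod r ≃ Fin n, σ.permCongr (rowShift ι r) = π} => Des π.1) := by
  obtain ⟨M, hM, tr, Lam, e, hadd, h0, hL, hlam, he⟩ := h.exists_labels
  have hn : NeZero n := ⟨by rw [← hX]; exact Nat.card_ne_zero.2 ⟨inferInstance, inferInstance⟩⟩
  let lam : (ι → M) → ι × ZMod r → ℤ ×ₗ ℕ := fun D x => Lam (tr x.2 (D x.1))
  have hlam' : ∀ D x, lam D (rowShift ι r x) ≠ lam D x := fun D x => by
    simp only [lam]
    rw [show (rowShift ι r x).2 = x.2 + 1 from rfl, add_comm, ← hadd]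
    exact hlam _
  let C : (ι × ZMod r ≃ Fin n) → Prop := fun σ =>
    ∀ i, ∑ x : ZMod r, ((σ (i, x + 1) - σ (i, x) : Fin n) : ℕ) = n
  let q : {b : (ι → M) × (ι × ZMod r ≃ Fin n) // C b.2} ≃
      {b : (ι → M) × (ι × ZMod r ≃ Fin n) // C b.2} :=
    ((Equiv.refl _).prodCongr (rot _ n)).subtypeEquiv fun b => by
      simp only [C, Equiv.prodCongr_apply, Prod.map_snd, fin_sub_rot]
  refine hasCyclicModel_of_card_subset
    (fun b : {b : (ι → M) × (ι × ZMod r ≃ Fin n) // C b.2} => cyc (rowShift ι r) (lam b.1.1) b.1.2)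
    q (fun b a => mem_cyc_rot a) (fun b => cyc_ne_empty (hlam' _)) (fun b => exists_notMem_cyc) _
    (fun t => Des_subset_Icc _)
    (N := Nat.card {z : Equiv.Perm (ι × ZMod r) // ∀ x, z (rowShift ι r x) = rowShift ι r (z x)})
    (Nat.card_pos_iff.2 ⟨⟨⟨1, fun _ => rfl⟩⟩, inferInstance⟩) fun K _ => ?_
  rw [← card_permCongr (fun π => Des π ⊆ K)]
  simp only [nonzeroPart_cyc_subset_iff (hlam' _), Des_permCongr_subset_iff]
  rw [Nat.card_congr (Equiv.subtypeSubtypeEquivSubtypeInter (fun b : (ι → M) × _ => C b.2)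
    fun b => IsStd (rowShift ι r) (finer (rowShift ι r) (lam b.1) fun x => blk K (b.2 x)) b.2)]
  symm
  refine card_eq_of_rel (fun σ x => blk K (σ x))
    (fun b => ((b.1, fun x => blk K (b.2 x)) : (ι → M) × (ι × ZMod r → ℕ)))
    (fun u j => ∀ i, RowRel tr e (fun x => u (i, x)) (j.1 i) fun x => j.2 (i, x)) ?_ ?_ ?_ ?_ ?_
  · intro σ hσ
    choose q hq using fun i => exists_rowRel_of_isAper (e := e) hadd h0
      (isAper_rowShift_iff.1 hσ.isAper i)
    exact ⟨(fun i => (q i).1, fun x => (q x.1).2 x.2), hq⟩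
  · rintro ⟨D, σ⟩ ⟨hC, hσ⟩
    choose u hu using fun i => RowCompat.exists_rowRel hadd he
      ((rowCompat_iff_card hadd hlam hσ i).2 (hC i))
    exact ⟨fun x => u x.1 x.2, hu⟩
  · rintro u ⟨D, w⟩ ⟨D', w'⟩ h1 h2
    have := fun i => (h1 i).left_unique hadd h0 (h2 i)
    exact Prod.ext (funext fun i => (this i).1) (funext fun x => congrFun (this x.1).2 x.2)
  · rintro u u' ⟨D, w⟩ h1 h2
    exact funext fun x => congrFun ((h1 x.1).right_unique hadd hlam he (h2 x.1)) x.2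
  · rintro u ⟨D, w⟩ h1
    have hco := fun i => (h1 i).rowCompat hadd hlam he
    have e1 : Nat.card {b : (ι → M) × (ι × ZMod r ≃ Fin n) // (C b.2 ∧ IsStd (rowShift ι r)
          (finer (rowShift ι r) (lam b.1) fun x => blk K (b.2 x)) b.2) ∧
          (b.1, fun x => blk K (b.2 x)) = (D, w)} =
        Nat.card {σ : ι × ZMod r ≃ Fin n // IsStd (rowShift ι r)
          (finer (rowShift ι r) (lam D) fun x => blk K (σ x)) σ ∧
          (fun x => blk K (σ x)) = w} := by
      refine Nat.card_congr
        { toFun := fun b => ⟨b.1.2, ?_⟩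
          invFun := fun σ => ⟨(D, σ.1), ⟨?_, σ.2.1⟩, Prod.ext rfl σ.2.2⟩
          left_inv := fun b => ?_
          right_inv := fun σ => rfl }
      · obtain ⟨⟨D', σ⟩, ⟨-, h3⟩, h4⟩ := b
        obtain ⟨rfl, h5⟩ := Prod.mk.injEq .. ▸ h4
        exact ⟨h3, h5⟩
      · obtain ⟨σ, h3, rfl⟩ := σ
        exact fun i => (rowCompat_iff_card hadd hlam h3 i).1 (hco i)
      · obtain ⟨⟨D', σ⟩, ⟨-, h3⟩, h4⟩ := b
        obtain ⟨rfl, h5⟩ := Prod.mk.injEq .. ▸ h4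
        rfl
    rw [e1]
    by_cases hw : IsWord n K u
    · rw [card_isStd_blk_self hX hw (isAper_rowShift_iff.2 fun i => (h1 i).isAper),
        card_isStd_blk hX (finer (rowShift ι r) (lam D)) finer_lt_of_lt ((isWord_rowRel_iff h1).1 hw)
        (isAper_finer_of_rowCompat hco)]
      exact Nat.card_congr (Equiv.subtypeEquivRight
        (isSym_rowRel_iff hadd h0 hL hlam he h1))
    · have h3 : IsEmpty {σ : ι × ZMod r ≃ Fin n // IsStd (rowShift ι r)
          (fun x => blk K (σ x)) σ ∧ (fun x => blk K (σ x)) = u} :=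
        ⟨fun ⟨σ, _, h⟩ => hw ⟨σ, fun x => (congrFun h x).symm⟩⟩
      have h4 : IsEmpty {σ : ι × ZMod r ≃ Fin n // IsStd (rowShift ι r)
          (finer (rowShift ι r) (lam D) fun x => blk K (σ x)) σ ∧
          (fun x => blk K (σ x)) = w} :=
        ⟨fun ⟨σ, _, h⟩ => hw ((isWord_rowRel_iff h1).2 ⟨σ, fun x => (congrFun h x).symm⟩)⟩
      rw [Nat.card_of_isEmpty, Nat.card_of_isEmpty]
end

theorem mem_sh_iff {n : ℕ} (hn : 0 < n) {S : Finset ℕ} (hS : S ⊆ Icc 1 n) {k : ℕ} :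
    k + 1 ∈ sh n S ↔ k = 0 ∧ n ∈ S ∨ k < n ∧ k ∈ S := by
  rw [sh, mem_image]
  constructor
  · rintro ⟨a, ha, hak⟩
    have h := mem_Icc.1 (hS ha)
    rcases h.2.eq_or_lt with rfl | hlt
    · rw [Nat.mod_self] at hak
      exact Or.inl ⟨by omega, ha⟩
    · rw [Nat.mod_eq_of_lt hlt] at hak
      obtain rfl : a = k := by omega
      exact Or.inr ⟨hlt, ha⟩
  · rintro (⟨rfl, h⟩ | ⟨h1, h2⟩)
    · exact ⟨n, h, by simp⟩
    · exact ⟨k, h2, by rw [Nat.mod_eq_of_lt h1]⟩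

theorem sh_subset {n : ℕ} (hn : 0 < n) (S : Finset ℕ) : sh n S ⊆ Icc 1 n := by
  intro k hk
  obtain ⟨a, -, rfl⟩ := mem_image.1 hk
  have := Nat.mod_lt a hn
  rw [mem_Icc]; omega

theorem inter_eq_Icc_iff {n i : ℕ} (hi : i < n) {S : Finset ℕ} (hS : S ⊆ Icc 1 n) :
    S ∩ Icc 1 (n - 1) = Icc 1 i ↔ S = Icc 1 i ∨ sh n S = Icc 1 (i + 1) := by
  have hn : 0 < n := by omega
  constructor
  · intro h
    have hk : ∀ k, 1 ≤ k → k < n → (k ∈ S ↔ k ≤ i) := fun k h1 h2 => by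
      have := Finset.ext_iff.1 h k
      rw [mem_inter, mem_Icc, mem_Icc] at this
      constructor
      · exact fun hk => (this.1 ⟨hk, h1, by omega⟩).2
      · exact fun hk => (this.2 ⟨h1, hk⟩).1
    by_cases hnS : n ∈ S
    · right
      ext k
      rcases k with _ | k
      · exact ⟨fun h => by simpa using sh_subset hn S h, fun h => by simp at h⟩
      · rw [mem_sh_iff hn hS, mem_Icc]
        rcases Nat.eq_zero_or_pos k with rfl | hk0
        · simp [hnS]
        · constructor
          · rintro (h | h)
            · omega
            · have := (hk k hk0 h.1).1 h.2
              omega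
          · exact fun h => Or.inr ⟨by omega, (hk k hk0 (by omega)).2 (by omega)⟩
    · left
      ext k
      rw [mem_Icc]
      constructor
      · intro hkS
        have h1 := mem_Icc.1 (hS hkS)
        have h2 : k ≠ n := fun he => hnS (he ▸ hkS)
        exact ⟨h1.1, (hk k h1.1 (by omega)).1 hkS⟩
      · exact fun h => (hk k h.1 (by omega)).2 h.2
  · rintro (rfl | h)
    · ext k; rw [mem_inter, mem_Icc, mem_Icc]; omega
    · ext k
      have h1 := Finset.ext_iff.1 h (k + 1)
      rw [mem_sh_iff hn hS, mem_Icc] at h1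
      rw [mem_inter, mem_Icc, mem_Icc]
      constructor
      · rintro ⟨h2, h3⟩
        have := h1.1 (Or.inr ⟨by omega, h2⟩)
        omega
      · intro h2
        rcases h1.2 (by omega) with h3 | h3
        · omega
        · exact ⟨h3.2, by omega⟩

theorem HasCyclicExtension.alternating_sum_eq_zero {T : Type*} [Finite T] {n : ℕ} (hn : 0 < n)
    {DesT : T → Finset ℕ} (h : HasCyclicExtension n DesT) :
    ∑ i ∈ range n, (-1 : ℤ) ^ i * Nat.card {t // DesT t = Icc 1 i} = 0 := by
  classical
  have := Fintype.ofFinite T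
  obtain ⟨cD, p, h⟩ := h
  let c : ℕ → ℤ := fun i => #{t | cD t = Icc 1 i}
  have h1 : ∀ i < n, (Nat.card {t // DesT t = Icc 1 i} : ℤ) = c i + c (i + 1) := by
    intro i hi
    rw [Nat.card_eq_fintype_card, Fintype.card_subtype]
    have h2 : #{t | cD t = Icc 1 (i + 1)} = #{t | cD (p t) = Icc 1 (i + 1)} :=
      (card_bij (fun t _ => p t) (fun t ht => by simpa using ht) (fun _ _ _ _ h => p.injective h)
        fun t ht => ⟨p.symm t, by simpa using ht, by simp⟩).symm
    simp only [c]
    rw [h2]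
    norm_cast
    rw [← card_union_of_disjoint]
    · congr 1
      ext t
      obtain ⟨hs, hd, hp, -⟩ := h t
      simp only [mem_filter, mem_univ, true_and, mem_union]
      rw [← hd, inter_eq_Icc_iff hi hs, hp]
    · rw [disjoint_left]
      intro t h3 h4
      obtain ⟨hs, -, hp, -⟩ := h t
      simp only [mem_filter, mem_univ, true_and] at h3 h4
      rw [hp] at h4
      have : 0 + 1 ∈ sh n (cD t) := by rw [h4, mem_Icc]; omega
      rw [mem_sh_iff hn hs, h3, mem_Icc, mem_Icc] at this
      omega
  have h2 : ∀ m ≤ n, ∑ i ∈ range m, (-1 : ℤ) ^ i * Nat.card {t // DesT t = Icc 1 i} =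
      c 0 - (-1) ^ m * c m := by
    intro m
    induction m with
    | zero => simp
    | succ m ih =>
      intro hm
      rw [sum_range_succ, ih (by omega), h1 m (by omega)]
      ring
  have h3 : c 0 = 0 := by
    simp only [c, Nat.cast_eq_zero, card_eq_zero, filter_eq_empty_iff]
    intro t _
    simpa using (h t).2.2.2.1
  have h4 : c n = 0 := by
    simp only [c, Nat.cast_eq_zero, card_eq_zero, filter_eq_empty_iff]
    exact fun t _ => (h t).2.2.2.2
  rw [h2 n le_rfl, h3, h4]
  simp

theorem sum_powerset_superset_neg_one_pow (D B : Finset ℕ) :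
    ∑ K ∈ B.powerset with D ⊆ K, (-1 : ℤ) ^ #K = if D = B then (-1) ^ #B else 0 := by
  by_cases h : D ⊆ B
  · have h1 : {K ∈ B.powerset | D ⊆ K} = (B \ D).powerset.image (D ∪ ·) := by
      rw [← Finset.Icc_eq_image_powerset h]
      ext K
      simp [and_comm]
    have hd : ∀ E ∈ (B \ D).powerset, Disjoint D E := fun E hE =>
      disjoint_of_subset_right (mem_powerset.1 hE) disjoint_sdiff
    rw [h1, sum_image]
    · rw [sum_congr rfl fun E hE => by rw [card_union_of_disjoint (hd E hE), pow_add], ← mul_sum,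
        sum_powerset_neg_one_pow_card]
      by_cases hB : D = B
      · simp [hB]
      · rw [if_neg fun hBD => hB (h.antisymm (sdiff_eq_empty_iff_subset.1 hBD)), if_neg hB,
          mul_zero]
    · intro E hE E' hE' heq
      simp only at heq
      rw [← union_sdiff_cancel_left (hd E hE), heq, union_sdiff_cancel_left (hd E' hE')]
  · rw [if_neg fun h' => h h'.subset]
    refine sum_eq_zero fun K hK => ?_
    rw [mem_filter, mem_powerset] at hK
    exact absurd (hK.2.trans hK.1) h

section
variable {X : Type*} {n : ℕ} {π₀ : Equiv.Perm X}

/-- The values of `w` form an initial segment of `ℕ`. -/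
def IsInit (w : X → ℕ) : Prop := ∀ x, ∀ k ≤ w x, ∃ y, w y = k

theorem IsInit.lt [Finite X] (hX : Nat.card X = n) {w : X → ℕ} (hw : IsInit w) (x : X) : w x < n := by
  classical
  have := Fintype.ofFinite X
  have h : range (w x + 1) ⊆ univ.image w := fun k hk => by
    obtain ⟨y, hy⟩ := hw x k (by rw [mem_range] at hk; omega)
    exact mem_image.2 ⟨y, mem_univ _, hy⟩
  have := (card_le_card h).trans card_image_le
  rw [card_range, card_univ, ← Nat.card_eq_fintype_card, hX] at this
  exact this

open Classical in
/-- The functions on `X` whose values form an initial segment. -/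
noncomputable def initWords (X : Type*) [Finite X] : Finset (X → ℕ) :=
  letI := Fintype.ofFinite X
  {w ∈ Fintype.piFinset fun _ : X => range (Nat.card X) | IsInit w}

theorem mem_initWords [Finite X] {w : X → ℕ} : w ∈ initWords X ↔ IsInit w := by
  simp only [initWords, mem_filter, Fintype.mem_piFinset, mem_range]
  exact ⟨fun h => h.2, fun h => ⟨h.lt rfl, h⟩⟩

theorem blk_eq_card {K : Finset ℕ} {j : ℕ} (hK : K ⊆ Icc 1 j) : blk K j = #K := by
  rw [blk, filter_true_of_mem fun k hk => (mem_Icc.1 (hK hk)).2]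

theorem exists_blk_eq {K : Finset ℕ} (h0 : 0 ∉ K) (j : ℕ) : ∀ k ≤ blk K j, ∃ i ≤ j, blk K i = k := by
  induction j with
  | zero =>
    intro k hk
    have : blk K 0 = 0 := by
      rw [blk, card_eq_zero, filter_eq_empty_iff]
      intro k hk h
      rw [Nat.le_zero.1 h] at hk
      exact h0 hk
    exact ⟨0, le_rfl, by omega⟩
  | succ j ih =>
    intro k hk
    rcases hk.eq_or_lt with rfl | hlt
    · exact ⟨j + 1, le_rfl, rfl⟩
    · rw [blk_succ] at hlt
      obtain ⟨i, hi, hik⟩ := ih k (by split_ifs at hlt <;> omega)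
      exact ⟨i, by omega, hik⟩

theorem sum_initWords_eq [Finite X] (σ : X ≃ Fin n) (x : X)
    [DecidablePred fun w : X → ℕ => IsStd π₀ w σ ∧ ∀ y, w y ≤ w x] :
    ∑ w ∈ initWords X with IsStd π₀ w σ ∧ ∀ y, w y ≤ w x, (-1 : ℤ) ^ w x =
      ∑ K ∈ (Icc 1 (σ x : ℕ)).powerset with Des (σ.permCongr π₀) ⊆ K, (-1 : ℤ) ^ #K := by
  symm
  refine sum_bij (fun K _ y => blk K (σ y)) (fun K hK => ?_) (fun K hK K' hK' h => ?_)
    (fun w hw => ?_) fun K hK => ?_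
  · rw [mem_filter, mem_powerset] at hK
    rw [mem_filter, mem_initWords]
    refine ⟨fun y k hk => ?_, Des_permCongr_subset_iff.1 hK.2, fun y => ?_⟩
    · obtain ⟨i, hi, hik⟩ := exists_blk_eq (fun h0 => by simpa using hK.1 h0) _ k hk
      have := (σ y).2
      exact ⟨σ.symm ⟨i, by omega⟩, by simpa using hik⟩
    · change blk K (σ y) ≤ blk K (σ x)
      rw [blk_eq_card hK.1]
      exact card_le_card (filter_subset _ _)
  · rw [mem_filter, mem_powerset] at hK hK'
    have h1 : ∀ j < n, blk K j = blk K' j := fun j hj => by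
      simpa using congrFun h (σ.symm ⟨j, hj⟩)
    have h2 : ∀ j, j + 1 < n → (j + 1 ∈ K ↔ j + 1 ∈ K') := fun j hj => by
      have h3 := h1 (j + 1) hj
      rw [blk_succ, blk_succ, h1 j (by omega)] at h3
      split_ifs at h3 with h4 h5 h5 <;> simp_all
    have := (σ x).2
    have hb : ∀ K : Finset ℕ, K ⊆ Icc 1 (σ x : ℕ) → ∀ k ∈ K, ∃ j, k = j + 1 ∧ j + 1 < n :=
      fun K hK k hk => ⟨k - 1, by have := mem_Icc.1 (hK hk); omega⟩
    ext k
    constructor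
    · intro hk
      obtain ⟨j, rfl, hj⟩ := hb K hK.1 k hk
      exact (h2 j hj).1 hk
    · intro hk
      obtain ⟨j, rfl, hj⟩ := hb K' hK'.1 k hk
      exact (h2 j hj).2 hk
  · rw [mem_filter, mem_initWords] at hw
    obtain ⟨hw, hs, hm⟩ := hw
    have hn : 0 < n := (σ x).pos
    let v : ℕ → ℕ := fun j => if h : j < n then w (σ.symm ⟨j, h⟩) else 0
    have hv : ∀ y, v (σ y) = w y := fun y => by simp [v]
    have hvi : ∀ j, (h : j < n) → v j = w (σ.symm ⟨j, h⟩) := fun j h => dif_pos h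
    have hmono : ∀ i j, i ≤ j → j < n → v i ≤ v j := fun i j hij hj => by
      rw [hvi i (by omega), hvi j hj]
      by_contra hcon
      have := (hs _ _).1 (not_le.1 hcon)
      simp only [Equiv.apply_symm_apply, Fin.mk_lt_mk] at this
      omega
    let K : Finset ℕ := {k ∈ Icc 1 (n - 1) | v (k - 1) < v k}
    have hsurj : ∀ j < n, ∀ k ≤ v j, ∃ i ≤ j, v i = k := fun j hj k hk => by
      obtain ⟨y, hy⟩ := hw (σ.symm ⟨j, hj⟩) k (by rwa [hvi j hj] at hk)
      rcases hk.eq_or_lt with rfl | hlt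
      · exact ⟨j, le_rfl, rfl⟩
      · refine ⟨σ y, ?_, by rw [hv, hy]⟩
        by_contra hcon
        have := hmono j (σ y) (by omega) (σ y).2
        rw [hv, hy] at this
        omega
    have hblk : ∀ j < n, blk K j = v j := by
      intro j
      induction j with
      | zero =>
        intro hj
        obtain ⟨i, hi, hi0⟩ := hsurj 0 hj 0 (Nat.zero_le _)
        obtain rfl : i = 0 := by omega
        rw [hi0, blk, card_eq_zero, filter_eq_empty_iff]
        intro k hk h
        have := mem_Icc.1 (mem_filter.1 hk).1
        omega
      | succ j ih =>
        intro hj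
        rw [blk_succ, ih (by omega)]
        have hle := hmono j (j + 1) (by omega) hj
        have hmem : j + 1 ∈ K ↔ v j < v (j + 1) := by
          simp only [K, mem_filter, mem_Icc, Nat.add_sub_cancel]
          exact ⟨fun h => h.2, fun h => ⟨by omega, h⟩⟩
        split_ifs with hjK
        · rw [hmem] at hjK
          obtain ⟨i, hi, hik⟩ := hsurj (j + 1) hj (v j + 1) (by omega)
          rcases hi.eq_or_lt with rfl | hlt
          · exact hik.symm
          · have := hmono i j (by omega) (by omega)
            omega
        · rw [hmem] at hjK
          omega
    have hwb : (fun y => blk K (σ y)) = w := funext fun y => by rw [hblk _ (σ y).2, hv]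
    refine ⟨K, ?_, hwb⟩
    rw [mem_filter, mem_powerset]
    refine ⟨fun k hk => ?_, Des_permCongr_subset_iff.2 (hwb ▸ hs)⟩
    simp only [K, mem_filter, mem_Icc] at hk
    rw [mem_Icc]
    refine ⟨hk.1.1, ?_⟩
    by_contra hcon
    have h1 := hmono (σ x) (k - 1) (by omega) (by omega)
    have h2 := hm (σ.symm ⟨k, by omega⟩)
    rw [← hvi, ← hv x] at h2
    omega
  · rw [mem_filter, mem_powerset] at hK
    simp only [blk_eq_card hK.1]
end

theorem HasCyclicExtension.sum_initWords_eq_zero {X : Type*} [Fintype X] {n : ℕ} (hn : 0 < n)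
    {π₀ : Equiv.Perm X}
    (h : HasCyclicExtension n (fun π : {π : Equiv.Perm (Fin n) //
      ∃ σ : X ≃ Fin n, σ.permCongr π₀ = π} => Des π.1)) :
    ∑ x : X, ∑ w ∈ initWords X with ∀ y, w y ≤ w x,
      (-1 : ℤ) ^ w x * Nat.card {σ : X ≃ Fin n // IsStd π₀ w σ} = 0 := by
  classical
  have h1 : ∑ i ∈ range n,
      (-1 : ℤ) ^ i * Nat.card {σ : X ≃ Fin n // Des (σ.permCongr π₀) = Icc 1 i} = 0 := by
    have h2 := h.alternating_sum_eq_zero hn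
    rw [sum_congr rfl fun i _ => by
      rw [card_permCongr (X := X) (π₀ := π₀) (fun π => Des π = Icc 1 i), Nat.cast_mul,
        mul_left_comm], ← mul_sum, h2, mul_zero]
  calc _ = ∑ x : X, ∑ σ : X ≃ Fin n,
        ∑ w ∈ initWords X with IsStd π₀ w σ ∧ ∀ y, w y ≤ w x, (-1 : ℤ) ^ w x := by
        refine sum_congr rfl fun x _ => ?_
        simp only [Nat.card_eq_fintype_card, Fintype.card_subtype, card_filter, Nat.cast_sum,
          mul_sum]
        rw [sum_comm]
        refine sum_congr rfl fun σ _ => ?_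
        rw [sum_filter, sum_filter]
        refine sum_congr rfl fun w _ => ?_
        by_cases hw : IsStd π₀ w σ <;> simp [hw]
    _ = ∑ x : X, ∑ σ : X ≃ Fin n,
        if Des (σ.permCongr π₀) = Icc 1 (σ x : ℕ) then (-1 : ℤ) ^ (σ x : ℕ) else 0 := by
        refine sum_congr rfl fun x _ => sum_congr rfl fun σ _ => ?_
        rw [sum_initWords_eq, sum_powerset_superset_neg_one_pow, Nat.card_Icc,
          Nat.add_sub_cancel]
    _ = ∑ σ : X ≃ Fin n, ∑ i ∈ range n,
        if Des (σ.permCongr π₀) = Icc 1 i then (-1 : ℤ) ^ i else 0 := by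
        rw [sum_comm]
        refine sum_congr rfl fun σ _ => ?_
        rw [← Fin.sum_univ_eq_sum_range
          (fun i => if Des (σ.permCongr π₀) = Icc 1 i then (-1 : ℤ) ^ i else 0)]
        exact σ.sum_comp fun i => if Des (σ.permCongr π₀) = Icc 1 (i : ℕ) then (-1 : ℤ) ^ (i : ℕ) else 0
    _ = 0 := by
        rw [sum_comm]
        refine (sum_congr rfl fun i _ => ?_).trans h1
        rw [Nat.card_eq_fintype_card, Fintype.card_subtype, card_filter, Nat.cast_sum, mul_sum]
        exact sum_congr rfl fun σ _ => by split_ifs <;> simp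

/-- The Ramanujan sum of modulus `r`, for `r` squarefree. -/
def ramanujan (r : ℕ) (c : ZMod r) : ℤ :=
  ∏ p ∈ r.primeFactors, if (c.cast : ZMod p) = 0 then (p : ℤ) - 1 else -1

section
variable {r : ℕ}

theorem ramanujan_of_isUnit {c : ZMod r} (hc : IsUnit c) :
    ramanujan r c = (-1) ^ #r.primeFactors := by
  rw [ramanujan, ← prod_const]
  refine prod_congr rfl fun p hp => if_neg fun h => ?_
  have hpr := Nat.dvd_of_mem_primeFactors hp
  have : Fact p.Prime := ⟨Nat.prime_of_mem_primeFactors hp⟩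
  obtain ⟨m, hm⟩ := hc.exists_right_inv
  have := congrArg (ZMod.castHom hpr (ZMod p)) hm
  rw [map_mul, map_one, ZMod.castHom_apply, h, zero_mul] at this
  exact zero_ne_one this

theorem sum_ramanujan_eq_zero [NeZero r] (hr : Squarefree r) {p : ℕ} (hp : p.Prime) {b : ZMod r}
    (hb : b ≠ 0) (hpb : p • b = 0) (c : ZMod r) :
    ∑ k ∈ range p, ramanujan r (c + k • b) = 0 := by
  have h1 : ∀ q ∈ r.primeFactors, q ≠ p → (b.cast : ZMod q) = 0 := by
    intro q hq hqp
    have hqr := Nat.dvd_of_mem_primeFactors hq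
    have : Fact q.Prime := ⟨Nat.prime_of_mem_primeFactors hq⟩
    have h := congrArg (ZMod.castHom hqr (ZMod q)) hpb
    rw [map_nsmul, map_zero, nsmul_eq_mul, mul_eq_zero, ZMod.natCast_eq_zero_iff] at h
    rcases h with h | h
    · exact absurd ((Nat.prime_dvd_prime_iff_eq Fact.out hp).1 h) hqp
    · exact h
  have h2 : ∃ q ∈ r.primeFactors, (b.cast : ZMod q) ≠ 0 := by
    by_contra! hcon
    apply hb
    rw [← ZMod.natCast_zmod_val b, ZMod.natCast_eq_zero_iff]
    have h : ∏ q ∈ r.primeFactors, q ∣ b.val :=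
      prod_primes_dvd _ (fun q hq => (Nat.prime_of_mem_primeFactors hq).prime) fun q hq => by
        rw [← ZMod.natCast_eq_zero_iff, ZMod.natCast_val]
        exact hcon q hq
    rwa [Nat.prod_primeFactors_of_squarefree hr] at h
  obtain ⟨q, hq, hqb⟩ := h2
  obtain rfl : q = p := by
    by_contra h
    exact hqb (h1 q hq h)
  have : Fact q.Prime := ⟨hp⟩
  have hqr := Nat.dvd_of_mem_primeFactors hq
  have h3 : ∀ k ∈ range q, ramanujan r (c + k • b) =
      (∏ p ∈ r.primeFactors.erase q, if (c.cast : ZMod p) = 0 then (p : ℤ) - 1 else -1) *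
        if (c.cast : ZMod q) + k * b.cast = 0 then (q : ℤ) - 1 else -1 := by
    intro k _
    have hcast : ∀ p ∈ r.primeFactors,
        ((c + k • b : ZMod r).cast : ZMod p) = c.cast + k * b.cast := fun p hp =>
      (map_add (ZMod.castHom (Nat.dvd_of_mem_primeFactors hp) (ZMod p)) c (k • b)).trans
        (by rw [map_nsmul, nsmul_eq_mul]; rfl)
    rw [ramanujan, ← prod_erase_mul _ _ hq, hcast q hq]
    congr 1
    refine prod_congr rfl fun p hp => ?_
    rw [mem_erase] at hp
    rw [hcast p hp.2, h1 p hp.2 hp.1, mul_zero, add_zero]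
  rw [sum_congr rfl h3, ← mul_sum]
  have h4 : ∑ k ∈ range q, (if (c.cast : ZMod q) + k * b.cast = 0 then (q : ℤ) - 1 else -1) =
      ∑ y : ZMod q, if y = 0 then (q : ℤ) - 1 else -1 := by
    refine sum_bij (fun k _ => (c.cast : ZMod q) + k * b.cast) (fun _ _ => mem_univ _)
      (fun k hk l hl h => ?_) (fun y _ => ?_) fun _ _ => rfl
    · have h5 := mul_right_cancel₀ hqb (add_left_cancel h)
      rw [ZMod.natCast_eq_natCast_iff'] at h5
      rwa [Nat.mod_eq_of_lt (mem_range.1 hk), Nat.mod_eq_of_lt (mem_range.1 hl)] at h5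
    · refine ⟨((y - c.cast) / b.cast).val, mem_range.2 (ZMod.val_lt _), ?_⟩
      rw [ZMod.natCast_zmod_val, div_mul_cancel₀ _ hqb, add_sub_cancel]
  have h6 : ∀ y : ZMod q, (if y = 0 then (q : ℤ) - 1 else -1) = (if y = 0 then (q : ℤ) else 0) - 1 :=
    fun y => by split_ifs <;> simp
  rw [h4, sum_congr rfl fun y _ => h6 y, sum_sub_distrib]
  simp [ZMod.card]
end

/-- The translation by `b` of the row `i`. -/
def rowTrans {ι : Type*} [DecidableEq ι] {r : ℕ} (i : ι) (b : ZMod r) : Equiv.Perm (ι × ZMod r) where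
  toFun x := (x.1, if x.1 = i then x.2 + b else x.2)
  invFun x := (x.1, if x.1 = i then x.2 - b else x.2)
  left_inv x := by ext <;> grind
  right_inv x := by ext <;> grind

/-- The sum of the translation amounts of the rows. -/
def totalTrans {ι : Type*} [Fintype ι] {r : ℕ} (z : Equiv.Perm (ι × ZMod r)) : ZMod r :=
  ∑ i, (z (i, 0)).2

section
variable {ι : Type*} {r : ℕ}

theorem rowTrans_commute [DecidableEq ι] (i : ι) (b : ZMod r) (x : ι × ZMod r) :
    rowTrans i b (rowShift ι r x) = rowShift ι r (rowTrans i b x) := by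
  obtain ⟨j, x⟩ := x
  by_cases h : j = i <;> simp [rowTrans, rowShift_apply, h, add_right_comm]

theorem injective_row_of_commute [NeZero r] {z : Equiv.Perm (ι × ZMod r)}
    (hz : ∀ x, z (rowShift ι r x) = rowShift ι r (z x)) :
    Function.Injective fun i => (z (i, 0)).1 := by
  intro i j h
  have h1 : z (i, -(z (i, 0)).2) = z (j, -(z (j, 0)).2) := by
    rw [apply_eq_of_commute_rowShift hz, apply_eq_of_commute_rowShift hz j]
    exact Prod.ext h (by simp)
  exact congrArg Prod.fst (z.injective h1)

theorem totalTrans_mul_rowTrans [Fintype ι] [DecidableEq ι] [NeZero r] {z : Equiv.Perm (ι × ZMod r)}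
    (hz : ∀ x, z (rowShift ι r x) = rowShift ι r (z x)) (i : ι) (b : ZMod r) :
    totalTrans (z * rowTrans i b) = totalTrans z + b := by
  have h : ∀ j, ((z * rowTrans i b) (j, 0)).2 = (z (j, 0)).2 + if j = i then b else 0 := by
    intro j
    rw [Equiv.Perm.mul_apply]
    change (z (j, if j = i then 0 + b else 0)).2 = _
    rw [apply_eq_of_commute_rowShift hz, zero_add]
  rw [totalTrans, sum_congr rfl fun j _ => h j, sum_add_distrib]
  simp [totalTrans]

theorem totalTrans_eq_zero_of_isSym [Fintype ι] [NeZero r] {Γ : Type*} {κ : ι × ZMod r → Γ}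
    {z : Equiv.Perm (ι × ZMod r)} (ha : IsAper (rowShift ι r) κ) (hz : IsSym (rowShift ι r) κ z) :
    totalTrans z = 0 := by
  rw [isAper_rowShift_iff] at ha
  simp only [isAper_zmod_iff] at ha
  let P : ι → (ZMod r → Γ) → Prop := fun i v => ∃ t, ∀ x, v x = κ (i, x + t)
  have hne : Nonempty (ZMod r → Γ) ∨ IsEmpty ι := by
    rcases isEmpty_or_nonempty ι with h | ⟨⟨i⟩⟩
    · exact Or.inr h
    · exact Or.inl ⟨fun x => κ (i, x)⟩
  rcases hne with hne | hne
  swap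
  · simp [totalTrans]
  have hP : ∀ i, P i (Classical.epsilon (P i)) := fun i =>
    Classical.epsilon_spec ⟨fun x => κ (i, x), 0, fun x => by rw [add_zero]⟩
  choose c hc using hP
  have hk : ∀ i x, κ ((z (i, 0)).1, (z (i, 0)).2 + x) = κ (i, x) := fun i x => by
    rw [← apply_eq_of_commute_rowShift hz.1, hz.2]
  have h1 : ∀ i, (z (i, 0)).2 + c i = c (z (i, 0)).1 := by
    intro i
    have h2 : P (z (i, 0)).1 = P i := by
      funext v
      refine propext ⟨fun ⟨t, ht⟩ => ⟨t - (z (i, 0)).2, fun x => ?_⟩,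
        fun ⟨t, ht⟩ => ⟨(z (i, 0)).2 + t, fun x => ?_⟩⟩
      · rw [ht, ← hk i]
        congr 2
        ring
      · rw [ht, ← hk i]
        congr 2
        ring
    rw [← sub_eq_zero]
    refine ha (z (i, 0)).1 _ fun x => ?_
    have h3 := hc (z (i, 0)).1 (x - c (z (i, 0)).1)
    rw [h2, hc i, ← hk i, sub_add_cancel] at h3
    rw [← h3]
    congr 2
    ring
  have h4 := ((injective_row_of_commute hz.1).bijective_of_finite).sum_comp c
  rw [← sum_congr rfl fun i _ => h1 i, sum_add_distrib] at h4
  exact add_eq_right.1 h4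

theorem ramanujan_zero_mul_card_isStd [Fintype ι] [DecidableEq ι] [NeZero r] (hr : Squarefree r)
    {n : ℕ} (hX : Nat.card (ι × ZMod r) = n) {Γ : Type*} [LinearOrder Γ] (κ : ι × ZMod r → Γ)
    [DecidablePred (IsSym (rowShift ι r) κ)] :
    ramanujan r 0 * Nat.card {σ : ι × ZMod r ≃ Fin n // IsStd (rowShift ι r) κ σ} =
      ∑ z : Equiv.Perm (ι × ZMod r) with IsSym (rowShift ι r) κ z, ramanujan r (totalTrans z) := by
  by_cases ha : IsAper (rowShift ι r) κ
  · rw [card_isStd hX ha, Nat.card_eq_fintype_card, Fintype.card_subtype, mul_comm,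
      ← nsmul_eq_mul, ← sum_const]
    refine sum_congr rfl fun z hz => ?_
    rw [totalTrans_eq_zero_of_isSym ha (mem_filter.1 hz).2]
  · have : IsEmpty {σ : ι × ZMod r ≃ Fin n // IsStd (rowShift ι r) κ σ} :=
      ⟨fun σ => ha σ.2.isAper⟩
    rw [Nat.card_of_isEmpty, Nat.cast_zero, mul_zero]
    simp only [isAper_rowShift_iff, isAper_zmod_iff] at ha
    push Not at ha
    obtain ⟨i, a, ha, ha0⟩ := ha
    obtain ⟨p, hp, hpa⟩ := Nat.exists_prime_and_dvd (mt AddMonoid.addOrderOf_eq_one_iff.1 ha0)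
    obtain ⟨m, hm⟩ := hpa
    have hpos : 0 < addOrderOf a := addOrderOf_pos a
    have hm0 : 0 < m := Nat.pos_of_ne_zero fun h => by simp [hm, h] at hpos
    have hb0 : m • a ≠ 0 := fun h => by
      have h1 := Nat.le_of_dvd hm0 (addOrderOf_dvd_of_nsmul_eq_zero h)
      have := hp.two_le
      nlinarith
    have hpb : p • m • a = 0 := by
      rw [← mul_nsmul', ← hm, addOrderOf_nsmul_eq_zero]
    have hκ : ∀ (k : ℕ) x, κ (i, x + k • a) = κ (i, x) := by
      intro k
      induction k with
      | zero => simp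
      | succ k ih => intro x; rw [succ_nsmul, ← add_assoc, ha, ih]
    have hsym : ∀ (k : ℕ) (z : Equiv.Perm (ι × ZMod r)), IsSym (rowShift ι r) κ z ↔
        IsSym (rowShift ι r) κ (z * rowTrans i (k • m • a)) := by
      intro k z
      have h1 : ∀ x, κ (rowTrans i (k • m • a) x) = κ x := by
        rintro ⟨j, x⟩
        change κ (j, if j = i then x + _ else x) = _
        split_ifs with h
        · rw [h, ← mul_nsmul', hκ]
        · rfl
      constructor
      · exact fun h => ⟨fun x => by
          rw [Equiv.Perm.mul_apply, rowTrans_commute, h.1, Equiv.Perm.mul_apply], fun x => by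
          rw [Equiv.Perm.mul_apply, h.2, h1]⟩
      · refine fun h => ⟨fun x => ?_, fun x => ?_⟩
        · have := h.1 ((rowTrans i (k • m • a)).symm x)
          rwa [Equiv.Perm.mul_apply, rowTrans_commute, Equiv.Perm.mul_apply,
            Equiv.apply_symm_apply] at this
        · have := h.2 ((rowTrans i (k • m • a)).symm x)
          rwa [Equiv.Perm.mul_apply, Equiv.apply_symm_apply, ← h1 (Equiv.symm _ x),
            Equiv.apply_symm_apply] at this
    have hshift : ∀ k : ℕ,
        ∑ z : Equiv.Perm (ι × ZMod r) with IsSym (rowShift ι r) κ z, ramanujan r (totalTrans z) =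
        ∑ z : Equiv.Perm (ι × ZMod r) with IsSym (rowShift ι r) κ z,
          ramanujan r (totalTrans z + k • m • a) := by
      intro k
      refine (sum_equiv (Equiv.mulRight (rowTrans i (k • m • a))) (fun z => ?_) fun z hz => ?_).symm
      · simpa using hsym k z
      · rw [Equiv.coe_mulRight, totalTrans_mul_rowTrans (mem_filter.1 hz).2.1]
    have h5 : (p : ℤ) * ∑ z : Equiv.Perm (ι × ZMod r) with IsSym (rowShift ι r) κ z,
        ramanujan r (totalTrans z) = 0 := by
      rw [← nsmul_eq_mul, ← card_range p, ← sum_const, sum_congr rfl fun k _ => hshift k, sum_comm]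
      exact sum_eq_zero fun z _ => sum_ramanujan_eq_zero hr hp hb0 hpb _
    exact ((mul_eq_zero.1 h5).resolve_left (by exact_mod_cast hp.ne_zero)).symm
end

theorem sum_initWords_invariant {X : Type*} [Finite X] (z : Equiv.Perm X) (x : X)
    [DecidablePred fun w : X → ℕ => (∀ y, w (z y) = w y) ∧ ∀ y, w y ≤ w x]
    [Decidable (∀ y, z.SameCycle x y)] :
    ∑ w ∈ initWords X with (∀ y, w (z y) = w y) ∧ ∀ y, w y ≤ w x, (-1 : ℤ) ^ w x =
      if ∀ y, z.SameCycle x y then 1 else 0 := by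
  classical
  have hzk : ∀ w : X → ℕ, (∀ y, w (z y) = w y) → ∀ y, z.SameCycle x y → w y = w x := by
    intro w hw y hy
    obtain ⟨i, -, rfl⟩ := hy.exists_pow_eq'
    induction i with
    | zero => rfl
    | succ i ih => rw [pow_succ', Equiv.Perm.mul_apply, hw, ih ⟨i, by simp⟩]
  split_ifs with ht
  · have h : {w ∈ initWords X | (∀ y, w (z y) = w y) ∧ ∀ y, w y ≤ w x} = {fun _ => 0} := by
      ext w
      rw [mem_filter, mem_initWords, mem_singleton]
      constructor
      · rintro ⟨h1, h2, -⟩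
        obtain ⟨y0, hy0⟩ := h1 x 0 (Nat.zero_le _)
        exact funext fun y => by rw [hzk w h2 y (ht y), ← hzk w h2 y0 (ht y0), hy0]
      · rintro rfl
        exact ⟨fun y k hk => ⟨y, (Nat.le_zero.1 hk).symm⟩, fun _ => rfl, fun _ => le_rfl⟩
    rw [h, sum_singleton, pow_zero]
  · push Not at ht
    obtain ⟨y1, hy1⟩ := ht
    let A : (X → ℕ) → Prop := fun w => ∃ y, ¬ z.SameCycle x y ∧ w y = w x
    let g : (X → ℕ) → X → ℕ := fun w y =>
      if z.SameCycle x y then (if A w then w x + 1 else w x - 1) else w y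
    have hg1 : ∀ w y, z.SameCycle x y → g w y = if A w then w x + 1 else w x - 1 :=
      fun w y h => if_pos h
    have hg2 : ∀ w y, ¬ z.SameCycle x y → g w y = w y := fun w y h => if_neg h
    have hgx : ∀ w, g w x = if A w then w x + 1 else w x - 1 :=
      fun w => hg1 w x (Equiv.Perm.SameCycle.refl _ _)
    have hlt : ∀ w : X → ℕ, (∀ y, w y ≤ w x) → ¬ A w → ∀ y, ¬ z.SameCycle x y → w y < w x :=
      fun w h1 h2 y hy => lt_of_le_of_ne (h1 y) fun h => h2 ⟨y, hy, h⟩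
    have hpos : ∀ w : X → ℕ, (∀ y, w y ≤ w x) → ¬ A w → 0 < w x :=
      fun w h1 h2 => (Nat.zero_le _).trans_lt (hlt w h1 h2 y1 hy1)
    have hA : ∀ w, IsInit w → (∀ y, w (z y) = w y) → (∀ y, w y ≤ w x) → (A (g w) ↔ ¬ A w) := by
      intro w h1 h2 h3
      constructor
      · rintro ⟨y, hy, hyx⟩ h4
        rw [hg2 w y hy, hgx, if_pos h4] at hyx
        have := h3 y
        omega
      · intro h4
        have h5 := hpos w h3 h4
        obtain ⟨y, hy⟩ := h1 x (w x - 1) (by omega)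
        have h6 : ¬ z.SameCycle x y := fun h => by
          have := hzk w h2 y h
          omega
        exact ⟨y, h6, by rw [hg2 w y h6, hgx, if_neg h4, hy]⟩
    refine sum_involution (fun w _ => g w) (fun w hw => ?_) (fun w hw _ h => ?_) (fun w hw => ?_)
      fun w hw => ?_
    all_goals
      rw [mem_filter, mem_initWords] at hw
      obtain ⟨h1, h2, h3⟩ := hw
    · rw [hgx]
      split_ifs with h
      · ring
      · obtain ⟨m, hm⟩ := Nat.exists_eq_succ_of_ne_zero (hpos w h3 h).ne'
        rw [hm, Nat.succ_sub_one, pow_succ]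
        ring
    · have h4 := congrFun h x
      rw [hgx] at h4
      split_ifs at h4 with h5
      · omega
      · have := hpos w h3 h5
        omega
    · rw [mem_filter, mem_initWords]
      refine ⟨fun y k hk => ?_, fun y => ?_, fun y => ?_⟩
      · by_cases h4 : A w
        · by_cases h5 : k = w x + 1
          · exact ⟨x, by rw [hgx, if_pos h4, h5]⟩
          · have hkx : k ≤ w x := by
              by_cases hy : z.SameCycle x y
              · rw [hg1 w y hy, if_pos h4] at hk
                omega
              · rw [hg2 w y hy] at hk
                exact hk.trans (h3 y)
            rcases hkx.eq_or_lt with rfl | hkx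
            · obtain ⟨y', hy', h6⟩ := h4
              exact ⟨y', by rw [hg2 w y' hy', h6]⟩
            · obtain ⟨y', hy'⟩ := h1 x k hkx.le
              refine ⟨y', ?_⟩
              rw [hg2 w y' fun h => ?_, hy']
              have := hzk w h2 y' h
              omega
        · have h5 := hpos w h3 h4
          have hkx : k < w x := by
            by_cases hy : z.SameCycle x y
            · rw [hg1 w y hy, if_neg h4] at hk
              omega
            · rw [hg2 w y hy] at hk
              exact hk.trans_lt (hlt w h3 h4 y hy)
          obtain ⟨y', hy'⟩ := h1 x k hkx.le
          refine ⟨y', ?_⟩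
          rw [hg2 w y' fun h => ?_, hy']
          have := hzk w h2 y' h
          omega
      · simp only [g, Equiv.Perm.sameCycle_apply_right, h2]
      · by_cases hy : z.SameCycle x y
        · rw [hg1 w y hy, hgx]
        · rw [hg2 w y hy, hgx]
          split_ifs with h4
          · exact (h3 y).trans (Nat.le_succ _)
          · have := hlt w h3 h4 y hy
            omega
    · funext y
      by_cases hy : z.SameCycle x y
      · rw [hg1 _ y hy, hzk w h2 y hy, hgx]
        by_cases h4 : A w
        · rw [if_neg fun h => (hA w h1 h2 h3).1 h h4, if_pos h4, Nat.add_sub_cancel]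
        · have := hpos w h3 h4
          rw [if_pos ((hA w h1 h2 h3).2 h4), if_neg h4]
          omega
      · rw [hg2 _ y hy, hg2 w y hy]

section
variable {ι : Type*} {r : ℕ} [NeZero r]

theorem isUnit_totalTrans [Fintype ι] {z : Equiv.Perm (ι × ZMod r)}
    (hz : ∀ x, z (rowShift ι r x) = rowShift ι r (z x)) {x : ι × ZMod r}
    (ht : ∀ y, z.SameCycle x y) : IsUnit (totalTrans z) := by
  classical
  have hall : ∀ a b, z.SameCycle a b := fun a b => (ht a).symm.trans (ht b)
  obtain ⟨i, -⟩ := x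
  let ζ : Equiv.Perm ι := Equiv.ofBijective _ (injective_row_of_commute hz).bijective_of_finite
  have hpow : ∀ (k : ℕ) i x, (z ^ k) (i, x) =
      ((ζ ^ k) i, x + ∑ j ∈ range k, (z ((ζ ^ j) i, 0)).2) := by
    intro k i x
    induction k with
    | zero => simp
    | succ k ih =>
      rw [pow_succ', Equiv.Perm.mul_apply, ih, apply_eq_of_commute_rowShift hz, sum_range_succ,
        pow_succ', Equiv.Perm.mul_apply]
      exact Prod.ext rfl (by ring)
  have hcyc : ζ.IsCycleOn (univ : Finset ι) := by
    refine ⟨by simp, fun a _ b _ => ?_⟩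
    obtain ⟨k, -, hk⟩ := (hall (a, 0) (b, 0)).exists_pow_eq'
    rw [hpow] at hk
    exact ⟨k, by simpa using congrArg Prod.fst hk⟩
  have hsum : ∑ j ∈ range #(univ : Finset ι), (z ((ζ ^ j) i, 0)).2 = totalTrans z := by
    have hinj : Set.InjOn (fun j => (ζ ^ j) i) (range #(univ : Finset ι)) := fun j hj l hl h =>
      Nat.ModEq.eq_of_lt_of_lt ((hcyc.pow_apply_eq_pow_apply (mem_univ i)).1 h)
        (by simpa using hj) (by simpa using hl)
    have himg : (range #(univ : Finset ι)).image (fun j => (ζ ^ j) i) = univ :=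
      eq_univ_of_card _ (by rw [card_image_of_injOn hinj, card_range, card_univ])
    exact (sum_image (f := fun j => (z (j, 0)).2) hinj).symm.trans (by rw [himg, totalTrans])
  have hmul : ∀ (m : ℕ) x, ((z ^ #(univ : Finset ι)) ^ m) (i, x) = (i, x + m * totalTrans z) := by
    intro m x
    induction m with
    | zero => simp
    | succ m ih =>
      rw [pow_succ', Equiv.Perm.mul_apply, ih, hpow, hcyc.pow_card_apply (mem_univ i), hsum]
      push_cast
      exact Prod.ext rfl (by ring)
  obtain ⟨k, -, hk⟩ := (hall (i, 0) (i, 1)).exists_pow_eq'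
  have hki := congrArg Prod.fst hk
  rw [hpow] at hki
  obtain ⟨m, rfl⟩ := (hcyc.pow_apply_eq (mem_univ i)).1 hki
  rw [pow_mul, hmul, zero_add] at hk
  exact IsUnit.of_mul_eq_one_right _ (congrArg Prod.snd hk)

theorem exists_transitive_commute (s : ℕ) : ∃ z : Equiv.Perm (Fin (s + 1) × ZMod r),
    (∀ x, z (rowShift _ r x) = rowShift _ r (z x)) ∧ ∀ y, z.SameCycle (0, 0) y := by
  let z : Equiv.Perm (Fin (s + 1) × ZMod r) :=
    (rowTrans (Fin.last s) 1).trans ((finRotate (s + 1)).prodCongr (Equiv.refl _))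
  have hz : ∀ i x, z (i, x) = (i + 1, if i = Fin.last s then x + 1 else x) := fun i x => by
    change (finRotate (s + 1) i, _) = _
    rw [finRotate_apply]
    rfl
  have h1 : ∀ (x : ZMod r) (j : ℕ) (hj : j < s + 1), z.SameCycle (0, x) (⟨j, hj⟩, x) := by
    intro x j
    induction j with
    | zero => exact fun _ => Equiv.Perm.SameCycle.refl _ _
    | succ j ih =>
      intro hj
      have h := Equiv.Perm.sameCycle_apply_right.2 (ih (by omega))
      rw [hz, if_neg (by rw [Fin.ext_iff, Fin.val_last]; dsimp; omega)] at h
      convert h using 2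
      rw [Fin.ext_iff, Fin.val_add_one_of_lt]
      rw [Fin.lt_def, Fin.val_last]; dsimp; omega
  have h2 : ∀ k : ℕ, z.SameCycle (0, 0) (0, (k : ZMod r)) := by
    intro k
    induction k with
    | zero => simpa using Equiv.Perm.SameCycle.refl z (0, 0)
    | succ k ih =>
      have h := Equiv.Perm.sameCycle_apply_right.2 (ih.trans (h1 k s (by omega)))
      rw [hz, if_pos (show (⟨s, _⟩ : Fin (s + 1)) = Fin.last s from rfl)] at h
      convert h using 2
      · exact (Fin.last_add_one s).symm
      · push_cast; rfl
  refine ⟨z, ?_, ?_⟩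
  · rintro ⟨i, x⟩
    rw [rowShift_apply, hz, hz, rowShift_apply]
    split_ifs <;> rfl
  · rintro ⟨⟨j, hj⟩, x⟩
    have := h2 x.val
    rw [ZMod.natCast_zmod_val] at this
    exact this.trans (h1 x j hj)

theorem not_hasCyclicExtension_of_squarefree (hr : Squarefree r) {s n : ℕ}
    (hX : Nat.card (Fin (s + 1) × ZMod r) = n) :
    ¬ HasCyclicExtension n (fun π : {π : Equiv.Perm (Fin n) //
      ∃ σ : Fin (s + 1) × ZMod r ≃ Fin n, σ.permCongr (rowShift _ r) = π} => Des π.1) := by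
  classical
  intro h
  have h0 := h.sum_initWords_eq_zero (hX ▸ Nat.card_pos)
  have h1 := congrArg (ramanujan r 0 * ·) h0
  simp only [mul_zero, mul_sum, mul_left_comm (ramanujan r 0),
    ramanujan_zero_mul_card_isStd hr hX] at h1
  have h2 : ∀ x : Fin (s + 1) × ZMod r, (∑ w ∈ initWords (Fin (s + 1) × ZMod r) with ∀ y, w y ≤ w x,
      ∑ z : Equiv.Perm (Fin (s + 1) × ZMod r) with IsSym (rowShift _ r) w z,
        (-1) ^ w x * ramanujan r (totalTrans z)) =
      ∑ z : Equiv.Perm (Fin (s + 1) × ZMod r),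
        if (∀ x, z (rowShift _ r x) = rowShift _ r (z x)) ∧ ∀ y, z.SameCycle x y then
          (-1) ^ #r.primeFactors else 0 := by
    intro x
    rw [sum_congr rfl fun w _ => sum_filter _ _, sum_comm]
    refine sum_congr rfl fun z _ => ?_
    by_cases hz : ∀ x, z (rowShift _ r x) = rowShift _ r (z x)
    · have h3 := sum_initWords_invariant z x
      rw [← sum_filter, filter_filter, ← sum_mul]
      rw [filter_congr (q := fun w : _ → ℕ => (∀ y, w (z y) = w y) ∧ ∀ y, w y ≤ w x)
        fun w _ => by rw [IsSym, and_comm]; simp only [hz, implies_true, true_and], h3]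
      by_cases ht : ∀ y, z.SameCycle x y
      · rw [if_pos ht, if_pos ⟨hz, ht⟩, one_mul, ramanujan_of_isUnit (isUnit_totalTrans hz ht)]
      · rw [if_neg ht, if_neg fun h => ht h.2, zero_mul]
    · rw [if_neg fun h => hz h.1]
      exact sum_eq_zero fun w _ => if_neg fun h => hz h.1
  rw [sum_congr rfl fun x _ => h2 x] at h1
  obtain ⟨z, hz, ht⟩ := exists_transitive_commute (r := r) s
  have h4 : (∑ x : Fin (s + 1) × ZMod r, ∑ z : Equiv.Perm (Fin (s + 1) × ZMod r),
      if (∀ x, z (rowShift _ r x) = rowShift _ r (z x)) ∧ ∀ y, z.SameCycle x y then (1 : ℤ)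
        else 0) = 0 := by
    have h5 := congrArg ((-1) ^ #r.primeFactors * ·) h1
    simpa only [mul_sum, mul_ite, mul_zero, ← mul_pow, mul_neg, mul_one, neg_neg, one_pow] using h5
  have h6 := (sum_eq_zero_iff_of_nonneg fun x _ => sum_nonneg fun z _ => by
    split_ifs <;> simp).1 h4 (0, 0) (mem_univ _)
  have h7 := (sum_eq_zero_iff_of_nonneg fun z _ => by split_ifs <;> simp).1 h6 z (mem_univ _)
  rw [if_pos ⟨hz, ht⟩] at h7
  exact one_ne_zero h7
end

theorem parts_partition_eq_fullCycleType {n : ℕ} (π : Equiv.Perm (Fin n)) :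
    π.partition.parts = fullCycleType π := by
  rw [Equiv.Perm.parts_partition, Fintype.card_fin, fullCycleType]

theorem fullCycleType_eq_iff_isConj {n : ℕ} {π τ : Equiv.Perm (Fin n)} :
    fullCycleType π = fullCycleType τ ↔ IsConj π τ := by
  rw [Equiv.Perm.partition_eq_of_isConj, ← parts_partition_eq_fullCycleType,
    ← parts_partition_eq_fullCycleType, Nat.Partition.ext_iff]

theorem permCongr_pow_apply {X Y : Type*} (e : X ≃ Y) (π : Equiv.Perm X) (k : ℕ) (x : X) :
    ((e.permCongr π) ^ k) (e x) = e ((π ^ k) x) := by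
  induction k with
  | zero => rfl
  | succ k ih => simp [pow_succ', ih]

theorem fullCycleType_permCongr_rowShift {ι : Type*} {r n : ℕ} [NeZero r]
    (e : ι × ZMod r ≃ Fin n) :
    ∀ m ∈ fullCycleType (e.permCongr (rowShift ι r)), m = r := by
  intro m hm
  set π := e.permCongr (rowShift ι r) with hπ
  have hpow : ∀ k a, (π ^ k) a = a ↔ r ∣ k := by
    intro k a
    obtain ⟨⟨i, x⟩, rfl⟩ := e.surjective a
    rw [hπ, permCongr_pow_apply, e.apply_eq_iff_eq, rowShift_pow_apply, Prod.mk.injEq,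
      and_iff_right rfl, add_eq_left, ZMod.natCast_eq_zero_iff]
  rw [fullCycleType, Multiset.mem_add] at hm
  rcases hm with hm | hm
  · have h1 : m ∣ r := (Equiv.Perm.dvd_of_mem_cycleType hm).trans
      (orderOf_dvd_of_pow_eq_one (Equiv.ext fun a => (hpow r a).2 dvd_rfl))
    rw [Equiv.Perm.cycleType_def, Multiset.mem_map] at hm
    obtain ⟨c, hc, rfl⟩ := hm
    rw [mem_val] at hc
    have hcy := (Equiv.Perm.mem_cycleFactorsFinset_iff.1 hc).1
    obtain ⟨a, ha⟩ := hcy.nonempty_support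
    refine Nat.dvd_antisymm h1 ((hpow _ a).1 ?_)
    rw [← Equiv.Perm.cycleOf_pow_apply_self, ← Equiv.Perm.cycle_is_cycleOf ha hc,
      Function.comp_apply, ← hcy.orderOf, pow_orderOf_eq_one, Equiv.Perm.one_apply]
  · rw [Multiset.mem_replicate] at hm
    obtain ⟨h1, rfl⟩ := hm
    have h2 : #π.support ≠ Fintype.card (Fin n) := by rw [Fintype.card_fin]; omega
    rw [Ne, card_eq_iff_eq_univ, eq_univ_iff_forall] at h2
    push Not at h2
    obtain ⟨a, ha⟩ := h2
    rw [Equiv.Perm.notMem_support, ← pow_one π, hpow, Nat.dvd_one] at ha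
    exact ha.symm

theorem fullCycleType_eq_replicate_iff {r s : ℕ} [NeZero r] (π : Equiv.Perm (Fin (r * s))) :
    fullCycleType π = Multiset.replicate s r ↔
      ∃ σ : Fin s × ZMod r ≃ Fin (r * s), σ.permCongr (rowShift (Fin s) r) = π := by
  have hr : 0 < r := Nat.pos_of_neZero r
  have key : ∀ e : Fin s × ZMod r ≃ Fin (r * s),
      fullCycleType (e.permCongr (rowShift (Fin s) r)) = Multiset.replicate s r := by
    intro e
    have h1 := fullCycleType_permCongr_rowShift e
    rw [Multiset.eq_replicate]
    refine ⟨?_, h1⟩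
    have h2 := (e.permCongr (rowShift (Fin s) r)).partition.parts_sum
    rw [parts_partition_eq_fullCycleType, Fintype.card_fin, Multiset.eq_replicate_card.2 h1,
      Multiset.sum_replicate, smul_eq_mul, mul_comm] at h2
    exact Nat.eq_of_mul_eq_mul_left hr h2
  constructor
  · intro h
    have e : Fin s × ZMod r ≃ Fin (r * s) :=
      Fintype.equivFinOfCardEq (by simp [ZMod.card, mul_comm])
    rw [← key e, fullCycleType_eq_iff_isConj, isConj_comm, isConj_iff] at h
    obtain ⟨c, hc⟩ := h
    exact ⟨e.trans c, by rw [← hc]; ext a; simp [Equiv.permCongr_apply]⟩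
  · rintro ⟨e, rfl⟩
    exact key e

theorem hasCyclicExtension_congr {n : ℕ} {P Q : Equiv.Perm (Fin n) → Prop}
    (h : ∀ π, P π ↔ Q π) :
    HasCyclicExtension n (fun π : {π // P π} => Des π.1) ↔
      HasCyclicExtension n (fun π : {π // Q π} => Des π.1) := by
  obtain rfl : P = Q := funext fun π => propext (h π)
  rfl

/-- For `r, s ≥ 1` and `n = r * s`, the descent map on the conjugacy class
`C_{(r^s)} ⊆ S_n` admits a cyclic extension iff `r` is not squarefree. -/
theorem stmt2 (r s : ℕ) (hr : 1 ≤ r) (hs : 1 ≤ s) :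
    HasCyclicExtension (r * s)
      (fun π : {π : Equiv.Perm (Fin (r * s)) //
          fullCycleType π = Multiset.replicate s r} => Des π.1) ↔
    ¬ Squarefree r := by
  have : NeZero r := ⟨by omega⟩
  have : NeZero s := ⟨by omega⟩
  have hX : Nat.card (Fin s × ZMod r) = r * s := by
    rw [Nat.card_prod, Nat.card_zmod, Nat.card_fin, mul_comm]
  rw [hasCyclicExtension_congr fullCycleType_eq_replicate_iff]
  constructor
  · intro h hsq
    obtain ⟨s, rfl⟩ := Nat.exists_eq_add_of_le' hs
    exact not_hasCyclicExtension_of_squarefree hsq hX h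
  · intro h
    rw [Nat.squarefree_iff_prime_squarefree] at h
    push Not at h
    obtain ⟨p, hp, hpr⟩ := h
    exact ((hasCyclicModel_single hp hpr).prod hX).hasCyclicExtension
end
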